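/- arXiv:1705.01199 — 2 statements merged into one kernel-verified Lean document; each statement's English description precedes it below -/
import Mathlib

section
/- If G is a 4-edge-connected multigraph and r is any vertex of G, then G has a chain decomposition rooted at r. -/
set_option autoImplicit false

/-- A multigraph: a type of vertices, a type of edges, and a map assigning to each
edge its unordered pair of endpoints (a loop has endpoints `s(v, v)`). -/
structure MG : Type 1 where
  V : Type
  E : Type
  ends : E → Sym2 V

namespace MG

variable (G : MG)

/-- The set of vertices covered by a set `F` of edges. -/
def vertsOf (F : Set G.E) : Set G.V := {v | ∃ e ∈ F, v ∈ G.ends e}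

/-- The degree of a vertex `v` with respect to a set `F` of edges;
a loop contributes two to the degree. -/
noncomputable def deg (F : Set G.E) (v : G.V) : ℕ :=
  {e ∈ F | v ∈ G.ends e}.ncard + {e ∈ F | G.ends e = s(v, v)}.ncard

/-- `G` has no isolated vertices. -/
def NoIsolated : Prop := ∀ v : G.V, ∃ e : G.E, v ∈ G.ends e

/-- `IsLink vs es`: the edge list `es` successively links the consecutive
vertices of the vertex list `vs`. -/
def IsLink : List G.V → List G.E → Prop
  | [_], [] => True
  | a :: b :: vs, e :: es => G.ends e = s(a, b) ∧ IsLink (b :: vs) es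
  | _, _ => False

/-- `vs, es` form a (simple) path: distinct vertices, distinct edges, consecutive linking. -/
def IsPath (vs : List G.V) (es : List G.E) : Prop :=
  vs.Nodup ∧ es.Nodup ∧ G.IsLink vs es

/-- `v :: vs, es` form a (simple) cycle through the basepoint `v`:
the distinct vertices `v :: vs` are linked cyclically by the distinct edges `es`.
A loop gives a cycle of length one and two parallel edges give a cycle of length two. -/
def IsCycle (v : G.V) (vs : List G.V) (es : List G.E) : Prop :=
  (v :: vs).Nodup ∧ es.Nodup ∧ es ≠ [] ∧ G.IsLink (v :: (vs ++ [v])) es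

/-- Reachability using only edges from `F`. -/
def Reach (F : Set G.E) : G.V → G.V → Prop :=
  Relation.ReflTransGen (fun a b => ∃ e ∈ F, G.ends e = s(a, b))

/-- `G` with edge set restricted to `F` is connected as a graph on all of `G.V`. -/
def ConnectedOn (F : Set G.E) : Prop := ∀ a b : G.V, G.Reach F a b

/-- The subgraph formed by the edge set `F` together with the vertices it covers
is connected. -/
def ConnectedWithin (F : Set G.E) : Prop :=
  ∀ a ∈ G.vertsOf F, ∀ b ∈ G.vertsOf F, G.Reach F a b

/-- `G` is 4-edge-connected: at least two vertices, and deleting any set of fewer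
than four edges leaves the graph connected. -/
def FourEdgeConnected : Prop :=
  2 ≤ Nat.card G.V ∧ ∀ S : Set G.E, S.Finite → S.ncard < 4 → G.ConnectedOn Sᶜ

/-- `e` is a cut edge of the subgraph formed by the edge set `F`: removing `e`
disconnects two vertices of that subgraph. -/
def IsCutEdge (F : Set G.E) (e : G.E) : Prop :=
  e ∈ F ∧ ∃ a ∈ G.vertsOf F, ∃ b ∈ G.vertsOf F, ¬ G.Reach (F \ {e}) a b

/-! ### Chains -/

/-- An open up chain with respect to `(H, Hb)`, rooted at `r`: a path with at least
one edge, edge-disjoint from `H` and `Hb`, in which every vertex is `r` or has degree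
at least two in `Hb`, and whose ends are `r` or lie in `H`. -/
def IsOpenUpChain (r : G.V) (H Hb C : Set G.E) : Prop :=
  Disjoint C H ∧ Disjoint C Hb ∧
  ∃ vs es, G.IsPath vs es ∧ es ≠ [] ∧ C = {e | e ∈ es} ∧
    (∀ v ∈ vs, v = r ∨ 2 ≤ G.deg Hb v) ∧
    (∀ v, vs.head? = some v → v = r ∨ v ∈ G.vertsOf H) ∧
    (∀ v, vs.getLast? = some v → v = r ∨ v ∈ G.vertsOf H)

/-- A closed up chain with respect to `(H, Hb)`, rooted at `r`, with common end `v`: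
a cycle through `v`, edge-disjoint from `H` and `Hb`, in which every vertex is `r` or
has degree at least two in `Hb`, and the end `v` is `r` or has degree at least two in `H`. -/
def IsClosedUpChain (r : G.V) (H Hb C : Set G.E) (v : G.V) : Prop :=
  Disjoint C H ∧ Disjoint C Hb ∧
  ∃ vs es, G.IsCycle v vs es ∧ C = {e | e ∈ es} ∧
    (∀ u ∈ v :: vs, u = r ∨ 2 ≤ G.deg Hb u) ∧
    (v = r ∨ 2 ≤ G.deg H v)

/-- An up chain with respect to `(H, Hb)`. -/
def IsUpChain (r : G.V) (H Hb C : Set G.E) : Prop :=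
  G.IsOpenUpChain r H Hb C ∨ ∃ v, G.IsClosedUpChain r H Hb C v

/-- A down chain with respect to `(H, Hb)` is an up chain with respect to `(Hb, H)`. -/
def IsDownChain (r : G.V) (H Hb C : Set G.E) : Prop := G.IsUpChain r Hb H C

/-- A closed down chain with respect to `(H, Hb)` with common end `v`. -/
def IsClosedDownChain (r : G.V) (H Hb C : Set G.E) (v : G.V) : Prop :=
  G.IsClosedUpChain r Hb H C v

/-- A one-way chain with respect to `(H, Hb)`, with tail `u` and head `v`:
a single edge `e ∉ H ∪ Hb` with ends `u` and `v`, where the tail `u` is `r` or has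
degree at least two in `H`, and the head `v` is `r` or has degree at least two in `Hb`. -/
def IsOneWayChainAt (r : G.V) (H Hb C : Set G.E) (u v : G.V) : Prop :=
  ∃ e, e ∉ H ∧ e ∉ Hb ∧ C = {e} ∧ G.ends e = s(u, v) ∧
    (u = r ∨ 2 ≤ G.deg H u) ∧ (v = r ∨ 2 ≤ G.deg Hb v)

/-- A one-way chain with respect to `(H, Hb)`. -/
def IsOneWayChain (r : G.V) (H Hb C : Set G.E) : Prop :=
  ∃ u v, G.IsOneWayChainAt r H Hb C u v

/-- A chain with respect to `(H, Hb)`: an up chain, a down chain, or a one-way chain. -/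
def IsChain (r : G.V) (H Hb C : Set G.E) : Prop :=
  G.IsUpChain r H Hb C ∨ G.IsDownChain r H Hb C ∨ G.IsOneWayChain r H Hb C

/-- `H_i`: the union of the chains with index `< i`. -/
def before {n : ℕ} (Gs : Fin n → Set G.E) (i : Fin n) : Set G.E :=
  {e | ∃ j, j < i ∧ e ∈ Gs j}

/-- `Hbar_i`: the union of the chains with index `> i`. -/
def after {n : ℕ} (Gs : Fin n → Set G.E) (i : Fin n) : Set G.E :=
  {e | ∃ j, i < j ∧ e ∈ Gs j}

/-- `Gs` is a chain decomposition, rooted at `r`, of the part of `G` with edge set `F`: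
the `Gs i` partition `F`, and each `Gs i` is an up chain, a down chain or a one-way
chain with respect to `(H_i, Hbar_i)`. -/
def IsChainDecompOn (F : Set G.E) (r : G.V) {n : ℕ} (Gs : Fin n → Set G.E) : Prop :=
  (∀ i j, i ≠ j → Disjoint (Gs i) (Gs j)) ∧ (⋃ i, Gs i) = F ∧
  ∀ i, G.IsChain r (G.before Gs i) (G.after Gs i) (Gs i)

/-- `Gs` is a chain decomposition of `G` rooted at `r`. -/
def IsChainDecomp (r : G.V) {n : ℕ} (Gs : Fin n → Set G.E) : Prop :=
  G.IsChainDecompOn Set.univ r Gs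

/-- `G` has a chain decomposition rooted at `r`. -/
def HasChainDecomp (r : G.V) : Prop :=
  ∃ (m : ℕ) (Gs : Fin (m + 1) → Set G.E), G.IsChainDecomp r Gs

/-- A minimal open up chain: an open up chain none of whose internal vertices
lies in `{r} ∪ V(H)`. -/
def IsMinimalOpenUpChain (r : G.V) (H Hb C : Set G.E) : Prop :=
  Disjoint C H ∧ Disjoint C Hb ∧
  ∃ vs es, G.IsPath vs es ∧ es ≠ [] ∧ C = {e | e ∈ es} ∧
    (∀ v ∈ vs, v = r ∨ 2 ≤ G.deg Hb v) ∧
    (∀ v, vs.head? = some v → v = r ∨ v ∈ G.vertsOf H) ∧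
    (∀ v, vs.getLast? = some v → v = r ∨ v ∈ G.vertsOf H) ∧
    (∀ v ∈ vs, vs.head? ≠ some v → vs.getLast? ≠ some v → v ≠ r ∧ v ∉ G.vertsOf H)

/-- A minimal up chain: an up chain none of whose internal vertices lies in
`{r} ∪ V(H)`. -/
def IsMinimalUpChain (r : G.V) (H Hb C : Set G.E) : Prop :=
  G.IsMinimalOpenUpChain r H Hb C ∨
  ∃ v, G.IsClosedUpChain r H Hb C v ∧
    ∀ u ∈ G.vertsOf C, u ≠ v → u ≠ r ∧ u ∉ G.vertsOf H

/-- A minimal down chain: a down chain none of whose internal vertices lies in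
`{r} ∪ V(Hb)`. -/
def IsMinimalDownChain (r : G.V) (H Hb C : Set G.E) : Prop :=
  G.IsMinimalUpChain r Hb H C

/-- A minimal chain decomposition (of the part of `G` with edge set `F`):
a chain decomposition all of whose up chains and down chains are minimal. -/
def IsMinimalChainDecompOn (F : Set G.E) (r : G.V) {n : ℕ} (Gs : Fin n → Set G.E) : Prop :=
  G.IsChainDecompOn F r Gs ∧
  ∀ i, G.IsMinimalUpChain r (G.before Gs i) (G.after Gs i) (Gs i) ∨
       G.IsMinimalDownChain r (G.before Gs i) (G.after Gs i) (Gs i) ∨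
       G.IsOneWayChain r (G.before Gs i) (G.after Gs i) (Gs i)

/-- A minimal chain decomposition of `G` rooted at `r`. -/
def IsMinimalChainDecomp (r : G.V) {n : ℕ} (Gs : Fin n → Set G.E) : Prop :=
  G.IsMinimalChainDecompOn Set.univ r Gs

/-! ### Subgraphs, trees and edge-independence -/

/-- A subgraph of `G`: a set of vertices together with a set of edges all of whose
endpoints lie in the vertex set. -/
structure Sub (G : MG) where
  verts : Set G.V
  edges : Set G.E
  valid : ∀ e ∈ edges, ∀ v ∈ G.ends e, v ∈ verts

/-- A subgraph is connected. -/
def Sub.Connected {G : MG} (T : Sub G) : Prop :=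
  T.verts.Nonempty ∧ ∀ a ∈ T.verts, ∀ b ∈ T.verts,
    Relation.ReflTransGen (fun x y => ∃ e ∈ T.edges, G.ends e = s(x, y)) a b

/-- A subgraph is a tree: connected and containing no cycle. -/
def Sub.IsTree {G : MG} (T : Sub G) : Prop :=
  T.Connected ∧ ¬ ∃ v vs es, G.IsCycle v vs es ∧ ∀ e ∈ es, e ∈ T.edges

/-- A subgraph is spanning. -/
def Sub.Spanning {G : MG} (T : Sub G) : Prop := T.verts = Set.univ

/-- `vs, es` is a path from `a` to `b` all of whose edges lie in the subgraph `T`. -/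
def Sub.PathIn {G : MG} (T : Sub G) (a b : G.V) (vs : List G.V) (es : List G.E) : Prop :=
  G.IsPath vs es ∧ vs.head? = some a ∧ vs.getLast? = some b ∧ ∀ e ∈ es, e ∈ T.edges

/-- Two subtrees of `G` are edge-independent with root `r`: each contains `r`, and for
every common vertex `v`, the path between `r` and `v` in one tree is edge-disjoint from
the path between `r` and `v` in the other. -/
def EdgeIndependent (r : G.V) (T₁ T₂ : Sub G) : Prop :=
  r ∈ T₁.verts ∧ r ∈ T₂.verts ∧
  ∀ v ∈ T₁.verts ∩ T₂.verts, ∀ vs₁ es₁ vs₂ es₂,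
    T₁.PathIn r v vs₁ es₁ → T₂.PathIn r v vs₂ es₂ → ∀ e ∈ es₁, e ∉ es₂

/-- `G` has a set of four edge-independent spanning trees rooted at `r`. -/
def HasFourEIST (r : G.V) : Prop :=
  ∃ T : Fin 4 → Sub G, (∀ i, (T i).IsTree ∧ (T i).Spanning) ∧
    ∀ i j, i ≠ j → G.EdgeIndependent r (T i) (T j)

/-! ### Mader operations -/

/-- Add to `G` a new edge with the (not necessarily distinct) endpoints `p`. -/
def addEdge (p : Sym2 G.V) : MG :=
  ⟨G.V, Option G.E, fun e => e.elim p G.ends⟩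

/-- Pinch the two distinct edges `e₁` (with ends `x`, `y`) and `e₂` (with ends `z`, `w`):
delete `e₁` and `e₂`, add a new vertex (`none`), and add four new edges joining the new
vertex to `x`, `y`, `z`, `w` respectively. -/
def pinch (e₁ e₂ : G.E) (x y z w : G.V) : MG where
  V := Option G.V
  E := {e : G.E // e ≠ e₁ ∧ e ≠ e₂} ⊕ Fin 4
  ends := fun e =>
    Sum.elim (fun e' => (G.ends e'.1).map some)
      (fun i =>
        if i = 0 then s((none : Option G.V), some x)
        else if i = 1 then s((none : Option G.V), some y)
        else if i = 2 then s((none : Option G.V), some z)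
        else s((none : Option G.V), some w)) e

end MG

/-- A multigraph with a distinguished root vertex. -/
structure PMG : Type 1 where
  G : MG
  r : G.V

/-- A single Mader operation on a rooted multigraph: either add an edge, or pinch two
distinct edges. -/
inductive MaderStep : PMG → PMG → Prop
  | addEdge (P : PMG) (p : Sym2 P.G.V) : MaderStep P ⟨P.G.addEdge p, P.r⟩
  | pinch (P : PMG) (e₁ e₂ : P.G.E) (x y z w : P.G.V) (hne : e₁ ≠ e₂)
      (h₁ : P.G.ends e₁ = s(x, y)) (h₂ : P.G.ends e₂ = s(z, w)) :
      MaderStep P ⟨P.G.pinch e₁ e₂ x y z w, some P.r⟩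

/-- The starting graph `G⁰` of the Mader construction: two vertices joined by four
parallel edges, rooted at one of them. -/
def basePMG : PMG :=
  ⟨⟨Bool, Fin 4, fun _ => s(false, true)⟩, false⟩

/-- An isomorphism of rooted multigraphs: bijections on vertices and edges commuting
with the endpoint maps and sending root to root. -/
def PIso (P Q : PMG) : Prop :=
  ∃ (fV : P.G.V ≃ Q.G.V) (fE : P.G.E ≃ Q.G.E),
    (∀ e, Q.G.ends (fE e) = (P.G.ends e).map fV) ∧ fV P.r = Q.r

/-- `G`, rooted at `r`, can be built from `basePMG` by repeatedly performing
Mader operations. -/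
def MaderConstructible (G : MG) (r : G.V) : Prop :=
  ∃ Q : PMG, Relation.ReflTransGen MaderStep basePMG Q ∧ PIso Q ⟨G, r⟩

namespace ChainDecomp

variable {V E : Type}

/-! ### Degrees of multisets of edges -/

open Classical in
/-- The contribution of an edge with endpoints `s` to the degree of `x`. -/
noncomputable def cnt (s : Sym2 V) (x : V) : ℕ :=
  (if x ∈ s then 1 else 0) + (if s = s(x, x) then 1 else 0)

open Classical in
theorem cnt_mk (a b x : V) :
    cnt s(a, b) x = (if a = x then 1 else 0) + (if b = x then 1 else 0) := by
  unfold cnt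
  simp only [Sym2.mem_iff, Sym2.eq_iff]
  by_cases h1 : a = x <;> by_cases h2 : b = x <;> simp [h1, h2, eq_comm]

/-- The degree of `x` in a multiset of edges with endpoints given by `f`. -/
noncomputable def dg (f : E → Sym2 V) (M : Multiset E) (x : V) : ℕ :=
  (M.map fun e => cnt (f e) x).sum

variable {f f' : E → Sym2 V} {r : V}

@[simp] theorem dg_zero (x : V) : dg f 0 x = 0 := by simp [dg]

@[simp] theorem dg_cons (e : E) (M : Multiset E) (x : V) :
    dg f (e ::ₘ M) x = cnt (f e) x + dg f M x := by simp [dg]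

@[simp] theorem dg_singleton (e : E) (x : V) : dg f {e} x = cnt (f e) x := by simp [dg]

@[simp] theorem dg_add (M N : Multiset E) (x : V) :
    dg f (M + N) x = dg f M x + dg f N x := by simp [dg]

theorem dg_congr {M : Multiset E} (h : ∀ e ∈ M, f' e = f e) (x : V) : dg f' M x = dg f M x := by
  unfold dg
  rw [Multiset.map_congr rfl]
  intro e he
  rw [h e he]

theorem dg_eq_zero {M : Multiset E} {x : V} (h : ∀ e ∈ M, x ∉ f e) : dg f M x = 0 := by
  unfold dg
  rw [Multiset.sum_eq_zero]
  intro n hn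
  obtain ⟨e, he, rfl⟩ := Multiset.mem_map.1 hn
  have hx := h e he
  unfold cnt
  have hx' : f e ≠ s(x, x) := fun h' => hx (by simp [h'])
  simp [hx, hx']

/-- A vertex is big in `M` if it is the root or has degree at least two in `M`. -/
def Big (f : E → Sym2 V) (r : V) (M : Multiset E) (x : V) : Prop := x = r ∨ 2 ≤ dg f M x

/-- The edges of `M` provide distinct edge-ends at `a` and `b`, the root being exempt. -/
def Cap (f : E → Sym2 V) (r : V) (M : Multiset E) (a b : V) : Prop :=
  ∀ u, u ≠ r → cnt s(a, b) u ≤ dg f M u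

/-! ### Trails and ears -/

/-- A walk with edges `m` all of whose vertices satisfy `P`. -/
inductive Tr (f : E → Sym2 V) (P : V → Prop) : V → Multiset E → V → Prop
  | nil {a : V} : P a → Tr f P a 0 a
  | cons {a b c : V} {e : E} {m : Multiset E} :
      P a → f e = s(a, b) → Tr f P b m c → Tr f P a (e ::ₘ m) c

/-- A walk from a vertex satisfying `A` all of whose further vertices satisfy `B`. -/
inductive Arm (f : E → Sym2 V) (A B : V → Prop) : Multiset E → V → Prop
  | base {x : V} : A x → Arm f A B 0 x
  | step {m : Multiset E} {x y : V} {e : E} :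
      Arm f A B m x → f e = s(x, y) → B y → Arm f A B (e ::ₘ m) y

/-- An ear whose ends satisfy `A` and whose internal vertices satisfy `B`,
presented through one of its edges `g`. -/
def UEar (f : E → Sym2 V) (A B : V → Prop) (c : Multiset E) : Prop :=
  ∃ g x y m₁ m₂, c = g ::ₘ (m₁ + m₂) ∧ f g = s(x, y) ∧ Arm f A B m₁ x ∧ Arm f A B m₂ y ∧
    (B x ∨ B y)

/-- An ear with respect to the earlier edges `H` and the later edges `K`: either empty, or an
ear on vertices visited by `H` whose internal vertices are big in `K`, or a trail on visited
vertices whose ends are covered by `K`. -/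
def Ear (f : E → Sym2 V) (r : V) (H c K : Multiset E) : Prop :=
  c = 0 ∨ UEar f (Big f r H) (Big f r K) c ∨
    ∃ a b, Tr f (Big f r H) a c b ∧ Cap f r K a b

theorem Tr.start {P : V → Prop} {a b : V} {m : Multiset E} (h : Tr f P a m b) : P a := by
  cases h <;> assumption

theorem Tr.last {P : V → Prop} {a b : V} {m : Multiset E} (h : Tr f P a m b) : P b := by
  induction h <;> assumption

theorem Tr.trans {P : V → Prop} {a b c : V} {m n : Multiset E} (h : Tr f P a m b)
    (h' : Tr f P b n c) : Tr f P a (m + n) c := by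
  induction h with
  | nil _ => simpa using h'
  | cons ha he _ ih => rw [Multiset.cons_add]; exact .cons ha he (ih h')

theorem Tr.single {P : V → Prop} {a b : V} {e : E} (ha : P a) (hb : P b) (he : f e = s(a, b)) :
    Tr f P a {e} b := .cons ha he (.nil hb)

theorem Tr.symm {P : V → Prop} {a b : V} {m : Multiset E} (h : Tr f P a m b) :
    Tr f P b m a := by
  induction h with
  | nil ha => exact .nil ha
  | cons ha he h ih =>
    have := ih.trans (.single h.start ha (he.trans Sym2.eq_swap))
    rwa [add_comm, Multiset.singleton_add] at this

theorem Tr.mono {P P' : V → Prop} {a b : V} {m : Multiset E} (h : Tr f P a m b)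
    (hf : ∀ e ∈ m, f' e = f e) (hP : ∀ x, P x → P' x) : Tr f' P' a m b := by
  induction h with
  | nil ha => exact .nil (hP _ ha)
  | cons ha he h ih =>
    exact .cons (hP _ ha) ((hf _ (Multiset.mem_cons_self _ _)).trans he)
      (ih fun e h => hf e (Multiset.mem_cons_of_mem h))

theorem Tr.split {P : V → Prop} {a b : V} {m : Multiset E} (h : Tr f P a m b) {e : E}
    (he : e ∈ m) : ∃ x y m₁ m₂, m = e ::ₘ (m₁ + m₂) ∧ f e = s(x, y) ∧ Tr f P a m₁ x ∧
      Tr f P y m₂ b := by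
  induction h with
  | nil _ => simp at he
  | @cons a b c e' m ha hf h ih =>
    rcases Multiset.mem_cons.1 he with rfl | he
    · exact ⟨a, b, 0, m, by simp, hf, .nil ha, h⟩
    · obtain ⟨x, y, m₁, m₂, rfl, hxy, h₁, h₂⟩ := ih he
      refine ⟨x, y, e' ::ₘ m₁, m₂, ?_, hxy, .cons ha hf h₁, h₂⟩
      rw [Multiset.cons_add, Multiset.cons_swap]

theorem Tr.of_touch {P : V → Prop} {a b : V} {m : Multiset E} (h : Tr f P a m b) {x : V}
    (hx : dg f m x ≠ 0) : P x := by
  classical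
  induction h with
  | nil _ => simp at hx
  | @cons _ _ _ _ m ha he h ih =>
    by_cases h0 : dg f m x = 0
    · rw [dg_cons, h0, he, cnt_mk] at hx
      split_ifs at hx with h1 h2 h2
      · exact h1 ▸ ha
      · exact h1 ▸ ha
      · exact h2 ▸ h.start
      · simp at hx
    · exact ih h0

theorem Tr.dg_start {P : V → Prop} {a b : V} {m : Multiset E} (h : Tr f P a m b) (hm : m ≠ 0) :
    dg f m a ≠ 0 := by
  classical
  cases h with
  | nil _ => simp at hm
  | cons ha he h => rw [dg_cons, he, cnt_mk]; simp

theorem Arm.mono {A A' B B' : V → Prop} {x : V} {m : Multiset E} (h : Arm f A B m x)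
    (hf : ∀ e ∈ m, f' e = f e) (hA : ∀ x, A x → A' x) (hB : ∀ x, B x → B' x) :
    Arm f' A' B' m x := by
  induction h with
  | base ha => exact .base (hA _ ha)
  | step h he hb ih =>
    exact .step (ih fun e h => hf e (Multiset.mem_cons_of_mem h))
      ((hf _ (Multiset.mem_cons_self _ _)).trans he) (hB _ hb)

theorem Arm.extend {A B : V → Prop} {x y : V} {m n : Multiset E} (h : Arm f A B m x)
    (h' : Tr f B x n y) : Arm f A B (n + m) y := by
  induction h' generalizing m with
  | nil _ => simpa using h
  | cons ha he h' ih =>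
    have := ih (.step h he h'.start)
    rwa [Multiset.cons_add, ← Multiset.add_cons]

theorem Arm.split {A B : V → Prop} {x : V} {m : Multiset E} (h : Arm f A B m x) {e : E}
    (he : e ∈ m) : ∃ u w m₁ m₂, m = e ::ₘ (m₁ + m₂) ∧ f e = s(u, w) ∧ Arm f A B m₁ u ∧
      Tr f B w m₂ x := by
  induction h with
  | base _ => simp at he
  | @step m x y e' h hf hy ih =>
    rcases Multiset.mem_cons.1 he with rfl | he
    · exact ⟨x, y, m, 0, by simp, hf, h, .nil hy⟩
    · obtain ⟨u, w, m₁, m₂, rfl, huw, h₁, h₂⟩ := ih he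
      refine ⟨u, w, m₁, m₂ + {e'}, ?_, huw, h₁, h₂.trans (.single h₂.last hy hf)⟩
      simp only [← Multiset.singleton_add]
      abel

theorem Arm.last {A B : V → Prop} {x : V} {m : Multiset E} (h : Arm f A B m x) : A x ∨ B x := by
  cases h <;> tauto

theorem Arm.of_touch {A B : V → Prop} {x u : V} {m : Multiset E} (h : Arm f A B m x)
    (hu : dg f m u ≠ 0) : A u ∨ B u := by
  classical
  induction h with
  | base _ => simp at hu
  | @step m _ _ _ h he hy ih =>
    by_cases h0 : dg f m u = 0
    · rw [dg_cons, h0, he, cnt_mk] at hu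
      split_ifs at hu with h1 h2 h2
      · exact h1 ▸ h.last
      · exact h1 ▸ h.last
      · exact h2 ▸ .inr hy
      · simp at hu
    · exact ih h0

theorem UEar.mono {A A' B B' : V → Prop} {c : Multiset E} (h : UEar f A B c)
    (hf : ∀ e ∈ c, f' e = f e) (hA : ∀ x, A x → A' x) (hB : ∀ x, B x → B' x) :
    UEar f' A' B' c := by
  obtain ⟨g, x, y, m₁, m₂, rfl, hg, h₁, h₂, h⟩ := h
  refine ⟨g, x, y, m₁, m₂, rfl, (hf g (by simp)).trans hg, h₁.mono ?_ hA hB, h₂.mono ?_ hA hB,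
    h.imp (hB _) (hB _)⟩ <;>
  · intro e he
    exact hf e (by simp [he])

/-- Any edge of an ear can be used to present it. -/
theorem UEar.reroot {A B : V → Prop} {c : Multiset E} (h : UEar f A B c) {e : E} (he : e ∈ c) :
    ∃ x y m₁ m₂, c = e ::ₘ (m₁ + m₂) ∧ f e = s(x, y) ∧ Arm f A B m₁ x ∧ Arm f A B m₂ y ∧
      (B x ∨ B y) := by
  have key : ∀ {m₁ x}, Arm f A B m₁ x → e ∈ m₁ → ∀ {g y m₂}, f g = s(x, y) → Arm f A B m₂ y →
      ∃ x' y' n₁ n₂, g ::ₘ (m₁ + m₂) = e ::ₘ (n₁ + n₂) ∧ f e = s(x', y') ∧ Arm f A B n₁ x' ∧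
        Arm f A B n₂ y' ∧ (B x' ∨ B y') := by
    intro m₁ x h
    induction h with
    | base _ => simp
    | @step m x' x e' h hf hx ih =>
      intro he g y m₂ hg h₂
      have h₂' := Arm.step h₂ (hg.trans Sym2.eq_swap) hx
      rcases Multiset.mem_cons.1 he with rfl | he
      · refine ⟨x', x, m, g ::ₘ m₂, ?_, hf, h, h₂', .inr hx⟩
        rw [Multiset.cons_add, Multiset.cons_swap, Multiset.add_cons]
      · obtain ⟨a, b, n₁, n₂, h0, h1⟩ := ih he hf h₂'
        refine ⟨a, b, n₁, n₂, ?_, h1⟩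
        rw [← h0, Multiset.cons_add, Multiset.cons_swap, Multiset.add_cons]
  obtain ⟨g, x, y, m₁, m₂, rfl, hg, h₁, h₂, h⟩ := h
  rcases Multiset.mem_cons.1 he with rfl | he
  · exact ⟨x, y, m₁, m₂, rfl, hg, h₁, h₂, h⟩
  rcases Multiset.mem_add.1 he with he | he
  · exact key h₁ he hg h₂
  · rw [add_comm m₁]
    exact key h₂ he (hg.trans Sym2.eq_swap) h₁

theorem UEar.of_touch {A B : V → Prop} {c : Multiset E} (h : UEar f A B c) {u : V}
    (hu : dg f c u ≠ 0) : A u ∨ B u := by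
  classical
  obtain ⟨g, x, y, m₁, m₂, rfl, hg, h₁, h₂, h⟩ := h
  by_cases hm₁ : dg f m₁ u = 0
  · by_cases hm₂ : dg f m₂ u = 0
    · rw [dg_cons, dg_add, hm₁, hm₂, hg, cnt_mk] at hu
      split_ifs at hu with a b b
      · exact a ▸ h₁.last
      · exact a ▸ h₁.last
      · exact b ▸ h₂.last
      · simp at hu
    · exact h₂.of_touch hm₂
  · exact h₁.of_touch hm₁

theorem Big.mono {M M' : Multiset E} {x : V} (h : Big f r M x) (hM : dg f M x ≤ dg f' M' x) :
    Big f' r M' x := h.imp_right fun h => h.trans hM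

/-- A vertex visited by an ear is big in the earlier edges or in the later edges. -/
theorem Ear.big_of_touch {H c K : Multiset E} (h : Ear f r H c K) {x : V}
    (hx : dg f c x ≠ 0) : Big f r H x ∨ Big f r K x := by
  rcases h with rfl | h | ⟨a, b, h, -⟩
  · simp at hx
  · exact h.of_touch hx
  · exact .inl (h.of_touch hx)

theorem Ear.mono {H c K H' K' : Multiset E} (h : Ear f r H c K) (hf : ∀ e ∈ c, f' e = f e)
    (hH : ∀ u, dg f H u ≤ dg f' H' u)
    (hK : ∀ u, dg f K u ≤ dg f' K' u ∨ (u ≠ r ∧ dg f c u = 0 ∧ dg f K u ≤ 1)) :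
    Ear f' r H' c K' := by
  classical
  have hB : ∀ u, Big f r K u → Big f' r K' u := by
    intro u hu
    rcases hK u with h | ⟨h1, -, h2⟩
    · exact hu.mono h
    · rcases hu with hu | hu
      · exact absurd hu h1
      · omega
  rcases h with h | h | ⟨a, b, h, hc⟩
  · exact .inl h
  · exact .inr (.inl (h.mono hf (fun u hu => hu.mono (hH u)) hB))
  · by_cases h0 : c = 0
    · exact .inl h0
    refine .inr (.inr ⟨a, b, h.mono hf (fun u hu => hu.mono (hH u)), fun u hu => ?_⟩)
    rcases hK u with hK | ⟨-, h2, -⟩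
    · exact (hc u hu).trans hK
    · have ha := h.dg_start h0
      have hb := h.symm.dg_start h0
      rw [cnt_mk, if_neg, if_neg]
      · simp
      · rintro rfl; exact hb h2
      · rintro rfl; exact ha h2

/-! ### Sequences of edge sets -/

/-- Every member `c` of the list satisfies `P` with respect to the edges before and after it. -/
def Valid (P : Multiset E → Multiset E → Multiset E → Prop) :
    Multiset E → List (Multiset E) → Multiset E → Prop
  | _, [], _ => True
  | H, c :: cs, K => P H c (cs.sum + K) ∧ Valid P (H + c) cs K

theorem valid_append {P : Multiset E → Multiset E → Multiset E → Prop} {H K : Multiset E}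
    {A B : List (Multiset E)} :
    Valid P H (A ++ B) K ↔ Valid P H A (B.sum + K) ∧ Valid P (H + A.sum) B K := by
  induction A generalizing H with
  | nil => simp [Valid]
  | cons c A ih => simp [Valid, ih, and_assoc, add_assoc]

theorem valid_singleton {P : Multiset E → Multiset E → Multiset E → Prop}
    {H K c : Multiset E} : Valid P H [c] K ↔ P H c K := by simp [Valid]

theorem Valid.mono {H K H' K' : Multiset E} {cs : List (Multiset E)}
    (h : Valid (Ear f r) H cs K) (hf : ∀ e ∈ cs.sum, f' e = f e)
    (hH : ∀ u, dg f H u ≤ dg f' H' u)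
    (hK : ∀ u, dg f K u ≤ dg f' K' u ∨ (u ≠ r ∧ dg f cs.sum u = 0 ∧ dg f K u ≤ 1)) :
    Valid (Ear f' r) H' cs K' := by
  induction cs generalizing H H' with
  | nil => trivial
  | cons c cs ih =>
    rw [List.sum_cons] at hf hK
    have hf₁ : ∀ e ∈ c, f' e = f e := fun e he => hf e (by simp [he])
    have hf₂ : ∀ e ∈ cs.sum, f' e = f e := fun e he => hf e (Multiset.mem_add.2 (.inr he))
    refine ⟨h.1.mono hf₁ hH fun u => ?_, ih h.2 hf₂ (fun u => ?_) fun u => ?_⟩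
    · simp only [dg_add, dg_congr hf₂] at hK ⊢
      rcases hK u with h | ⟨h1, h2, h3⟩
      · left; omega
      · exact .inr ⟨h1, by omega, by omega⟩
    · have := hH u
      simp only [dg_add, dg_congr hf₁] at this ⊢
      omega
    · simp only [dg_add] at hK
      rcases hK u with h | ⟨h1, h2, h3⟩
      · exact .inl h
      · exact .inr ⟨h1, by omega, h3⟩

/-! ### Adding an edge -/

theorem Valid.exists_gap {H K : Multiset E} {cs : List (Multiset E)}
    (h : Valid (Ear f r) H cs K) {u v : V} (hu : Big f r (H + cs.sum) u)
    (hv : Big f r (H + cs.sum) v) (hn : ¬ (Big f r H u ∧ Big f r H v)) :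
    ∃ A B, cs = A ++ B ∧ Big f r (H + A.sum) u ∧ Big f r (H + A.sum) v ∧
      (Big f r (B.sum + K) u ∨ Big f r (B.sum + K) v) := by
  induction cs generalizing H with
  | nil => simp at hu hv; tauto
  | cons c cs ih =>
    by_cases hc : Big f r (H + c) u ∧ Big f r (H + c) v
    · have key : ∀ w, Big f r (H + c) w → ¬ Big f r H w → Big f r (cs.sum + K) w := by
        intro w hw hw'
        have := h.1.big_of_touch (x := w)
        simp only [Big, dg_add] at *
        by_cases h0 : dg f c w = 0
        · rw [h0] at hw; simp at hw; tauto
        · tauto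
      refine ⟨[c], cs, rfl, by simpa using hc.1, by simpa using hc.2, ?_⟩
      by_cases h' : Big f r H u
      · exact .inr (key v hc.2 fun h => hn ⟨h', h⟩)
      · exact .inl (key u hc.1 h')
    · rw [List.sum_cons, ← add_assoc] at hu hv
      obtain ⟨A, B, rfl, h₁, h₂, h₃⟩ := ih h.2 hu hv hc
      exact ⟨c :: A, B, rfl, by simpa [add_assoc] using h₁, by simpa [add_assoc] using h₂, h₃⟩

theorem Valid.add_edge {cs : List (Multiset E)} (h : Valid (Ear f r) 0 cs 0) {e : E} {u v : V}
    (he : f e = s(u, v)) (hu : Big f r cs.sum u) (hv : Big f r cs.sum v) :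
    ∃ cs' : List (Multiset E), cs'.sum = e ::ₘ cs.sum ∧ Valid (Ear f r) 0 cs' 0 := by
  obtain ⟨A, B, rfl, h₁, h₂, h₃⟩ : ∃ A B, cs = A ++ B ∧ Big f r (0 + A.sum) u ∧
      Big f r (0 + A.sum) v ∧ (Big f r (B.sum + 0) u ∨ Big f r (B.sum + 0) v) := by
    by_cases hn : Big f r 0 u ∧ Big f r 0 v
    · have : u = r := by simpa [Big] using hn.1
      exact ⟨[], cs, rfl, .inl this, by simpa using hn.2, .inl (.inl this)⟩
    · exact h.exists_gap (by simpa using hu) (by simpa using hv) hn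
  rw [valid_append] at h
  refine ⟨A ++ {e} :: B, ?_, valid_append.2 ⟨h.1.mono (fun _ _ => rfl) (fun _ => le_rfl) ?_,
    .inr (.inl ⟨e, u, v, 0, 0, rfl, he, .base h₁, .base h₂, h₃⟩),
    h.2.mono (fun _ _ => rfl) ?_ fun _ => .inl le_rfl⟩⟩
  · rw [List.sum_append, List.sum_append, List.sum_cons, add_left_comm, Multiset.singleton_add]
  · intro u
    simp
  · intro u
    simp

/-! ### Pinching two edges -/

/-- The edge `g` with ends `x` and `y` is subdivided into `e` and `e'` by the vertex `v`. -/
structure Subdiv (f f' : E → Sym2 V) (v : V) (g : E) (x y : V) (e e' : E) : Prop where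
  old : f g = s(x, y)
  left : f' e = s(x, v)
  right : f' e' = s(y, v)
  ne_left : x ≠ v
  ne_right : y ≠ v

theorem Subdiv.symm {v x y : V} {g e e' : E} (h : Subdiv f f' v g x y e e') :
    Subdiv f f' v g y x e' e :=
  ⟨h.old.trans Sym2.eq_swap, h.right, h.left, h.ne_right, h.ne_left⟩

theorem Cap.symm {M : Multiset E} {a b : V} (h : Cap f r M a b) : Cap f r M b a := by
  rwa [Cap, Sym2.eq_swap]

theorem Ear.cases_edge {H K c : Multiset E} {g : E} {x y : V} (h : Ear f r H (g ::ₘ c) K)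
    (hg : f g = s(x, y)) :
    (∃ m₁ m₂, c = m₁ + m₂ ∧ Arm f (Big f r H) (Big f r K) m₁ x ∧
      Arm f (Big f r H) (Big f r K) m₂ y ∧ (Big f r K x ∨ Big f r K y)) ∨
    ∃ a b m₁ m₂, c = m₁ + m₂ ∧ Tr f (Big f r H) a m₁ x ∧ Tr f (Big f r H) y m₂ b ∧
      Cap f r K a b := by
  rcases h with h | h | ⟨a, b, h, hc⟩
  · simp at h
  · left
    obtain ⟨x', y', m₁, m₂, h0, h1, h2, h3, h4⟩ := h.reroot (Multiset.mem_cons_self g c)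
    rw [Multiset.cons_inj_right] at h0
    rw [hg, Sym2.eq_iff] at h1
    rcases h1 with ⟨rfl, rfl⟩ | ⟨rfl, rfl⟩
    · exact ⟨m₁, m₂, h0, h2, h3, h4⟩
    · exact ⟨m₂, m₁, h0.trans (add_comm _ _), h3, h2, h4.symm⟩
  · right
    obtain ⟨x', y', m₁, m₂, h0, h1, h2, h3⟩ := h.split (Multiset.mem_cons_self g c)
    rw [Multiset.cons_inj_right] at h0
    rw [hg, Sym2.eq_iff] at h1
    rcases h1 with ⟨rfl, rfl⟩ | ⟨rfl, rfl⟩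
    · exact ⟨a, b, m₁, m₂, h0, h2, h3, hc⟩
    · exact ⟨b, a, m₂, m₁, h0.trans (add_comm _ _), h3.symm, h2.symm, hc.symm⟩

theorem Ear.subdivide_early {H K c H' K' : Multiset E} {v x y : V} {g e e' : E}
    (h : Ear f r H (g ::ₘ c) K) (hs : Subdiv f f' v g x y e e') (hf : ∀ a ∈ c, f' a = f a)
    (hH : ∀ u, dg f H u ≤ dg f' H' u) (hK : ∀ u, dg f K u ≤ dg f' K' u)
    (hv : 2 ≤ dg f' K' v) :
    ∃ L : List (Multiset E), L.sum = e ::ₘ e' ::ₘ c ∧ Valid (Ear f' r) H' L K' := by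
  classical
  rcases h.cases_edge hs.old with ⟨m₁, m₂, rfl, h₁, h₂, -⟩ | ⟨a, b, m₁, m₂, rfl, h₁, h₂, hc⟩
  · have hf₁ : ∀ a ∈ m₁, f' a = f a := fun a ha => hf a (by simp [ha])
    have hf₂ : ∀ a ∈ m₂, f' a = f a := fun a ha => hf a (by simp [ha])
    refine ⟨[e ::ₘ e' ::ₘ (m₁ + m₂)], by simp, valid_singleton.2 (.inr (.inl
      ⟨e', v, y, e ::ₘ m₁, m₂, ?_, hs.right.trans Sym2.eq_swap, .step (h₁.mono hf₁
        (fun u hu => hu.mono (hH u)) fun u hu => hu.mono (hK u)) hs.left (.inr hv),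
        h₂.mono hf₂ (fun u hu => hu.mono (hH u)) fun u hu => hu.mono (hK u),
        .inl (.inr hv)⟩))⟩
    rw [Multiset.cons_add, Multiset.cons_swap]
  · have hf₁ : ∀ a ∈ m₁, f' a = f a := fun a ha => hf a (by simp [ha])
    have hf₂ : ∀ a ∈ m₂, f' a = f a := fun a ha => hf a (by simp [ha])
    refine ⟨[m₁, m₂, {e, e'}], ?_, .inr (.inr ⟨a, x, h₁.mono hf₁ fun u hu => hu.mono (hH u),
      fun u hu => ?_⟩), .inr (.inr ⟨y, b, h₂.mono hf₂ fun u hu => hu.mono ?_, fun u hu => ?_⟩),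
      .inr (.inl ⟨e', v, y, {e}, 0, ?_, hs.right.trans Sym2.eq_swap,
        .step (.base (h₁.last.mono ?_)) hs.left (.inr ?_), .base (h₂.start.mono ?_),
        .inl (.inr ?_)⟩), trivial⟩
    · simp only [List.sum_cons, List.sum_nil, Multiset.insert_eq_cons, ← Multiset.singleton_add]
      abel
    · have h1 := hc u hu
      have h2 := hK u
      simp [hs.left, cnt_mk] at h1 ⊢
      omega
    · have := hH u
      simp
      omega
    · have h1 := hc u hu
      have h2 := hK u
      simp [hs.left, hs.right, cnt_mk] at h1 ⊢
      omega
    · simp only [Multiset.insert_eq_cons, ← Multiset.singleton_add]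
      abel
    · have := hH x
      simp
      omega
    · simpa using hv
    · have := hH y
      simp
      omega
    · simpa using hv

/-- The ear can be replaced by two of its sub-ears obtained by subdividing an edge with a
visited vertex `v`. -/
def LateGood (f f' : E → Sym2 V) (r : V) (H c K : Multiset E) (v : V) (e e' : E) : Prop :=
  ∀ H' K', (∀ u, dg f H u ≤ dg f' H' u) → (∀ u, dg f K u ≤ dg f' K' u) → 2 ≤ dg f' H' v →
    ∃ L : List (Multiset E), L.sum = e ::ₘ e' ::ₘ c ∧ Valid (Ear f' r) H' L K'

/-- The edge `g` is the last one at the visited vertex `z`, and it may be replaced by an edge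
`e'` from a visited vertex `v`. -/
def LateBad (f f' : E → Sym2 V) (r : V) (H : Multiset E) (g : E) (c K : Multiset E) (v z : V)
    (e' : E) : Prop :=
  z ≠ r ∧ Big f r H z ∧ dg f (g ::ₘ c) z + dg f K z ≤ 1 ∧
    ∀ H' K', (∀ u, dg f H u ≤ dg f' H' u) → (∀ u, dg f K u ≤ dg f' K' u) → 2 ≤ dg f' H' v →
      Ear f' r H' (e' ::ₘ c) K'

theorem LateGood.symm {H c K : Multiset E} {v : V} {e e' : E}
    (h : LateGood f f' r H c K v e e') : LateGood f f' r H c K v e' e := by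
  intro H' K' h₁ h₂ h₃
  obtain ⟨L, h₄, h₅⟩ := h H' K' h₁ h₂ h₃
  exact ⟨L, h₄.trans (Multiset.cons_swap _ _ _), h₅⟩

theorem Ear.subdivide_late {H K c : Multiset E} {v z w : V} {g e e' : E}
    (h : Ear f r H (g ::ₘ c) K) (hs : Subdiv f f' v g z w e e') (hf : ∀ a ∈ c, f' a = f a) :
    LateGood f f' r H c K v e e' ∨ LateBad f f' r H g c K v z e' ∨
      LateBad f f' r H g c K v w e := by
  classical
  have one : ∀ {z w e e' m₁ m₂}, c = m₁ + m₂ → Subdiv f f' v g z w e e' →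
      Arm f (Big f r H) (Big f r K) m₁ z → Arm f (Big f r H) (Big f r K) m₂ w →
      ¬ Big f r K z → Big f r K w →
      LateGood f f' r H c K v e e' ∨ LateBad f f' r H g c K v z e' := by
    intro z w e e' m₁ m₂ hc hs h₁ h₂ hz hw
    cases h₁ with
    | step _ _ h => exact absurd h hz
    | base h₁ =>
    rw [zero_add] at hc
    subst hc
    have hzr : z ≠ r := fun h => hz (.inl h)
    have hear : ∀ H' K', (∀ u, dg f H u ≤ dg f' H' u) → (∀ u, dg f K u ≤ dg f' K' u) →
        2 ≤ dg f' H' v → Ear f' r H' (e' ::ₘ c) K' := fun H' K' hH hK hv =>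
      .inr (.inl ⟨e', w, v, c, 0, by simp, hs.right, h₂.mono hf (fun u hu => hu.mono (hH u))
        fun u hu => hu.mono (hK u), .base (.inr hv), .inl (hw.mono (hK w))⟩)
    by_cases hle : dg f (g ::ₘ c) z + dg f K z ≤ 1
    · exact .inr ⟨hzr, h₁, hle, hear⟩
    · refine .inl fun H' K' hH hK hv => ⟨[{e}, e' ::ₘ c], by
      rw [List.sum_cons, List.sum_singleton, Multiset.singleton_add], .inr (.inr ⟨z, v,
        .single (h₁.mono (hH z)) (.inr hv) hs.left, fun u hu => ?_⟩),
        hear _ _ (fun u => ?_) (fun u => by simpa using hK u) ?_, trivial⟩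
      · have hzv := hs.ne_left
        have := hK z
        simp only [dg_cons, hs.old, cnt_mk, if_true] at hle
        simp only [List.sum_cons, List.sum_nil, add_zero, dg_add, dg_cons, hs.right, cnt_mk,
          dg_congr hf]
        by_cases hzu : z = u
        · subst hzu
          rw [if_pos rfl, if_neg hzv.symm]
          omega
        · rw [if_neg hzu]
          omega
      · have := hH u
        simp
        omega
      · simp
        omega
  rcases h.cases_edge hs.old with ⟨m₁, m₂, hc, h₁, h₂, h₃⟩ | ⟨a, b, m₁, m₂, rfl, h₁, h₂, hc⟩
  · by_cases hz : Big f r K z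
    · by_cases hw : Big f r K w
      · left
        subst hc
        have hf₁ : ∀ a ∈ m₁, f' a = f a := fun a ha => hf a (by simp [ha])
        have hf₂ : ∀ a ∈ m₂, f' a = f a := fun a ha => hf a (by simp [ha])
        refine fun H' K' hH hK hv => ⟨[e ::ₘ m₁, e' ::ₘ m₂], ?_, .inr (.inl ⟨e, z, v, m₁, 0,
          by simp, hs.left, h₁.mono hf₁ (fun u hu => hu.mono (hH u)) fun u hu => hu.mono ?_,
          .base (.inr hv), .inl (hz.mono ?_)⟩), .inr (.inl ⟨e', w, v, m₂, 0,
          by simp, hs.right, h₂.mono hf₂ (fun u hu => hu.mono ?_) fun u hu => hu.mono ?_,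
          .base (.inr ?_), .inl (hw.mono ?_)⟩), trivial⟩
        · simp only [List.sum_cons, List.sum_nil, ← Multiset.singleton_add]
          abel
        · have := hK u
          simp
          omega
        · have := hK z
          simp
          omega
        · have := hH u
          simp
          omega
        · simpa using hK u
        · simp
          omega
        · simpa using hK w
      · rw [add_comm] at hc
        rcases one hc hs.symm h₂ h₁ hw hz with h | h
        · exact .inl h.symm
        · exact .inr (.inr h)
    · rcases one hc hs h₁ h₂ hz (h₃.resolve_left hz) with h | h
      · exact .inl h
      · exact .inr (.inl h)
  · left
    have hf₁ : ∀ a ∈ m₁, f' a = f a := fun a ha => hf a (by simp [ha])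
    have hf₂ : ∀ a ∈ m₂, f' a = f a := fun a ha => hf a (by simp [ha])
    refine fun H' K' hH hK hv => ⟨[m₁ + e ::ₘ e' ::ₘ m₂], ?_, valid_singleton.2 (.inr (.inr
      ⟨a, b, ?_, fun u hu => (hc u hu).trans (hK u)⟩))⟩
    · simp only [List.sum_singleton, ← Multiset.singleton_add]
      abel
    · have h₂' := h₂.mono (P' := Big f' r H') hf₂ fun u hu => hu.mono (hH u)
      exact (h₁.mono hf₁ fun u hu => hu.mono (hH u)).trans (.cons (h₁.last.mono (hH z)) hs.left
        (.cons (.inr hv) (hs.right.trans Sym2.eq_swap) h₂'))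

theorem Ear.subdivide_both {H K c H' K' : Multiset E} {v x y z w : V} {g₁ g₂ e₁ e₁' e₂ e₂' : E}
    (h : Ear f r H (g₁ ::ₘ g₂ ::ₘ c) K) (hs₁ : Subdiv f f' v g₁ x y e₁ e₁')
    (hs₂ : Subdiv f f' v g₂ z w e₂ e₂') (hf : ∀ a ∈ c, f' a = f a)
    (hH : ∀ u, dg f H u ≤ dg f' H' u) (hK : ∀ u, dg f K u ≤ dg f' K' u) :
    ∃ L : List (Multiset E), L.sum = e₁ ::ₘ e₁' ::ₘ e₂ ::ₘ e₂' ::ₘ c ∧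
      Valid (Ear f' r) H' L K' := by
  classical
  have upAux : ∀ {x y e₁ e₁' z w e₂ e₂' m₂ n₁ n₂}, c = n₁ + n₂ + m₂ →
      Subdiv f f' v g₁ x y e₁ e₁' → Subdiv f f' v g₂ z w e₂ e₂' →
      Arm f (Big f r H) (Big f r K) n₁ z → Tr f (Big f r K) w n₂ x →
      Arm f (Big f r H) (Big f r K) m₂ y →
      ∃ L : List (Multiset E), L.sum = e₁ ::ₘ e₁' ::ₘ e₂ ::ₘ e₂' ::ₘ c ∧
        Valid (Ear f' r) H' L K' := by
    intro x y e₁ e₁' z w e₂ e₂' m₂ n₁ n₂ hc hs₁ hs₂ h₁ h₂ h₃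
    subst hc
    have hf₁ : ∀ a ∈ n₁, f' a = f a := fun a ha => hf a (by simp [ha])
    have hf₂ : ∀ a ∈ n₂, f' a = f a := fun a ha => hf a (by simp [ha])
    have hf₃ : ∀ a ∈ m₂, f' a = f a := fun a ha => hf a (by simp [ha])
    have hA : ∀ u, Big f r H u → Big f' r H' u := fun u hu => hu.mono (hH u)
    have hB : ∀ u, Big f r K u → Big f' r K' u := fun u hu => hu.mono (hK u)
    have hB₁ : ∀ u, Big f r K u → Big f' r ((e₁ ::ₘ e₂' ::ₘ n₂) + K') u := fun u hu =>
      hu.mono ((hK u).trans (by simp; omega))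
    have hv₁ : Big f' r ((e₁ ::ₘ e₂' ::ₘ n₂) + K') v := .inr (by
      simp [hs₁.left, hs₂.right, cnt_mk]
      omega)
    have hv₂ : Big f' r (H' + (e₁' ::ₘ (e₂ ::ₘ n₁ + m₂))) v := .inr (by
      simp [hs₁.right, hs₂.left, cnt_mk]
      omega)
    refine ⟨[e₁' ::ₘ (e₂ ::ₘ n₁ + m₂), e₁ ::ₘ e₂' ::ₘ n₂], ?_, .inr (.inl ⟨e₁', v, y,
      e₂ ::ₘ n₁, m₂, rfl, hs₁.right.trans Sym2.eq_swap, .step (h₁.mono hf₁ hA ?_) hs₂.left ?_,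
      h₃.mono hf₃ hA ?_, .inl ?_⟩), .inr (.inl ⟨e₁, x, v, n₂ + (e₂' ::ₘ 0), 0, ?_, hs₁.left,
      (Arm.step (.base hv₂) (hs₂.right.trans Sym2.eq_swap) ?_).extend (h₂.mono hf₂ ?_),
      .base hv₂, .inl ?_⟩), trivial⟩
    · simp only [List.sum_cons, List.sum_nil, ← Multiset.singleton_add]
      abel
    · simpa using hB₁
    · simpa using hv₁
    · simpa using hB₁
    · simpa using hv₁
    · simp only [← Multiset.singleton_add]
      abel
    · simpa using hB w h₂.start
    · simpa using hB
    · simpa using hB x h₂.last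
  have downAux : ∀ {x y e₁ e₁' z w e₂ e₂' m₁ n₁ n₂ a b}, c = m₁ + n₁ + n₂ →
      Subdiv f f' v g₁ x y e₁ e₁' → Subdiv f f' v g₂ z w e₂ e₂' →
      Tr f (Big f r H) a m₁ x → Tr f (Big f r H) y n₁ z → Tr f (Big f r H) w n₂ b →
      Cap f r K a b →
      ∃ L : List (Multiset E), L.sum = e₁ ::ₘ e₁' ::ₘ e₂ ::ₘ e₂' ::ₘ c ∧
        Valid (Ear f' r) H' L K' := by
    intro x y e₁ e₁' z w e₂ e₂' m₁ n₁ n₂ a b hc hs₁ hs₂ h₁ h₂ h₃ hcap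
    subst hc
    have hf₁ : ∀ a ∈ m₁, f' a = f a := fun a ha => hf a (by simp [ha])
    have hf₂ : ∀ a ∈ n₁, f' a = f a := fun a ha => hf a (by simp [ha])
    have hf₃ : ∀ a ∈ n₂, f' a = f a := fun a ha => hf a (by simp [ha])
    have hA : ∀ M u, Big f r H u → Big f' r (H' + M) u := fun M u hu =>
      hu.mono ((hH u).trans (by simp))
    refine ⟨[n₁, {e₁', e₂}, m₁ + e₁ ::ₘ e₂' ::ₘ n₂], ?_, .inr (.inr ⟨y, z,
      h₂.mono hf₂ fun u hu => hu.mono (hH u), fun u hu => ?_⟩), .inr (.inl ⟨e₂, z, v, 0,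
      e₁' ::ₘ 0, ?_, hs₂.left, .base (hA _ z h₂.last),
      .step (.base (hA _ y h₂.start)) hs₁.right (.inr ?_), .inr (.inr ?_)⟩),
      .inr (.inr ⟨a, b, (h₁.mono hf₁ fun u hu => ?_).trans (.cons ?_ hs₁.left
        (.cons (.inr ?_) (hs₂.right.trans Sym2.eq_swap) (h₃.mono hf₃ fun u hu => ?_))),
        fun u hu => ?_⟩), trivial⟩
    · simp only [List.sum_cons, List.sum_nil, Multiset.insert_eq_cons, ← Multiset.singleton_add]
      abel
    · simp [hs₁.right, hs₂.left, cnt_mk]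
      omega
    · simp only [Multiset.insert_eq_cons, ← Multiset.singleton_add]
      abel
    · simp [hs₁.left, hs₂.right, cnt_mk]
      omega
    · simp [hs₁.left, hs₂.right, cnt_mk]
      omega
    · simpa only [add_assoc] using hA _ u hu
    · simpa only [add_assoc] using hA _ x h₁.last
    · simp [hs₁.right, hs₂.left, cnt_mk]
      omega
    · simpa only [add_assoc] using hA _ u hu
    · have := hcap u hu
      have := hK u
      simp
      omega
  have hswap : ∀ {e₁ e₁' e₂ e₂' f₁ f₁' f₂ f₂' : E},
      e₁ ::ₘ e₁' ::ₘ (0 : Multiset E) = f₁ ::ₘ f₁' ::ₘ 0 →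
      e₂ ::ₘ e₂' ::ₘ (0 : Multiset E) = f₂ ::ₘ f₂' ::ₘ 0 →
      (∃ L : List (Multiset E), L.sum = e₁ ::ₘ e₁' ::ₘ e₂ ::ₘ e₂' ::ₘ c ∧
        Valid (Ear f' r) H' L K') →
      ∃ L : List (Multiset E), L.sum = f₁ ::ₘ f₁' ::ₘ f₂ ::ₘ f₂' ::ₘ c ∧
        Valid (Ear f' r) H' L K' := by
    rintro e₁ e₁' e₂ e₂' f₁ f₁' f₂ f₂' h₁ h₂ ⟨L, hL, hL'⟩
    refine ⟨L, ?_, hL'⟩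
    rw [hL]
    have h₃ : e₁ ::ₘ e₁' ::ₘ (0 : Multiset E) + (e₂ ::ₘ e₂' ::ₘ 0) + c =
        f₁ ::ₘ f₁' ::ₘ 0 + (f₂ ::ₘ f₂' ::ₘ 0) + c := by rw [h₁, h₂]
    simpa only [Multiset.cons_add, zero_add] using h₃
  have sw : ∀ a b : E, a ::ₘ b ::ₘ (0 : Multiset E) = b ::ₘ a ::ₘ 0 := fun a b =>
    Multiset.cons_swap a b 0
  have upSplit : ∀ {x y e₁ e₁' m₁ m₂}, g₂ ::ₘ c = m₁ + m₂ →
      Subdiv f f' v g₁ x y e₁ e₁' → Arm f (Big f r H) (Big f r K) m₁ x →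
      Arm f (Big f r H) (Big f r K) m₂ y → g₂ ∈ m₁ →
      ∃ L : List (Multiset E), L.sum = e₁ ::ₘ e₁' ::ₘ e₂ ::ₘ e₂' ::ₘ c ∧
        Valid (Ear f' r) H' L K' := by
    intro x y e₁ e₁' m₁ m₂ hc hs₁ h₁ h₂ hg
    obtain ⟨u, w', n₁, n₂, rfl, huw, h₃, h₄⟩ := h₁.split hg
    rw [Multiset.cons_add, Multiset.cons_inj_right] at hc
    rw [hs₂.old, Sym2.eq_iff] at huw
    rcases huw with ⟨rfl, rfl⟩ | ⟨rfl, rfl⟩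
    · exact upAux hc hs₁ hs₂ h₃ h₄ h₂
    · exact hswap rfl (sw _ _) (upAux hc hs₁ hs₂.symm h₃ h₄ h₂)
  have downSplit : ∀ {x y e₁ e₁' m₁ m₂ a b}, g₂ ::ₘ c = m₁ + m₂ →
      Subdiv f f' v g₁ x y e₁ e₁' → Tr f (Big f r H) a m₁ x → Tr f (Big f r H) y m₂ b →
      Cap f r K a b → g₂ ∈ m₂ →
      ∃ L : List (Multiset E), L.sum = e₁ ::ₘ e₁' ::ₘ e₂ ::ₘ e₂' ::ₘ c ∧
        Valid (Ear f' r) H' L K' := by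
    intro x y e₁ e₁' m₁ m₂ a b hc hs₁ h₁ h₂ hcap hg
    obtain ⟨u, w', n₁, n₂, rfl, huw, h₃, h₄⟩ := h₂.split hg
    rw [Multiset.add_cons, Multiset.cons_inj_right, ← add_assoc] at hc
    rw [hs₂.old, Sym2.eq_iff] at huw
    rcases huw with ⟨rfl, rfl⟩ | ⟨rfl, rfl⟩
    · exact downAux hc hs₁ hs₂ h₁ h₃ h₄ hcap
    · exact hswap rfl (sw _ _) (downAux hc hs₁ hs₂.symm h₁ h₃ h₄ hcap)
  rcases h.cases_edge hs₁.old with ⟨m₁, m₂, hc, h₁, h₂, -⟩ | ⟨a, b, m₁, m₂, hc, h₁, h₂, hcap⟩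
  · rcases Multiset.mem_add.1 (hc ▸ Multiset.mem_cons_self g₂ c) with hg | hg
    · exact upSplit hc hs₁ h₁ h₂ hg
    · exact hswap (sw _ _) rfl (upSplit (hc.trans (add_comm _ _)) hs₁.symm h₂ h₁ hg)
  · rcases Multiset.mem_add.1 (hc ▸ Multiset.mem_cons_self g₂ c) with hg | hg
    · exact hswap (sw _ _) rfl (downSplit (hc.trans (add_comm _ _)) hs₁.symm h₂.symm h₁.symm
        hcap.symm hg)
    · exact downSplit hc hs₁ h₁ h₂ hcap hg

/-- Subdivide an edge with `v` and attach the edge `h` from `v` to a visited vertex `z` with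
at most one later edge, which gets replaced by an edge at `v`. -/
theorem Ear.subdivide_attach {H K c H' K' : Multiset E} {v x y z : V} {g e e' h : E}
    (hc : Ear f r H (g ::ₘ c) K) (hs : Subdiv f f' v g x y e e') (hf : ∀ a ∈ c, f' a = f a)
    (hh : f' h = s(z, v)) (hzv : z ≠ v) (hz : Big f r H z) (hzr : z ≠ r) (hzK : dg f K z ≤ 1)
    (hvr : v ≠ r) (hvK : dg f K v = 0) (hH : ∀ u, dg f H u ≤ dg f' H' u)
    (hK : ∀ u, dg f K u ≤ dg f' K' u ∨ u = z) (hv : 1 ≤ dg f' K' v) :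
    ∃ L : List (Multiset E), L.sum = h ::ₘ e ::ₘ e' ::ₘ c ∧ Valid (Ear f' r) H' L K' := by
  classical
  have hA : ∀ u, Big f r H u → Big f' r H' u := fun u hu => hu.mono (hH u)
  have hB : ∀ u, Big f r K u → Big f' r K' u := by
    intro u hu
    rcases hK u with h | rfl
    · exact hu.mono h
    · rcases hu with hu | hu
      · exact absurd hu hzr
      · omega
  have upAux : ∀ {x y e e' m₁ m₂}, c = m₁ + m₂ → Subdiv f f' v g x y e e' →
      Arm f (Big f r H) (Big f r K) m₁ x → Arm f (Big f r H) (Big f r K) m₂ y → Big f r K y →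
      ∃ L : List (Multiset E), L.sum = h ::ₘ e ::ₘ e' ::ₘ c ∧ Valid (Ear f' r) H' L K' := by
    intro x y e e' m₁ m₂ hc hs h₁ h₂ hy
    subst hc
    have hf₁ : ∀ a ∈ m₁, f' a = f a := fun a ha => hf a (by simp [ha])
    have hf₂ : ∀ a ∈ m₂, f' a = f a := fun a ha => hf a (by simp [ha])
    have hB₁ : ∀ u, Big f r K u → Big f' r ((e' ::ₘ m₂) + K') u := fun u hu =>
      (hB u hu).mono (by simp; omega)
    have hv₁ : Big f' r ((e' ::ₘ m₂) + K') v := .inr (by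
      simp [hs.right, cnt_mk]
      omega)
    refine ⟨[h ::ₘ e ::ₘ m₁, e' ::ₘ m₂], ?_, .inr (.inl ⟨h, z, v, 0, e ::ₘ m₁, by simp, hh,
      .base (hA z hz), .step (h₁.mono hf₁ hA ?_) hs.left ?_, .inr ?_⟩),
      .inr (.inl ⟨e', y, v, m₂, 0, by simp, hs.right, h₂.mono hf₂ (fun u hu => ?_) ?_,
        .base (.inr ?_), .inl ?_⟩), trivial⟩
    · simp only [List.sum_cons, List.sum_nil, ← Multiset.singleton_add]
      abel
    · simpa using hB₁
    · simpa using hv₁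
    · simpa using hv₁
    · exact (hA u hu).mono (by simp; omega)
    · simpa using hB
    · simp [hh, hs.left, cnt_mk]
      omega
    · simpa using hB y hy
  have downAux : ∀ {x y e e' m₁ m₂ a b}, c = m₁ + m₂ → Subdiv f f' v g x y e e' →
      Tr f (Big f r H) a m₁ x → Tr f (Big f r H) y m₂ b → Cap f r K a b → b ≠ z →
      ∃ L : List (Multiset E), L.sum = h ::ₘ e ::ₘ e' ::ₘ c ∧ Valid (Ear f' r) H' L K' := by
    intro x y e e' m₁ m₂ a b hc hs h₁ h₂ hcap hbz
    subst hc
    have hf₁ : ∀ a ∈ m₁, f' a = f a := fun a ha => hf a (by simp [ha])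
    have hf₂ : ∀ a ∈ m₂, f' a = f a := fun a ha => hf a (by simp [ha])
    have hbv : b ≠ v := by
      rintro rfl
      have := hcap b hvr
      rw [cnt_mk, if_pos rfl] at this
      omega
    refine ⟨[m₁, {e, h}, e' ::ₘ m₂], ?_, .inr (.inr ⟨a, x, h₁.mono hf₁ hA, fun u hu => ?_⟩),
      .inr (.inl ⟨h, z, v, 0, e ::ₘ 0, ?_, hh, .base ((hA z hz).mono (by simp)),
        .step (.base ((hA x h₁.last).mono (by simp))) hs.left (.inr ?_), .inr (.inr ?_)⟩),
      .inr (.inr ⟨v, b, .cons (.inr ?_) (hs.right.trans Sym2.eq_swap)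
        (h₂.mono hf₂ fun u hu => (hA u hu).mono ?_), fun u hu => ?_⟩), trivial⟩
    · simp only [List.sum_cons, List.sum_nil, Multiset.insert_eq_cons, ← Multiset.singleton_add]
      abel
    · have h1 := hcap u hu
      simp only [cnt_mk] at h1
      simp [hh, hs.left, cnt_mk]
      rcases hK u with h2 | rfl
      · omega
      · rw [if_pos rfl]
        split_ifs <;> omega
    · simp only [Multiset.insert_eq_cons, ← Multiset.singleton_add]
      abel
    · simp [hs.right, cnt_mk]
      omega
    · simp [hs.right, cnt_mk]
      omega
    · simp [hh, hs.left, cnt_mk]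
      omega
    · simp
      omega
    · have h1 := hcap u hu
      simp only [cnt_mk] at h1
      simp only [List.sum_nil, zero_add, cnt_mk]
      by_cases huv : v = u
      · subst huv
        rw [if_pos rfl, if_neg hbv]
        omega
      · rw [if_neg huv]
        rcases hK u with h2 | rfl
        · omega
        · simp [hbz]
  have sw : (∃ L : List (Multiset E), L.sum = h ::ₘ e' ::ₘ e ::ₘ c ∧ Valid (Ear f' r) H' L K') →
      ∃ L : List (Multiset E), L.sum = h ::ₘ e ::ₘ e' ::ₘ c ∧ Valid (Ear f' r) H' L K' := by
    rw [Multiset.cons_swap e' e]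
    exact id
  rcases hc.cases_edge hs.old with ⟨m₁, m₂, hc, h₁, h₂, h₃ | h₃⟩ |
    ⟨a, b, m₁, m₂, hc, h₁, h₂, hcap⟩
  · exact sw (upAux (hc.trans (add_comm _ _)) hs.symm h₂ h₁ h₃)
  · exact upAux hc hs h₁ h₂ h₃
  · by_cases hbz : b = z
    · refine sw (downAux (hc.trans (add_comm _ _)) hs.symm h₂.symm h₁.symm hcap.symm ?_)
      rintro rfl
      have := hcap a hzr
      rw [cnt_mk, if_pos rfl, if_pos hbz] at this
      omega
    · exact downAux hc hs h₁ h₂ hcap hbz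

/-- Attach the edge `h` from a visited vertex `v` to the ear `k`, the last one but one at `z`. -/
theorem Ear.attach {H K k H' K' : Multiset E} {v z : V} {h : E} (hk : Ear f r H k K)
    (hf : ∀ a ∈ k, f' a = f a) (hkz : dg f k z ≠ 0) (hh : f' h = s(z, v)) (hzv : z ≠ v)
    (hzr : z ≠ r) (hzK : dg f K z ≤ 1) (hvr : v ≠ r) (hvK : dg f K v = 0) (hvH : Big f' r H' v)
    (hH : ∀ u, dg f H u ≤ dg f' H' u) (hK : ∀ u, dg f K u ≤ dg f' K' u ∨ u = z)
    (hv : 1 ≤ dg f' K' v) :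
    ∃ L : List (Multiset E), L.sum = h ::ₘ k ∧ Valid (Ear f' r) H' L K' := by
  classical
  have hA : ∀ u, Big f r H u → Big f' r H' u := fun u hu => hu.mono (hH u)
  have hB : ∀ u, Big f r K u → Big f' r K' u := by
    intro u hu
    rcases hK u with h | rfl
    · exact hu.mono h
    · rcases hu with hu | hu
      · exact absurd hu hzr
      · omega
  have hz : Big f r H z := by
    rcases hk.big_of_touch hkz with h | h | h
    · exact h
    · exact absurd h hzr
    · omega
  have two : Ear f' r (H' + {h}) k K' →
      ∃ L : List (Multiset E), L.sum = h ::ₘ k ∧ Valid (Ear f' r) H' L K' := by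
    refine fun he => ⟨[{h}, k], by simp [← Multiset.singleton_add], .inr (.inr ⟨z, v,
      .single (hA z hz) hvH hh, fun u hu => ?_⟩), by simpa using he, trivial⟩
    simp [dg_congr hf, cnt_mk]
    by_cases h1 : z = u
    · subst h1
      simp [hzv.symm]
      omega
    · by_cases h2 : v = u
      · subst h2
        simp [h1]
        omega
      · simp [h1, h2]
  have one : ∀ {a b}, Tr f (Big f r H) a k b → Cap f r K a b → a = z →
      ∃ L : List (Multiset E), L.sum = h ::ₘ k ∧ Valid (Ear f' r) H' L K' := by
    rintro a b h1 hcap rfl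
    refine ⟨[h ::ₘ k], by simp, valid_singleton.2 (.inr (.inr ⟨v, b,
      .cons hvH (hh.trans Sym2.eq_swap) (h1.mono hf hA), fun u hu => ?_⟩))⟩
    have h2 := hcap u hu
    have h3 := hcap v hvr
    simp only [cnt_mk] at h2 h3 ⊢
    by_cases h4 : v = u
    · subst h4
      simp only [if_true]
      omega
    · rcases hK u with h5 | rfl
      · simp only [h4, if_false]
        omega
      · simp only [h4, if_false, if_true] at h2 ⊢
        omega
  rcases hk with rfl | h1 | ⟨a, b, h1, hcap⟩
  · simp at hkz
  · exact two (.inr (.inl (h1.mono hf (fun u hu => (hA u hu).mono (by simp)) hB)))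
  · by_cases ha : a = z
    · exact one h1 hcap ha
    · by_cases hb : b = z
      · exact one h1.symm hcap.symm hb
      · refine two (.inr (.inr ⟨a, b, h1.mono hf fun u hu => (hA u hu).mono (by simp),
          fun u hu => ?_⟩))
        rcases hK u with h2 | rfl
        · exact (hcap u hu).trans h2
        · simp [cnt_mk, ha, hb]

theorem Subdiv.cnt_le {v x y : V} {g e e' : E} (h : Subdiv f f' v g x y e e') (u : V) :
    cnt (f g) u ≤ cnt (f' e) u + cnt (f' e') u := by
  classical
  simp only [h.old, h.left, h.right, cnt_mk]
  omega

theorem Subdiv.cnt_le_right {v x y : V} {g e e' : E} (h : Subdiv f f' v g x y e e') {u : V}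
    (hu : u ≠ x) : cnt (f g) u ≤ cnt (f' e') u := by
  classical
  simp only [h.old, h.right, cnt_mk, if_neg hu.symm]
  omega

theorem Subdiv.one_le_left {v x y : V} {g e e' : E} (h : Subdiv f f' v g x y e e') :
    1 ≤ cnt (f' e) v := by
  classical
  simp [h.left, cnt_mk]

theorem Subdiv.one_le_right {v x y : V} {g e e' : E} (h : Subdiv f f' v g x y e e') :
    1 ≤ cnt (f' e') v := h.symm.one_le_left

theorem exists_last_touch {B : List (Multiset E)} {z : V} (h : dg f B.sum z ≠ 0) :
    ∃ B₁ k B₂, B = B₁ ++ k :: B₂ ∧ dg f k z ≠ 0 ∧ dg f B₂.sum z = 0 := by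
  induction B with
  | nil => simp at h
  | cons k B ih =>
    by_cases hB : dg f B.sum z = 0
    · refine ⟨[], k, B, rfl, ?_, hB⟩
      simpa [hB] using h
    · obtain ⟨B₁, k', B₂, rfl, h₁⟩ := ih hB
      exact ⟨k :: B₁, k', B₂, rfl, h₁⟩

theorem Valid.pinch_of_bad {A B D : List (Multiset E)} {c d : Multiset E} {v x y z w : V}
    {g₁ g₂ e₁ e₁' e₂ e₂' : E}
    (hA : Valid (Ear f r) 0 A ((g₁ ::ₘ c) + (B.sum + ((g₂ ::ₘ d) + D.sum))))
    (hc : Ear f r A.sum (g₁ ::ₘ c) (B.sum + ((g₂ ::ₘ d) + D.sum)))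
    (hB : Valid (Ear f r) (A.sum + (g₁ ::ₘ c)) B ((g₂ ::ₘ d) + D.sum))
    (hD : Valid (Ear f r) (A.sum + (g₁ ::ₘ c) + B.sum + (g₂ ::ₘ d)) D 0)
    (hs₁ : Subdiv f f' v g₁ x y e₁ e₁') (hs₂ : Subdiv f f' v g₂ z w e₂ e₂')
    (hfA : ∀ a ∈ A.sum, f' a = f a) (hfc : ∀ a ∈ c, f' a = f a)
    (hfB : ∀ a ∈ B.sum, f' a = f a) (hfd : ∀ a ∈ d, f' a = f a)
    (hfD : ∀ a ∈ D.sum, f' a = f a) (hvr : v ≠ r)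
    (hv : dg f (B.sum + ((g₂ ::ₘ d) + D.sum)) v = 0)
    (hbad : LateBad f f' r (A.sum + (g₁ ::ₘ c) + B.sum) g₂ d D.sum v z e₂') :
    ∃ cs : List (Multiset E), cs.sum = e₁ ::ₘ e₁' ::ₘ e₂ ::ₘ e₂' ::ₘ
      (A.sum + (c + (B.sum + (d + D.sum)))) ∧ Valid (Ear f' r) 0 cs 0 := by
  classical
  obtain ⟨hzr, hz, hle, hear⟩ := hbad
  have eA := dg_congr hfA
  have ec := dg_congr hfc
  have ed := dg_congr hfd
  have eD := dg_congr hfD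
  have s₁ := hs₁.cnt_le
  have s₂ := hs₂.cnt_le
  have v₁ := hs₁.one_le_left
  have v₁' := hs₁.one_le_right
  have v₂ := hs₂.one_le_left
  have v₂' := hs₂.one_le_right
  have sz := fun u hu => hs₂.cnt_le_right (u := u) hu
  simp only [dg_cons] at hle
  by_cases hBz : dg f B.sum z = 0
  · have eB := dg_congr hfB
    have hAz : Big f r A.sum z := by
      by_cases hcz : dg f (g₁ ::ₘ c) z = 0
      · refine hz.mono ?_
        simp only [dg_add, hBz, hcz]
        omega
      · rcases hc.big_of_touch hcz with h | h | h
        · exact h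
        · exact absurd h hzr
        · simp only [dg_add, dg_cons, hBz] at h
          omega
    obtain ⟨L, hL, hL'⟩ := hc.subdivide_attach (H' := A.sum)
      (K' := B.sum + ((e₂' ::ₘ d) + D.sum)) hs₁ hfc hs₂.left hs₂.ne_left hAz hzr
      (by simp only [dg_add, dg_cons]; omega) hvr hv (fun u => (eA u).ge)
      (fun u => by
        by_cases hu : u = z
        · exact .inr hu
        · left
          have := sz u hu
          simp only [dg_add, dg_cons, eB, ed, eD]
          omega)
      (by simp only [dg_add, dg_cons]; omega)
    refine ⟨A ++ (L ++ (B ++ ([e₂' ::ₘ d] ++ D))), ?_, ?_⟩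
    · simp only [List.sum_append, hL, List.sum_singleton, ← Multiset.singleton_add]
      abel
    · simp only [valid_append, valid_singleton, List.sum_append, List.sum_singleton, hL, zero_add,
        add_zero]
      refine ⟨hA.mono hfA (fun _ => le_rfl) fun u => .inl ?_, hL',
        hB.mono hfB (fun u => ?_) fun u => ?_, hear _ _ (fun u => ?_) (fun u => (eD u).ge) ?_,
        hD.mono hfD (fun u => ?_) fun _ => .inl le_rfl⟩
      · have := s₁ u
        have := s₂ u
        simp only [dg_add, dg_cons, ec, eB, ed, eD]
        omega
      · have := s₁ u
        simp only [dg_add, dg_cons, eA, ec]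
        omega
      · by_cases hu : u = z
        · subst hu
          exact .inr ⟨hzr, hBz, by simp only [dg_add, dg_cons]; omega⟩
        · left
          have := sz u hu
          simp only [dg_add, dg_cons, ed, eD]
          omega
      · have := s₁ u
        simp only [dg_add, dg_cons, eA, ec, eB]
        omega
      · simp only [dg_add, dg_cons]
        omega
      · have := s₁ u
        have := s₂ u
        simp only [dg_add, dg_cons, eA, ec, eB, ed]
        omega
  · obtain ⟨B₁, k, B₂, rfl, hkz, hB₂z⟩ := exists_last_touch hBz
    simp only [List.sum_append, List.sum_cons] at *
    have hfB₁ : ∀ a ∈ B₁.sum, f' a = f a := fun a ha =>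
      hfB a (by simp only [Multiset.mem_add, ha, true_or])
    have hfk : ∀ a ∈ k, f' a = f a := fun a ha => hfB a (by simp [ha])
    have hfB₂ : ∀ a ∈ B₂.sum, f' a = f a := fun a ha =>
      hfB a (by simp only [Multiset.mem_add, ha, or_true])
    have eB₁ := dg_congr hfB₁
    have ek := dg_congr hfk
    have eB₂ := dg_congr hfB₂
    obtain ⟨hB₁, hk, hB₂⟩ : Valid (Ear f r) (A.sum + (g₁ ::ₘ c)) B₁
        (k + B₂.sum + (g₂ ::ₘ d + D.sum)) ∧
        Ear f r (A.sum + (g₁ ::ₘ c) + B₁.sum) k (B₂.sum + (g₂ ::ₘ d + D.sum)) ∧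
        Valid (Ear f r) (A.sum + (g₁ ::ₘ c) + B₁.sum + k) B₂ (g₂ ::ₘ d + D.sum) := by
      rwa [valid_append, List.sum_cons] at hB
    obtain ⟨L, hL, hL'⟩ := hc.subdivide_early (H' := A.sum)
      (K' := B₁.sum + (e₂ ::ₘ k + (B₂.sum + ((e₂' ::ₘ d) + D.sum)))) hs₁ hfc
      (fun u => (eA u).ge)
      (fun u => by
        have := s₂ u
        simp only [dg_add, dg_cons, eB₁, ek, eB₂, ed, eD]
        omega)
      (by simp only [dg_add, dg_cons]; omega)
    obtain ⟨L', hM, hM'⟩ := hk.attach (H' := A.sum + (e₁ ::ₘ e₁' ::ₘ c) + B₁.sum)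
      (K' := B₂.sum + ((e₂' ::ₘ d) + D.sum)) hfk hkz hs₂.left hs₂.ne_left hzr
      (by simp only [dg_add, dg_cons]; omega) hvr
      (by simp only [dg_add, dg_cons] at hv ⊢; omega)
      (.inr (by simp only [dg_add, dg_cons]; omega))
      (fun u => by
        have := s₁ u
        simp only [dg_add, dg_cons, eA, ec, eB₁]
        omega)
      (fun u => by
        by_cases hu : u = z
        · exact .inr hu
        · left
          have := sz u hu
          simp only [dg_add, dg_cons, eB₂, ed, eD]
          omega)
      (by simp only [dg_add, dg_cons]; omega)
    refine ⟨A ++ (L ++ (B₁ ++ (L' ++ (B₂ ++ ([e₂' ::ₘ d] ++ D))))), ?_, ?_⟩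
    · simp only [List.sum_append, hL, hM, List.sum_singleton, ← Multiset.singleton_add]
      abel
    · simp only [valid_append, valid_singleton, List.sum_append, List.sum_singleton, hL, hM,
        zero_add, add_zero]
      refine ⟨hA.mono hfA (fun _ => le_rfl) fun u => .inl ?_, hL',
        hB₁.mono hfB₁ (fun u => ?_) fun u => .inl ?_, hM',
        hB₂.mono hfB₂ (fun u => ?_) fun u => ?_, hear _ _ (fun u => ?_) (fun u => (eD u).ge) ?_,
        hD.mono hfD (fun u => ?_) fun _ => .inl le_rfl⟩
      · have := s₁ u
        have := s₂ u
        simp only [dg_add, dg_cons, ec, eB₁, ek, eB₂, ed, eD]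
        omega
      · have := s₁ u
        simp only [dg_add, dg_cons, eA, ec]
        omega
      · have := s₂ u
        simp only [dg_add, dg_cons, ek, eB₂, ed, eD]
        omega
      · have := s₁ u
        simp only [dg_add, dg_cons, eA, ec, eB₁, ek]
        omega
      · by_cases hu : u = z
        · subst hu
          exact .inr ⟨hzr, hB₂z, by simp only [dg_add, dg_cons]; omega⟩
        · left
          have := sz u hu
          simp only [dg_add, dg_cons, ed, eD]
          omega
      · have := s₁ u
        simp only [dg_add, dg_cons, eA, ec, eB₁, ek, eB₂]
        omega
      · simp only [dg_add, dg_cons]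
        omega
      · have := s₁ u
        have := s₂ u
        simp only [dg_add, dg_cons, eA, ec, eB₁, ek, eB₂, ed]
        omega

theorem Valid.pinch_of_lt {A B D : List (Multiset E)} {c d : Multiset E} {v x y z w : V}
    {g₁ g₂ e₁ e₁' e₂ e₂' : E}
    (h : Valid (Ear f r) 0 (A ++ (g₁ ::ₘ c) :: (B ++ (g₂ ::ₘ d) :: D)) 0)
    (hs₁ : Subdiv f f' v g₁ x y e₁ e₁') (hs₂ : Subdiv f f' v g₂ z w e₂ e₂')
    (hf : ∀ a ∈ A.sum + (c + (B.sum + (d + D.sum))), f' a = f a) (hvr : v ≠ r)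
    (hv : dg f (B.sum + ((g₂ ::ₘ d) + D.sum)) v = 0) :
    ∃ cs : List (Multiset E), cs.sum = e₁ ::ₘ e₁' ::ₘ e₂ ::ₘ e₂' ::ₘ
      (A.sum + (c + (B.sum + (d + D.sum)))) ∧ Valid (Ear f' r) 0 cs 0 := by
  simp only [Multiset.mem_add] at hf
  have hfA : ∀ a ∈ A.sum, f' a = f a := fun a ha => hf a (.inl ha)
  have hfc : ∀ a ∈ c, f' a = f a := fun a ha => hf a (.inr (.inl ha))
  have hfB : ∀ a ∈ B.sum, f' a = f a := fun a ha => hf a (.inr (.inr (.inl ha)))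
  have hfd : ∀ a ∈ d, f' a = f a := fun a ha => hf a (.inr (.inr (.inr (.inl ha))))
  have hfD : ∀ a ∈ D.sum, f' a = f a := fun a ha => hf a (.inr (.inr (.inr (.inr ha))))
  simp only [valid_append, Valid, List.sum_append, List.sum_cons, add_zero, zero_add] at h
  obtain ⟨hA, hc, hB, hd, hD⟩ := h
  rcases hd.subdivide_late hs₂ hfd with hgood | hbad | hbad
  · have eA := dg_congr hfA
    have ec := dg_congr hfc
    have eB := dg_congr hfB
    have ed := dg_congr hfd
    have eD := dg_congr hfD
    have s₁ := hs₁.cnt_le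
    have s₂ := hs₂.cnt_le
    have v₁ := hs₁.one_le_left
    have v₁' := hs₁.one_le_right
    have v₂ := hs₂.one_le_left
    have v₂' := hs₂.one_le_right
    obtain ⟨L, hL, hL'⟩ := hc.subdivide_early (H' := A.sum)
      (K' := B.sum + (e₂ ::ₘ e₂' ::ₘ d + D.sum)) hs₁ hfc
      (fun u => (eA u).ge)
      (fun u => by
        have := s₂ u
        simp only [dg_add, dg_cons, eB, ed, eD]
        omega)
      (by simp only [dg_add, dg_cons]; omega)
    obtain ⟨L', hM, hM'⟩ := hgood (A.sum + (e₁ ::ₘ e₁' ::ₘ c) + B.sum) D.sum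
      (fun u => by
        have := s₁ u
        simp only [dg_add, dg_cons, eA, ec, eB]
        omega)
      (fun u => (eD u).ge)
      (by simp only [dg_add, dg_cons]; omega)
    refine ⟨A ++ (L ++ (B ++ (L' ++ D))), ?_, ?_⟩
    · simp only [List.sum_append, hL, hM, ← Multiset.singleton_add]
      abel
    · simp only [valid_append, List.sum_append, hL, hM, zero_add, add_zero]
      refine ⟨hA.mono hfA (fun _ => le_rfl) fun u => .inl ?_, hL',
        hB.mono hfB (fun u => ?_) fun u => .inl ?_, hM',
        hD.mono hfD (fun u => ?_) fun _ => .inl le_rfl⟩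
      · have := s₁ u
        have := s₂ u
        simp only [dg_add, dg_cons, ec, eB, ed, eD]
        omega
      · have := s₁ u
        simp only [dg_add, dg_cons, eA, ec]
        omega
      · have := s₂ u
        simp only [dg_add, dg_cons, ed, eD]
        omega
      · have := s₁ u
        have := s₂ u
        simp only [dg_add, dg_cons, eA, ec, eB, ed]
        omega
  · exact Valid.pinch_of_bad hA hc hB hD hs₁ hs₂ hfA hfc hfB hfd hfD hvr hv hbad
  · rw [Multiset.cons_swap e₂]
    exact Valid.pinch_of_bad hA hc hB hD hs₁ hs₂.symm hfA hfc hfB hfd hfD hvr hv hbad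

/-- A valid sequence of ears of a graph yields one of the graph obtained by pinching two edges. -/
theorem Valid.pinch {cs : List (Multiset E)} {M : Multiset E} {v x y z w : V}
    {g₁ g₂ e₁ e₁' e₂ e₂' : E} (h : Valid (Ear f r) 0 cs 0) (hcs : cs.sum = g₁ ::ₘ g₂ ::ₘ M)
    (hs₁ : Subdiv f f' v g₁ x y e₁ e₁') (hs₂ : Subdiv f f' v g₂ z w e₂ e₂')
    (hf : ∀ a ∈ M, f' a = f a) (hvr : v ≠ r) (hv : dg f M v = 0) :
    ∃ cs' : List (Multiset E), cs'.sum = e₁ ::ₘ e₁' ::ₘ e₂ ::ₘ e₂' ::ₘ M ∧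
      Valid (Ear f' r) 0 cs' 0 := by
  classical
  have mem_sum : ∀ {cs : List (Multiset E)} {g}, g ∈ cs.sum →
      ∃ A c B, cs = A ++ (g ::ₘ c) :: B := by
    intro cs g hg
    induction cs with
    | nil => simp at hg
    | cons c cs ih =>
      rw [List.sum_cons] at hg
      rcases Multiset.mem_add.1 hg with hg | hg
      · obtain ⟨c, rfl⟩ := Multiset.exists_cons_of_mem hg
        exact ⟨[], c, cs, rfl⟩
      · obtain ⟨A, c', B, rfl⟩ := ih hg
        exact ⟨c :: A, c', B, rfl⟩
  have hv₁ : cnt (f g₁) v = 0 := by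
    simp [hs₁.old, cnt_mk, hs₁.ne_left, hs₁.ne_right]
  have hv₂ : cnt (f g₂) v = 0 := by
    simp [hs₂.old, cnt_mk, hs₂.ne_left, hs₂.ne_right]
  obtain ⟨A, c, B, rfl⟩ := mem_sum (hcs ▸ Multiset.mem_cons_self g₁ _)
  have hM : g₂ ::ₘ M = A.sum + (c + B.sum) := by
    rw [← Multiset.cons_inj_right g₁, ← hcs]
    simp only [List.sum_append, List.sum_cons, ← Multiset.singleton_add]
    abel
  rcases Multiset.mem_add.1 (hM ▸ Multiset.mem_cons_self g₂ M) with hg | hg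
  · obtain ⟨A, d, D, rfl⟩ := mem_sum hg
    obtain rfl : M = A.sum + (d + (D.sum + (c + B.sum))) := by
      rw [← Multiset.cons_inj_right g₂, hM]
      simp only [List.sum_append, List.sum_cons, ← Multiset.singleton_add]
      abel
    rw [List.append_assoc, List.cons_append] at h
    obtain ⟨cs', h₁, h₂⟩ := h.pinch_of_lt hs₂ hs₁ hf hvr (by
      simp only [dg_add, dg_cons] at hv ⊢
      omega)
    refine ⟨cs', ?_, h₂⟩
    rw [h₁]
    simp only [← Multiset.singleton_add]
    abel
  · rcases Multiset.mem_add.1 hg with hg | hg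
    · obtain ⟨d, rfl⟩ := Multiset.exists_cons_of_mem hg
      obtain rfl : M = A.sum + (d + B.sum) := by
        rw [← Multiset.cons_inj_right g₂, hM]
        simp only [← Multiset.singleton_add]
        abel
      simp only [valid_append, Valid, List.sum_cons, add_zero, zero_add] at h
      obtain ⟨hA, hc, hB⟩ := h
      simp only [Multiset.mem_add] at hf
      have eA := dg_congr fun a ha => hf a (.inl ha)
      have ed := dg_congr fun a ha => hf a (.inr (.inl ha))
      have eB := dg_congr fun a ha => hf a (.inr (.inr ha))
      obtain ⟨L, hL, hL'⟩ := hc.subdivide_both hs₁ hs₂ (fun a ha => hf a (.inr (.inl ha)))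
        (fun u => (eA u).ge) (fun u => (eB u).ge)
      refine ⟨A ++ (L ++ B), ?_, ?_⟩
      · simp only [List.sum_append, hL, ← Multiset.singleton_add]
        abel
      · simp only [valid_append, List.sum_append, hL, zero_add, add_zero]
        refine ⟨hA.mono (fun a ha => hf a (.inl ha)) (fun _ => le_rfl) fun u => .inl ?_, hL',
          hB.mono (fun a ha => hf a (.inr (.inr ha))) (fun u => ?_) fun _ => .inl le_rfl⟩
        · have := hs₁.cnt_le u
          have := hs₂.cnt_le u
          simp only [dg_add, dg_cons, ed, eB]
          omega
        · have := hs₁.cnt_le u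
          have := hs₂.cnt_le u
          simp only [dg_add, dg_cons, eA, ed]
          omega
    · obtain ⟨B, d, D, rfl⟩ := mem_sum hg
      obtain rfl : M = A.sum + (c + (B.sum + (d + D.sum))) := by
        rw [← Multiset.cons_inj_right g₂, hM]
        simp only [List.sum_append, List.sum_cons, ← Multiset.singleton_add]
        abel
      exact h.pinch_of_lt hs₁ hs₂ hf hvr (by
        simp only [dg_add, dg_cons] at hv ⊢
        omega)

/-! ### Edge cuts -/

open Classical in
/-- Whether an edge with endpoints `s` has exactly one end in `X`. -/
noncomputable def cr (s : Sym2 V) (X : Set V) : ℕ :=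
  if (∃ a ∈ s, a ∈ X) ∧ ∃ b ∈ s, b ∉ X then 1 else 0

open Classical in
theorem cr_mk (a b : V) (X : Set V) : cr s(a, b) X = if (a ∈ X ↔ b ∈ X) then 0 else 1 := by
  unfold cr
  simp only [Sym2.mem_iff]
  by_cases ha : a ∈ X <;> by_cases hb : b ∈ X <;> simp [ha, hb]

/-- The number of edges of `M` with exactly one end in `X`. -/
noncomputable def dc (f : E → Sym2 V) (M : Multiset E) (X : Set V) : ℕ :=
  (M.map fun e => cr (f e) X).sum

@[simp] theorem dc_zero (X : Set V) : dc f 0 X = 0 := by simp [dc]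

@[simp] theorem dc_cons (e : E) (M : Multiset E) (X : Set V) :
    dc f (e ::ₘ M) X = cr (f e) X + dc f M X := by simp [dc]

theorem dc_congr {M : Multiset E} {X Y : Set V} (h : ∀ e ∈ M, cr (f' e) Y = cr (f e) X) :
    dc f' M Y = dc f M X := by
  unfold dc
  rw [Multiset.map_congr rfl h]

theorem dc_compl (M : Multiset E) (X : Set V) : dc f M Xᶜ = dc f M X := by
  classical
  refine dc_congr fun e _ => ?_
  induction f e with
  | h a b =>
    simp only [cr_mk, Set.mem_compl_iff]
    congr 1
    exact propext not_iff_not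

theorem dc_inter_add_union_le (M : Multiset E) (X Y : Set V) :
    dc f M (X ∩ Y) + dc f M (X ∪ Y) ≤ dc f M X + dc f M Y := by
  classical
  induction M using Multiset.induction with
  | empty => simp
  | cons e M ih =>
    have : cr (f e) (X ∩ Y) + cr (f e) (X ∪ Y) ≤ cr (f e) X + cr (f e) Y := by
      induction f e with
      | h a b =>
        simp only [cr_mk, Set.mem_inter_iff, Set.mem_union]
        by_cases a ∈ X <;> by_cases b ∈ X <;> by_cases a ∈ Y <;> by_cases b ∈ Y <;> simp [*]
    simp only [dc_cons]
    omega

theorem dc_triple_le (M : Multiset E) (X Y Z : Set V) :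
    dc f M (X ∩ Y ∩ Z) + dc f M (X \ (Y ∪ Z)) + dc f M (Y \ (X ∪ Z)) + dc f M (Z \ (X ∪ Y)) ≤
      dc f M X + dc f M Y + dc f M Z := by
  classical
  induction M using Multiset.induction with
  | empty => simp
  | cons e M ih =>
    have : cr (f e) (X ∩ Y ∩ Z) + cr (f e) (X \ (Y ∪ Z)) + cr (f e) (Y \ (X ∪ Z)) +
        cr (f e) (Z \ (X ∪ Y)) ≤ cr (f e) X + cr (f e) Y + cr (f e) Z := by
      induction f e with
      | h a b =>
        simp only [cr_mk, Set.mem_inter_iff, Set.mem_union, Set.mem_sdiff]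
        by_cases a ∈ X <;> by_cases b ∈ X <;> by_cases a ∈ Y <;> by_cases b ∈ Y <;>
          by_cases a ∈ Z <;> by_cases b ∈ Z <;> simp [*]
    simp only [dc_cons]
    omega

theorem dc_singleton_le_dg (M : Multiset E) (x : V) : dc f M {x} ≤ dg f M x := by
  classical
  induction M using Multiset.induction with
  | empty => simp
  | cons e M ih =>
    have : cr (f e) {x} ≤ cnt (f e) x := by
      induction f e with
      | h a b =>
        simp only [cr_mk, cnt_mk, Set.mem_singleton_iff]
        by_cases a = x <;> by_cases b = x <;> simp [*]
    simp only [dc_cons, dg_cons]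
    omega

/-- Every cut separating two vertices of `W` has at least four edges. -/
def CutCond (f : E → Sym2 V) (M : Multiset E) (W : Set V) : Prop :=
  ∀ X : Set V, (∃ a ∈ W, a ∈ X) → (∃ b ∈ W, b ∉ X) → 4 ≤ dc f M X

theorem exists_cons_of_dc {M : Multiset E} {X : Set V} {n : ℕ} (h : dc f M X = n + 1) :
    ∃ e M', M = e ::ₘ M' ∧ cr (f e) X = 1 ∧ dc f M' X = n := by
  have h1 : ∀ e, cr (f e) X ≤ 1 := fun e => by unfold cr; split_ifs <;> simp
  obtain ⟨e, he, h2⟩ : ∃ e ∈ M, cr (f e) X ≠ 0 := by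
    by_contra! h0
    have : dc f M X = 0 := Multiset.sum_eq_zero (by simpa using h0)
    omega
  obtain ⟨M', rfl⟩ := Multiset.exists_cons_of_mem he
  have := h1 e
  rw [dc_cons] at h
  exact ⟨e, M', rfl, by omega, by omega⟩

theorem eq_mk_of_cr_singleton {s : Sym2 V} {v : V} (h : cr s {v} = 1) :
    ∃ x, x ≠ v ∧ s = s(x, v) := by
  classical
  induction s with
  | h a b =>
    rw [cr_mk] at h
    by_cases ha : a = v
    · subst ha
      by_cases hb : b = a
      · simp [hb] at h
      · exact ⟨b, hb, Sym2.eq_swap⟩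
    · by_cases hb : b = v
      · subst hb
        exact ⟨a, ha, rfl⟩
      · simp [ha, hb] at h

/-- If deleting any edge violates the cut condition, every edge lies in a tight cut. -/
theorem CutCond.exists_tight {M : Multiset E} {W : Set V} (h : CutCond f M W) {e : E}
    {M' : Multiset E} (hM : M = e ::ₘ M') (hn : ¬ CutCond f M' W) (r : V) :
    ∃ Y, r ∉ Y ∧ dc f M Y = 4 ∧ cr (f e) Y = 1 := by
  classical
  have h1 : ∀ e X, cr (f e) X ≤ 1 := fun e X => by unfold cr; split_ifs <;> simp
  simp only [CutCond, not_forall] at hn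
  obtain ⟨Y, hY₁, hY₂, hY⟩ := hn
  have h2 := h Y hY₁ hY₂
  have h3 := h1 e Y
  have h4 : dc f M Y = cr (f e) Y + dc f M' Y := by rw [hM, dc_cons]
  by_cases hr : r ∈ Y
  · refine ⟨Yᶜ, by simpa using hr, ?_, ?_⟩
    · rw [dc_compl]
      omega
    · have h5 := dc_compl (f := f) {e} Y
      simp only [dc, Multiset.map_singleton, Multiset.sum_singleton] at h5
      omega
  · exact ⟨Y, hr, by omega, by omega⟩

/-- A graph in which every edge lies in a tight cut has a vertex of degree four. -/
theorem CutCond.exists_degree_four [Finite V] {M : Multiset E} {W : Set V} (h : CutCond f M W)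
    (hr : r ∈ W) (hM : M ≠ 0) (hW : ∀ e ∈ M, ∀ a ∈ f e, a ∈ W)
    (ht : ∀ e ∈ M, ∃ Y, r ∉ Y ∧ dc f M Y = 4 ∧ cr (f e) Y = 1) :
    ∃ v ∈ W, v ≠ r ∧ dc f M {v} = 4 := by
  classical
  let S : Set (Set V) := {X | X ⊆ W ∧ r ∉ X ∧ X.Nonempty ∧ dc f M X = 4}
  have hS : S.Nonempty := by
    obtain ⟨e, he⟩ := Multiset.exists_mem_of_ne_zero hM
    obtain ⟨Y, hY₁, hY₂, hY₃⟩ := ht e he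
    refine ⟨Y ∩ W, Set.inter_subset_right, fun h => hY₁ h.1, ?_, ?_⟩
    · unfold cr at hY₃
      split_ifs at hY₃ with h0
      obtain ⟨⟨a, ha, ha'⟩, -⟩ := h0
      exact ⟨a, ha', hW e he a ha⟩
    · rw [← hY₂]
      refine dc_congr fun e he => ?_
      have := hW e he
      revert this
      induction f e with
      | h a b =>
        intro this
        simp [cr_mk, this a, this b]
  obtain ⟨X, ⟨hXW, hrX, ⟨p, hp⟩, hX⟩, hmin⟩ :=
    (wellFounded_lt : WellFounded ((· < ·) : Set V → Set V → Prop)).has_min S hS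
  have hpr : p ≠ r := fun h => hrX (h ▸ hp)
  by_cases hXp : X = {p}
  · exact ⟨p, hXW hp, hpr, hXp ▸ hX⟩
  exfalso
  obtain ⟨q, hq, hqp⟩ : ∃ q ∈ X, q ≠ p := by
    by_contra! h0
    exact hXp (Set.eq_singleton_iff_unique_mem.2 ⟨hp, h0⟩)
  have h1 := h {p} ⟨p, hXW hp, rfl⟩ ⟨r, hr, hpr.symm⟩
  have h2 := h (X \ {p}) ⟨q, hXW hq, hq, hqp⟩ ⟨r, hr, fun h => hrX h.1⟩
  obtain ⟨e, he, hlt⟩ : ∃ e ∈ M, cr (f e) X < cr (f e) {p} + cr (f e) (X \ {p}) := by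
    by_contra! h0
    have : dc f M {p} + dc f M (X \ {p}) ≤ dc f M X := by
      unfold dc
      rw [← Multiset.sum_map_add]
      exact Multiset.sum_map_le_sum_map _ _ h0
    omega
  obtain ⟨Y, hrY, hY, hcr⟩ := ht e he
  obtain ⟨⟨a, haX, haY⟩, b, hbX, hbY⟩ : (∃ a ∈ X, a ∈ Y) ∧ ∃ b ∈ X, b ∉ Y := by
    revert hlt hcr
    induction f e with
    | h a b =>
      intro hlt hcr
      have hab : a ∈ X ∧ b ∈ X := by
        simp only [cr_mk, Set.mem_sdiff, Set.mem_singleton_iff] at hlt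
        by_cases h1 : a ∈ X <;> by_cases h2 : b ∈ X <;> by_cases h3 : a = p <;>
          by_cases h4 : b = p <;> simp_all
      rw [cr_mk] at hcr
      by_cases h1 : a ∈ Y <;> by_cases h2 : b ∈ Y <;> simp [h1, h2] at hcr
      · exact ⟨⟨a, hab.1, h1⟩, b, hab.2, h2⟩
      · exact ⟨⟨b, hab.2, h2⟩, a, hab.1, h1⟩
  have h3 := h (X ∩ Y) ⟨a, hXW haX, haX, haY⟩ ⟨r, hr, fun h => hrX h.1⟩
  have h4 := h (X ∪ Y) ⟨a, hXW haX, .inl haX⟩ ⟨r, hr, fun h => h.elim hrX hrY⟩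
  have h5 := dc_inter_add_union_le (f := f) M X Y
  exact hmin (X ∩ Y) ⟨fun u hu => hXW hu.1, fun h => hrX h.1, ⟨a, haX, haY⟩, by omega⟩
    ⟨fun u hu => hu.1, fun h => hbY (h hbX).2⟩

/-- One of the three ways to split off the edges at a vertex of degree four preserves the
cut condition. -/
theorem exists_splitting {M : Multiset E} {W : Set V} {x₁ x₂ x₃ x₄ : V} (h₁ : x₁ ∈ W)
    (h₂ : x₂ ∈ W) (h₃ : x₃ ∈ W) (h₄ : x₄ ∈ W)
    (h : ∀ X : Set V, (∃ a ∈ W, a ∈ X) → (∃ b ∈ W, b ∉ X) →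
      4 ≤ dc f M X + (X.indicator 1 x₁ + X.indicator 1 x₂ + X.indicator 1 x₃ +
        X.indicator 1 x₄) ∧
      X.indicator 1 x₁ + X.indicator 1 x₂ + X.indicator 1 x₃ + X.indicator 1 x₄ ≤ dc f M X) :
    (∀ X : Set V, (∃ a ∈ W, a ∈ X) → (∃ b ∈ W, b ∉ X) →
      4 ≤ dc f M X + cr s(x₁, x₂) X + cr s(x₃, x₄) X) ∨
    (∀ X : Set V, (∃ a ∈ W, a ∈ X) → (∃ b ∈ W, b ∉ X) →
      4 ≤ dc f M X + cr s(x₁, x₃) X + cr s(x₂, x₄) X) ∨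
    (∀ X : Set V, (∃ a ∈ W, a ∈ X) → (∃ b ∈ W, b ∉ X) →
      4 ≤ dc f M X + cr s(x₁, x₄) X + cr s(x₂, x₃) X) := by
  classical
  have key : ∀ X : Set V, (∃ a ∈ W, a ∈ X) → (∃ b ∈ W, b ∉ X) →
      4 ≤ dc f M X + ((if x₁ ∈ X then 1 else 0) + (if x₂ ∈ X then 1 else 0) +
        (if x₃ ∈ X then 1 else 0) + (if x₄ ∈ X then 1 else 0)) ∧
      (if x₁ ∈ X then 1 else 0) + (if x₂ ∈ X then 1 else 0) +
        (if x₃ ∈ X then 1 else 0) + (if x₄ ∈ X then 1 else 0) ≤ dc f M X := fun X hX hX' => by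
    simpa only [Set.indicator_apply, Pi.one_apply] using h X hX hX'
  by_contra! hcon
  obtain ⟨⟨X, hX₁, hX₂, hX⟩, ⟨Y, hY₁, hY₂, hY⟩, Z, hZ₁, hZ₂, hZ⟩ := hcon
  obtain ⟨X, hX, a₁, a₂, a₃, a₄⟩ : ∃ X : Set V, dc f M X ≤ 3 ∧ x₁ ∈ X ∧ x₂ ∈ X ∧ x₃ ∉ X ∧
      x₄ ∉ X := by
    have := key X hX₁ hX₂
    simp only [cr_mk] at hX
    by_cases b₁ : x₁ ∈ X <;> by_cases b₂ : x₂ ∈ X <;> by_cases b₃ : x₃ ∈ X <;>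
      by_cases b₄ : x₄ ∈ X <;> simp only [b₁, b₂, b₃, b₄, if_true, if_false, iff_false, iff_true,
        not_true_eq_false] at this hX <;> try omega
    · exact ⟨X, by omega, b₁, b₂, b₃, b₄⟩
    · exact ⟨Xᶜ, by rw [dc_compl]; omega, b₁, b₂, by simpa using b₃, by simpa using b₄⟩
  obtain ⟨Y, hY, b₁, b₃, b₂, b₄⟩ : ∃ X : Set V, dc f M X ≤ 3 ∧ x₁ ∈ X ∧ x₃ ∈ X ∧ x₂ ∉ X ∧
      x₄ ∉ X := by
    have := key Y hY₁ hY₂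
    simp only [cr_mk] at hY
    by_cases b₁ : x₁ ∈ Y <;> by_cases b₂ : x₂ ∈ Y <;> by_cases b₃ : x₃ ∈ Y <;>
      by_cases b₄ : x₄ ∈ Y <;> simp only [b₁, b₂, b₃, b₄, if_true, if_false, iff_false, iff_true,
        not_true_eq_false] at this hY <;> try omega
    · exact ⟨Y, by omega, b₁, b₃, b₂, b₄⟩
    · exact ⟨Yᶜ, by rw [dc_compl]; omega, b₁, b₃, by simpa using b₂, by simpa using b₄⟩
  obtain ⟨Z, hZ, c₁, c₄, c₂, c₃⟩ : ∃ X : Set V, dc f M X ≤ 3 ∧ x₁ ∈ X ∧ x₄ ∈ X ∧ x₂ ∉ X ∧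
      x₃ ∉ X := by
    have := key Z hZ₁ hZ₂
    simp only [cr_mk] at hZ
    by_cases b₁ : x₁ ∈ Z <;> by_cases b₂ : x₂ ∈ Z <;> by_cases b₃ : x₃ ∈ Z <;>
      by_cases b₄ : x₄ ∈ Z <;> simp only [b₁, b₂, b₃, b₄, if_true, if_false, iff_false, iff_true,
        not_true_eq_false] at this hZ <;> try omega
    · exact ⟨Z, by omega, b₁, b₄, b₂, b₃⟩
    · exact ⟨Zᶜ, by rw [dc_compl]; omega, b₁, b₄, by simpa using b₂, by simpa using b₃⟩
  have k₁ := key (X ∩ Y ∩ Z) ⟨x₁, h₁, ⟨a₁, b₁⟩, c₁⟩ ⟨x₂, h₂, by simp [*]⟩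
  have k₂ := key (X \ (Y ∪ Z)) ⟨x₂, h₂, by simp [*]⟩ ⟨x₁, h₁, by simp [*]⟩
  have k₃ := key (Y \ (X ∪ Z)) ⟨x₃, h₃, by simp [*]⟩ ⟨x₁, h₁, by simp [*]⟩
  have k₄ := key (Z \ (X ∪ Y)) ⟨x₄, h₄, by simp [*]⟩ ⟨x₁, h₁, by simp [*]⟩
  simp [a₁, a₂, a₃, a₄, b₁, b₂, b₃, b₄, c₁, c₂, c₃, c₄] at k₁ k₂ k₃ k₄
  have := dc_triple_le (f := f) M X Y Z
  omega

/-- A graph satisfying the cut condition has a valid sequence of ears. -/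
theorem CutCond.exists_valid [Finite V] {M : Multiset E} {W : Set V} (h : CutCond f M W)
    (hM : M.Nodup) (hr : r ∈ W) (hW : ∀ e ∈ M, ∀ a ∈ f e, a ∈ W) :
    ∃ cs : List (Multiset E), cs.sum = M ∧ Valid (Ear f r) 0 cs 0 := by
  classical
  induction hn : M.card using Nat.strong_induction_on generalizing f M W with
  | h n ih =>
  subst hn
  by_cases hdel : ∃ e M', M = e ::ₘ M' ∧ CutCond f M' W
  · obtain ⟨e, M', rfl, h'⟩ := hdel
    obtain ⟨cs, rfl, hcs⟩ := ih _ (by simp) h' (Multiset.nodup_cons.1 hM).2 hr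
      (fun a ha => hW a (Multiset.mem_cons_of_mem ha)) rfl
    have hbig : ∀ u ∈ f e, Big f r cs.sum u := by
      intro u hu
      by_cases hur : u = r
      · exact .inl hur
      · have h1 := h' {u} ⟨u, hW e (Multiset.mem_cons_self _ _) u hu, rfl⟩ ⟨r, hr, Ne.symm hur⟩
        have h2 := dc_singleton_le_dg (f := f) cs.sum u
        exact .inr (by omega)
    obtain ⟨u, v, he⟩ : ∃ u v, f e = s(u, v) := by
      induction f e with
      | h a b => exact ⟨a, b, rfl⟩
    exact hcs.add_edge he (hbig u (by simp [he])) (hbig v (by simp [he]))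
  by_cases hM0 : M = 0
  · exact ⟨[], hM0.symm, trivial⟩
  have ht : ∀ e ∈ M, ∃ Y, r ∉ Y ∧ dc f M Y = 4 ∧ cr (f e) Y = 1 := by
    intro e he
    obtain ⟨M', hM'⟩ := Multiset.exists_cons_of_mem he
    exact h.exists_tight hM' (fun h' => hdel ⟨e, M', hM', h'⟩) r
  obtain ⟨v, hvW, hvr, hv⟩ := h.exists_degree_four hr hM0 hW ht
  obtain ⟨e₁, M₁, hM₁, c₁, hv⟩ := exists_cons_of_dc hv
  obtain ⟨e₂, M₂, hM₂, c₂, hv⟩ := exists_cons_of_dc hv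
  obtain ⟨e₃, M₃, hM₃, c₃, hv⟩ := exists_cons_of_dc hv
  obtain ⟨e₄, M₀, hM₄, c₄, hv'⟩ := exists_cons_of_dc hv
  subst hM₄ hM₃ hM₂
  obtain ⟨x₁, hx₁, f₁⟩ := eq_mk_of_cr_singleton c₁
  obtain ⟨x₂, hx₂, f₂⟩ := eq_mk_of_cr_singleton c₂
  obtain ⟨x₃, hx₃, f₃⟩ := eq_mk_of_cr_singleton c₃
  obtain ⟨x₄, hx₄, f₄⟩ := eq_mk_of_cr_singleton c₄
  have w₁ : x₁ ∈ W \ {v} := ⟨hW e₁ (by simp [hM₁]) x₁ (by simp [f₁]), hx₁⟩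
  have w₂ : x₂ ∈ W \ {v} := ⟨hW e₂ (by simp [hM₁]) x₂ (by simp [f₂]), hx₂⟩
  have w₃ : x₃ ∈ W \ {v} := ⟨hW e₃ (by simp [hM₁]) x₃ (by simp [f₃]), hx₃⟩
  have w₄ : x₄ ∈ W \ {v} := ⟨hW e₄ (by simp [hM₁]) x₄ (by simp [f₄]), hx₄⟩
  have hv₀ : ∀ e ∈ M₀, v ∉ f e := by
    intro e he hve
    obtain ⟨Y, -, -, hY⟩ := ht e (by simp [hM₁, he])
    have h0 : cr (f e) {v} = 0 := by
      obtain ⟨M', rfl⟩ := Multiset.exists_cons_of_mem he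
      rw [dc_cons] at hv'
      omega
    revert h0 hY hve
    induction f e with
    | h a b =>
      intro hve hY h0
      simp only [cr_mk, Set.mem_singleton_iff, Sym2.mem_iff] at hve hY h0
      rcases hve with rfl | rfl
      · by_cases hb : b = v
        · simp [hb] at hY
        · simp [hb] at h0
      · by_cases ha : a = v
        · simp [ha] at hY
        · simp [ha] at h0
  have final : ∀ {e₁ e₁' e₂ e₂' x y z w}, M = e₁ ::ₘ e₁' ::ₘ e₂ ::ₘ e₂' ::ₘ M₀ →
      f e₁ = s(x, v) → f e₁' = s(y, v) → f e₂ = s(z, v) → f e₂' = s(w, v) →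
      x ∈ W \ {v} → y ∈ W \ {v} → z ∈ W \ {v} → w ∈ W \ {v} →
      (∀ X : Set V, (∃ a ∈ W \ {v}, a ∈ X) → (∃ b ∈ W \ {v}, b ∉ X) →
        4 ≤ dc f M₀ X + cr s(x, y) X + cr s(z, w) X) →
      ∃ cs : List (Multiset E), cs.sum = M ∧ Valid (Ear f r) 0 cs 0 := by
    intro e₁ e₁' e₂ e₂' x y z w hM' h₁ h₁' h₂ h₂' hx hy hz hw hcut
    rw [hM'] at hM ⊢
    simp only [Multiset.nodup_cons, Multiset.mem_cons, not_or] at hM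
    obtain ⟨⟨-, n₁₂, -, n₁⟩, -, ⟨-, n₂⟩, -, n₀⟩ := hM
    set f₀ : E → Sym2 V := Function.update (Function.update f e₁ s(x, y)) e₂ s(z, w) with hf₀
    have u₁ : f₀ e₁ = s(x, y) := by simp [hf₀, n₁₂]
    have u₂ : f₀ e₂ = s(z, w) := by simp [hf₀]
    have u₀ : ∀ e ∈ M₀, f₀ e = f e := by
      intro e he
      have : e ≠ e₁ := by rintro rfl; exact n₁ he
      have : e ≠ e₂ := by rintro rfl; exact n₂ he
      simp [f₀, *]
    obtain ⟨cs, hcs, hval⟩ := ih (M := e₁ ::ₘ e₂ ::ₘ M₀) (f := f₀) (W := W \ {v}) _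
      (by simp [hM']) (fun X hX hX' => by
        have := hcut X hX hX'
        rw [dc_cons, dc_cons, u₁, u₂, dc_congr fun e he => by rw [u₀ e he]]
        omega)
      (by simp [n₁₂, n₁, n₂, n₀]) ⟨hr, hvr.symm⟩
      (fun e he a ha => by
        simp only [Multiset.mem_cons] at he
        rcases he with rfl | rfl | he
        · rw [u₁, Sym2.mem_iff] at ha
          rcases ha with rfl | rfl <;> assumption
        · rw [u₂, Sym2.mem_iff] at ha
          rcases ha with rfl | rfl <;> assumption
        · rw [u₀ e he] at ha
          refine ⟨hW e (by simp [hM', he]) a ha, ?_⟩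
          rintro rfl
          exact hv₀ e he ha) rfl
    exact hval.pinch hcs ⟨u₁, h₁, h₁', hx.2, hy.2⟩ ⟨u₂, h₂, h₂', hz.2, hw.2⟩
      (fun e he => (u₀ e he).symm) hvr
      (dg_eq_zero fun e he => by rw [u₀ e he]; exact hv₀ e he)
  have hsplit := exists_splitting (f := f) (M := M₀) w₁ w₂ w₃ w₄ fun X => by
    rintro ⟨a, ha, haX⟩ ⟨b, hb, hbX⟩
    have h₁ := h (X \ {v}) ⟨a, ha.1, haX, ha.2⟩ ⟨b, hb.1, fun h => hbX h.1⟩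
    have h₂ := h (insert v X) ⟨a, ha.1, .inr haX⟩ ⟨b, hb.1, fun h => h.elim hb.2 hbX⟩
    have h₃ : dc f M₀ (X \ {v}) = dc f M₀ X := dc_congr fun e he => by
      have := hv₀ e he
      revert this
      induction f e with
      | h a b =>
        intro this
        simp only [Sym2.mem_iff, not_or] at this
        simp [cr_mk, Ne.symm this.1, Ne.symm this.2]
    have h₄ : dc f M₀ (insert v X) = dc f M₀ X := dc_congr fun e he => by
      have := hv₀ e he
      revert this
      induction f e with
      | h a b =>
        intro this
        simp only [Sym2.mem_iff, not_or] at this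
        simp [cr_mk, Ne.symm this.1, Ne.symm this.2]
    rw [hM₁] at h₁ h₂
    simp [h₃, h₄, f₁, f₂, f₃, f₄, cr_mk, hx₁, hx₂, hx₃, hx₄] at h₁ h₂
    simp only [Set.indicator_apply, Pi.one_apply]
    constructor
    · by_cases x₁ ∈ X <;> by_cases x₂ ∈ X <;> by_cases x₃ ∈ X <;> by_cases x₄ ∈ X <;>
        simp [*] at h₁ ⊢ <;> omega
    · by_cases x₁ ∈ X <;> by_cases x₂ ∈ X <;> by_cases x₃ ∈ X <;> by_cases x₄ ∈ X <;>
        simp [*] at h₂ ⊢ <;> omega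
  rcases hsplit with hs | hs | hs
  · exact final hM₁ f₁ f₂ f₃ f₄ w₁ w₂ w₃ w₄ hs
  · refine final (hM₁.trans ?_) f₁ f₃ f₂ f₄ w₁ w₃ w₂ w₄ hs
    rw [Multiset.cons_swap e₂]
  · refine final (hM₁.trans ?_) f₁ f₄ f₂ f₃ w₁ w₄ w₂ w₃ hs
    rw [Multiset.cons_swap e₃, Multiset.cons_swap e₂]

/-! ### From ears to chains -/

variable {G : MG} {r : G.V}

theorem deg_eq_dg {M : Multiset G.E} (hM : M.Nodup) (v : G.V) :
    G.deg {e | e ∈ M} v = dg G.ends M v := by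
  classical
  have key : ∀ (p : G.E → Prop) [DecidablePred p],
      {e | e ∈ M ∧ p e}.ncard = (M.map fun e => if p e then 1 else 0).sum := by
    intro p _
    have : {e | e ∈ M ∧ p e} = (Finset.mk M hM).filter p := by
      ext e
      simp
    rw [this, Set.ncard_coe_finset, Finset.card_filter]
    rfl
  unfold MG.deg dg cnt
  rw [Multiset.sum_map_add, ← key, ← key]
  rfl

theorem Big.deg {M : Multiset G.E} {v : G.V} (h : Big G.ends r M v) (hM : M.Nodup) :
    v = r ∨ 2 ≤ G.deg {e | e ∈ M} v := by
  rwa [deg_eq_dg hM]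

/-- The up chain condition for multisets of edges without repetitions. -/
def UpChain (r : G.V) (H c K : Multiset G.E) : Prop :=
  (H + c + K).Nodup → G.IsUpChain r {e | e ∈ H} {e | e ∈ K} {e | e ∈ c}

/-- The chain condition for multisets of edges without repetitions. -/
def Chain (r : G.V) (H c K : Multiset G.E) : Prop :=
  (H + c + K).Nodup → G.IsChain r {e | e ∈ H} {e | e ∈ K} {e | e ∈ c}

theorem Valid.imp {P P' : Multiset E → Multiset E → Multiset E → Prop} {H K : Multiset E}
    {L : List (Multiset E)} (h : Valid P H L K) (hP : ∀ {H c K}, P H c K → P' H c K) :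
    Valid P' H L K := by
  induction L generalizing H with
  | nil => trivial
  | cons c L ih => exact ⟨hP h.1, ih h.2⟩

theorem Valid.reverse {P P' : Multiset E → Multiset E → Multiset E → Prop} {H K : Multiset E}
    {L : List (Multiset E)} (h : Valid P K L H) (hP : ∀ {H c K}, P K c H → P' H c K) :
    Valid P' H L.reverse K := by
  induction L generalizing K with
  | nil => trivial
  | cons c L ih =>
    rw [List.reverse_cons, valid_append]
    refine ⟨by simpa [add_comm] using ih h.2, valid_singleton.2 (hP ?_)⟩
    simpa [add_comm] using h.1

theorem Tr.eq_of_eq_zero {P : V → Prop} {a b : V} {m : Multiset E} (h : Tr f P a m b)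
    (hm : m = 0) : a = b := by
  cases h with
  | nil _ => rfl
  | cons _ _ _ => simp at hm

theorem Tr.one_le {P : V → Prop} {a b : V} {m : Multiset E} (h : Tr f P a m b) :
    a = b ∨ 1 ≤ dg f m a := by
  by_cases hm : m = 0
  · exact .inl (h.eq_of_eq_zero hm)
  · exact .inr (Nat.one_le_iff_ne_zero.2 (h.dg_start hm))

/-- A trail is a path, or a cycle, or contains a closed trail as a proper part. -/
theorem Tr.simple_or_split {P : G.V → Prop} {p q : G.V} {m : Multiset G.E}
    (h : Tr G.ends P p m q) :
    (∃ vs es, G.IsLink (p :: vs) es ∧ (p :: vs).getLast? = some q ∧ (p :: vs).Nodup ∧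
      (es : Multiset G.E) = m ∧
      ∀ x ∈ p :: vs, ∃ m₁ m₂, m = m₁ + m₂ ∧ Tr G.ends P p m₁ x ∧ Tr G.ends P x m₂ q) ∨
    (p = q ∧ m ≠ 0 ∧ ∃ vs es, G.IsLink (p :: (vs ++ [p])) es ∧ (p :: vs).Nodup ∧
      (es : Multiset G.E) = m ∧ ∀ x ∈ p :: vs, P x) ∨
    ∃ a m₁ m₂ m₃, m = m₁ + m₂ + m₃ ∧ Tr G.ends P p m₁ a ∧ Tr G.ends P a m₂ a ∧
      Tr G.ends P a m₃ q ∧ m₂ ≠ 0 ∧ m₁ + m₃ ≠ 0 := by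
  induction h with
  | @nil a ha =>
    exact .inl ⟨[], [], trivial, rfl, by simp, rfl, by simpa using ⟨0, 0, rfl, .nil ha, .nil ha⟩⟩
  | @cons a b c e m ha he h ih =>
    have h₀ := Tr.single ha h.start he
    rcases ih with ⟨vs, es, hl, hlast, hnd, rfl, hx⟩ | ⟨rfl, hm, -⟩ |
      ⟨x, m₁, m₂, m₃, rfl, h₁, h₂, h₃, n₁, n₂⟩
    · by_cases hab : a ∈ b :: vs
      · by_cases hac : a = c
        · subst hac
          refine .inr (.inl ⟨rfl, by simp, (b :: vs).dropLast, e :: es, ?_, ?_, rfl, ?_⟩)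
          all_goals have hd := List.dropLast_append_getLast? a hlast
          · rw [hd]
            exact ⟨he, hl⟩
          · rw [← hd] at hnd
            rwa [List.nodup_append_comm] at hnd
          · intro x hx'
            rcases List.mem_cons.1 hx' with rfl | hx'
            · exact ha
            · obtain ⟨m₁, m₂, -, h₁, -⟩ := hx x (List.mem_of_mem_dropLast hx')
              exact h₁.last
        · obtain ⟨m₁, m₂, hm, h₁, h₂⟩ := hx a hab
          refine .inr (.inr ⟨a, 0, e ::ₘ m₁, m₂, ?_, .nil ha, .cons ha he h₁, h₂, by simp, ?_⟩)
          · rw [hm, zero_add, Multiset.cons_add]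
          · rw [zero_add]
            exact fun h0 => hac (h₂.eq_of_eq_zero h0)
      · refine .inl ⟨b :: vs, e :: es, ⟨he, hl⟩, by simpa using hlast,
          List.nodup_cons.2 ⟨hab, hnd⟩, rfl, ?_⟩
        intro x hx'
        rcases List.mem_cons.1 hx' with rfl | hx'
        · exact ⟨0, _, (zero_add _).symm, .nil ha, .cons ha he h⟩
        · obtain ⟨m₁, m₂, hm, h₁, h₂⟩ := hx x hx'
          exact ⟨e ::ₘ m₁, m₂, by rw [hm, Multiset.cons_add], .cons ha he h₁, h₂⟩
    · exact .inr (.inr ⟨b, {e}, m, 0, by simp, h₀, h, .nil h.start, hm, by simp⟩)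
    · refine .inr (.inr ⟨x, e ::ₘ m₁, m₂, m₃, ?_, .cons ha he h₁, h₂, h₃, n₁, by simp⟩)
      simp [Multiset.cons_add]

theorem exists_mem_of_dg {M : Multiset E} {x : V} (h : dg f M x ≠ 0) : ∃ e ∈ M, x ∈ f e := by
  by_contra! h'
  exact h (dg_eq_zero h')

/-- A trail on vertices that are big in `K`, with ends covered by `H`, decomposes into up
chains. -/
theorem Tr.exists_upChains {H K m : Multiset G.E} {p q : G.V}
    (h : Tr G.ends (Big G.ends r K) p m q) (hc : Cap G.ends r H p q) :
    ∃ L : List (Multiset G.E), L.sum = m ∧ Valid (UpChain r) H L K := by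
  classical
  induction hn : m.card using Nat.strong_induction_on generalizing H K m p q with
  | h n ih =>
  subst hn
  by_cases hm : m = 0
  · exact ⟨[], hm.symm, trivial⟩
  have disj : (H + m + K).Nodup → Disjoint {e | e ∈ m} {e | e ∈ H} ∧
      Disjoint {e | e ∈ m} {e | e ∈ K} := by
    intro hnd
    rw [Multiset.nodup_add, Multiset.nodup_add] at hnd
    simp only [Set.disjoint_left, Set.mem_ofPred_eq]
    refine ⟨fun e he he' => Multiset.disjoint_left.1 hnd.1.2.2 he' he, fun e he he' =>
      Multiset.disjoint_left.1 hnd.2.2 (Multiset.mem_add.2 (.inr he)) he'⟩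
  rcases h.simple_or_split with ⟨vs, es, hl, hlast, hvs, rfl, hx⟩ |
    ⟨rfl, -, vs, es, hl, hvs, rfl, hx⟩ | ⟨a, m₁, m₂, m₃, rfl, h₁, h₂, h₃, n₁, n₂⟩
  · refine ⟨[es], by simp, valid_singleton.2 fun hnd => .inl ⟨(disj hnd).1, (disj hnd).2,
      p :: vs, es, ⟨hvs, ?_, hl⟩, by simpa using hm, rfl, ?_, ?_, ?_⟩⟩
    · rw [Multiset.nodup_add, Multiset.nodup_add] at hnd
      exact hnd.1.2.1
    · intro v hv
      obtain ⟨m₁, m₂, -, h₁, -⟩ := hx v hv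
      exact h₁.last.deg (Multiset.nodup_add.1 hnd).2.1
    · rintro v hv
      obtain rfl : p = v := by simpa using hv
      refine or_iff_not_imp_left.2 fun hpr => exists_mem_of_dg (f := G.ends) ?_
      have := hc p hpr
      rw [cnt_mk] at this
      simp at this
      omega
    · intro v hv
      obtain rfl : q = v := by rw [hlast] at hv; simpa using hv
      refine or_iff_not_imp_left.2 fun hpr => exists_mem_of_dg (f := G.ends) ?_
      have := hc q hpr
      rw [cnt_mk] at this
      simp at this
      omega
  · refine ⟨[es], by simp, valid_singleton.2 fun hnd => .inr ⟨p, (disj hnd).1, (disj hnd).2,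
      vs, es, ⟨hvs, ?_, by simpa using hm, hl⟩, rfl, fun u hu =>
        (hx u hu).deg (Multiset.nodup_add.1 hnd).2.1, Big.deg ?_ ?_⟩⟩
    · rw [Multiset.nodup_add, Multiset.nodup_add] at hnd
      exact hnd.1.2.1
    · refine or_iff_not_imp_left.2 fun hpr => ?_
      have := hc p hpr
      rw [cnt_mk] at this
      simpa using this
    · exact (Multiset.nodup_add.1 (Multiset.nodup_add.1 hnd).1).1
  · have hcard₂ := Multiset.card_pos.2 n₁
    have hcard₁ := Multiset.card_pos.2 n₂
    simp only [Multiset.card_add] at ih hcard₁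
    have hK : ∀ x, Big G.ends r K x → Big G.ends r (m₂ + K) x := fun x hx => hx.mono (by simp)
    obtain ⟨L₁, hL₁, hv₁⟩ := ih _ (by rw [Multiset.card_add]; omega)
      ((h₁.mono (fun _ _ => rfl) hK).trans (h₃.mono (fun _ _ => rfl) hK)) hc rfl
    obtain ⟨L₂, rfl, hv₂⟩ := ih (H := H + (m₁ + m₃)) _ (by omega) h₂ (fun u hu => by
      have := hc u hu
      have i₁ := h₁.symm.one_le
      have i₃ := h₃.one_le
      rw [cnt_mk] at this ⊢
      simp only [dg_add]
      by_cases hau : a = u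
      · subst hau
        rw [eq_comm] at i₁
        rw [eq_comm] at i₃
        split_ifs at this ⊢ <;> simp_all <;> omega
      · simp [hau]) rfl
    refine ⟨L₁ ++ L₂, ?_, valid_append.2 ⟨hv₁, by rwa [hL₁]⟩⟩
    rw [List.sum_append, hL₁]
    abel

theorem Arm.start {A B : V → Prop} {x : V} {m : Multiset E} (h : Arm f A B m x) :
    (m = 0 ∧ A x) ∨ ∃ a p e m', m = e ::ₘ m' ∧ A a ∧ f e = s(a, p) ∧ Tr f B p m' x := by
  induction h with
  | base ha => exact .inl ⟨rfl, ha⟩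
  | @step m x y e h he hy ih =>
    rcases ih with ⟨rfl, hx⟩ | ⟨a, p, e', m', rfl, ha, he', h'⟩
    · exact .inr ⟨x, y, e, 0, rfl, hx, he, .nil hy⟩
    · refine .inr ⟨a, p, e', m' + {e}, ?_, ha, he', h'.trans (.single h'.last hy he)⟩
      rw [Multiset.cons_swap, add_comm, Multiset.singleton_add]

theorem UpChain.chain {H c K : Multiset G.E} (h : UpChain r H c K) : Chain r H c K :=
  fun hnd => .inl (h hnd)

theorem UpChain.chain_swap {H c K : Multiset G.E} (h : UpChain r K c H) : Chain r H c K := by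
  refine fun hnd => .inr (.inl (h ?_))
  rwa [add_comm, add_comm K, ← add_assoc]

theorem chain_singleton {H K : Multiset G.E} {e : G.E} {u v : G.V} (he : G.ends e = s(u, v))
    (hu : Big G.ends r H u) (hv : Big G.ends r K v) : Chain r H {e} K := by
  intro hnd
  rw [Multiset.nodup_add, Multiset.nodup_add] at hnd
  refine .inr (.inr ⟨u, v, e, fun h => ?_, fun h => ?_, by simp, he, hu.deg hnd.1.1,
    hv.deg hnd.2.1⟩)
  · exact Multiset.disjoint_left.1 hnd.1.2.2 h (Multiset.mem_singleton_self e)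
  · exact Multiset.disjoint_left.1 hnd.2.2
      (Multiset.mem_add.2 (.inr (Multiset.mem_singleton_self e))) h

/-- A trail on vertices that are big in `K`, extended at both ends by an edge to a vertex that
is big in `H`, decomposes into chains. -/
theorem Tr.exists_chains {H K m : Multiset G.E} {a b p q : G.V} {e₁ e₂ : G.E}
    (h : Tr G.ends (Big G.ends r K) p m q) (h₁ : G.ends e₁ = s(a, p)) (h₂ : G.ends e₂ = s(b, q))
    (ha : Big G.ends r H a) (hb : Big G.ends r H b) :
    ∃ L : List (Multiset G.E), L.sum = e₁ ::ₘ e₂ ::ₘ m ∧ Valid (Chain r) H L K := by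
  classical
  obtain ⟨L, rfl, hL⟩ := h.exists_upChains (H := H + {e₁} + {e₂}) fun u _ => by
    simp only [dg_add, dg_singleton, h₁, h₂, cnt_mk]
    omega
  refine ⟨{e₁} :: {e₂} :: L, by simp [Multiset.cons_swap e₂], chain_singleton h₁ ha (h.start.mono ?_),
    chain_singleton h₂ (hb.mono ?_) (h.last.mono ?_), hL.imp UpChain.chain⟩ <;>
  · simp only [List.sum_cons, dg_add]
    omega

theorem UEar.exists_chains {H K c : Multiset G.E}
    (h : UEar G.ends (Big G.ends r H) (Big G.ends r K) c) :
    ∃ L : List (Multiset G.E), L.sum = c ∧ Valid (Chain r) H L K := by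
  obtain ⟨g, x, y, m₁, m₂, rfl, hg, h₁, h₂, hB⟩ := h
  rcases h₁.start with ⟨rfl, hx⟩ | ⟨a, p, e₁, m₁, rfl, ha, he₁, h₁⟩ <;>
  rcases h₂.start with ⟨rfl, hy⟩ | ⟨b, q, e₂, m₂, rfl, hb, he₂, h₂⟩
  · refine ⟨[{g}], by simp, valid_singleton.2 ?_⟩
    rcases hB with hB | hB
    · exact chain_singleton (hg.trans Sym2.eq_swap) hy hB
    · exact chain_singleton hg hx hB
  · rw [zero_add]
    exact h₂.symm.exists_chains hg he₂ hx hb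
  · rw [add_zero]
    exact h₁.symm.exists_chains (hg.trans Sym2.eq_swap) he₁ hy ha
  · obtain ⟨L, hL, hv⟩ := (h₁.trans (.cons h₁.last hg h₂.symm)).exists_chains he₁ he₂ ha hb
    refine ⟨L, hL.trans ?_, hv⟩
    simp only [← Multiset.singleton_add]
    abel

theorem Ear.exists_chains {H K c : Multiset G.E} (h : Ear G.ends r H c K) :
    ∃ L : List (Multiset G.E), L.sum = c ∧ Valid (Chain r) H L K := by
  rcases h with rfl | h | ⟨a, b, h, hc⟩
  · exact ⟨[], rfl, trivial⟩
  · exact h.exists_chains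
  · obtain ⟨L, rfl, hL⟩ := h.exists_upChains hc
    exact ⟨L.reverse, L.sum_reverse, hL.reverse UpChain.chain_swap⟩

theorem Valid.exists_chains {H K : Multiset G.E} {cs : List (Multiset G.E)}
    (h : Valid (Ear G.ends r) H cs K) :
    ∃ L : List (Multiset G.E), L.sum = cs.sum ∧ Valid (Chain r) H L K := by
  induction cs generalizing H with
  | nil => exact ⟨[], rfl, trivial⟩
  | cons c cs ih =>
    obtain ⟨L₁, rfl, h₁⟩ := h.1.exists_chains
    obtain ⟨L₂, hL, h₂⟩ := ih h.2
    exact ⟨L₁ ++ L₂, by simp [hL], valid_append.2 ⟨by rwa [hL], h₂⟩⟩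

theorem mem_list_sum {L : List (Multiset E)} {e : E} : e ∈ L.sum ↔ ∃ c ∈ L, e ∈ c := by
  induction L with
  | nil => simp
  | cons c L ih => simp [ih]

theorem hasChainDecomp_of_valid {L : List (Multiset G.E)} (hL : ∀ e, e ∈ L.sum)
    (hnd : L.sum.Nodup) (hne : L ≠ []) (h : Valid (Chain r) 0 L 0) : G.HasChainDecomp r := by
  obtain ⟨c, cs, rfl⟩ := List.exists_cons_of_ne_nil hne
  set L := c :: cs
  have split : ∀ i : Fin L.length, L = L.take i ++ L[i] :: L.drop (i + 1) := fun i => by simp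
  have hnd' : ∀ i : Fin L.length, ((L.take i).sum + L[i] + (L.drop (i + 1)).sum).Nodup := by
    intro i
    rw [split i, List.sum_append, List.sum_cons, ← add_assoc] at hnd
    exact hnd
  have hbefore : ∀ i : Fin L.length,
      G.before (fun j : Fin L.length => {e | e ∈ L[j]}) i = {e | e ∈ (L.take i).sum} := by
    intro i
    ext e
    simp only [MG.before, Set.mem_ofPred_eq, mem_list_sum, List.mem_take_iff_getElem]
    constructor
    · rintro ⟨j, hj, he⟩
      exact ⟨_, ⟨j, by omega, rfl⟩, he⟩
    · rintro ⟨_, ⟨j, hj, rfl⟩, he⟩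
      exact ⟨⟨j, by omega⟩, Fin.lt_def.2 (by simp; omega), he⟩
  have hafter : ∀ i : Fin L.length,
      G.after (fun j : Fin L.length => {e | e ∈ L[j]}) i = {e | e ∈ (L.drop (i + 1)).sum} := by
    intro i
    ext e
    simp only [MG.after, Set.mem_ofPred_eq, mem_list_sum, List.mem_drop_iff_getElem]
    constructor
    · rintro ⟨j, hj, he⟩
      refine ⟨_, ⟨j - (i + 1), by omega, rfl⟩, ?_⟩
      have : (i : ℕ) + 1 + (j - (i + 1)) = j := by omega
      simpa [this] using he
    · rintro ⟨_, ⟨j, hj, rfl⟩, he⟩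
      exact ⟨⟨i + 1 + j, by omega⟩, Fin.lt_def.2 (by simp; omega), by simpa [add_comm] using he⟩
  have hdisj : ∀ i j : Fin L.length, i < j → Disjoint {e | e ∈ L[i]} {e | e ∈ L[j]} := by
    intro i j hij
    refine Set.disjoint_left.2 fun e he he' => ?_
    have h' : e ∈ G.after (fun j : Fin L.length => {e | e ∈ L[j]}) i := ⟨j, hij, he'⟩
    rw [hafter] at h'
    exact Multiset.disjoint_left.1 (Multiset.nodup_add.1 (hnd' i)).2.2
      (Multiset.mem_add.2 (.inr he)) h'
  refine ⟨cs.length, fun i : Fin L.length => {e | e ∈ L[i]}, fun i j hij => ?_, ?_, fun i => ?_⟩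
  · rcases lt_or_gt_of_ne hij with h | h
    · exact hdisj i j h
    · exact (hdisj j i h).symm
  · refine Set.eq_univ_of_forall fun e => ?_
    obtain ⟨c, hc, he⟩ := mem_list_sum.1 (hL e)
    obtain ⟨i, hi, rfl⟩ := List.mem_iff_getElem.1 hc
    exact Set.mem_iUnion.2 ⟨⟨i, hi⟩, he⟩
  · rw [hbefore, hafter]
    rw [split i, valid_append] at h
    have := h.2.1
    rw [zero_add, add_zero] at this
    exact this (hnd' i)

theorem cutCond_univ [Fintype G.E] (h4 : G.FourEdgeConnected) :
    CutCond G.ends Finset.univ.val Set.univ := by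
  classical
  rintro X ⟨a, -, ha⟩ ⟨b, -, hb⟩
  by_contra! hlt
  set S : Finset G.E := {e | cr (G.ends e) X ≠ 0}
  have hS : S.card ≤ dc G.ends Finset.univ.val X := by
    rw [Finset.card_filter]
    refine Finset.sum_le_sum fun e _ => ?_
    split_ifs <;> omega
  have hreach := h4.2 S S.finite_toSet (by rw [Set.ncard_coe_finset]; omega) a b
  refine hb ?_
  clear hb
  induction hreach with
  | refl => exact ha
  | tail _ he ih =>
    obtain ⟨e, heS, he⟩ := he
    by_contra hc
    refine heS ?_
    simp [S, he, cr_mk, ih, hc]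

end ChainDecomp

theorem exists_chain_decomposition (G : MG) [Finite G.V] [Finite G.E]
    (h4 : G.FourEdgeConnected) (r : G.V) : G.HasChainDecomp r := by
  have := Fintype.ofFinite G.E
  have hcut := ChainDecomp.cutCond_univ h4
  obtain ⟨cs, hcs, hv⟩ := hcut.exists_valid Finset.univ.nodup (Set.mem_univ r)
    fun _ _ a _ => Set.mem_univ a
  obtain ⟨L, hL, hv⟩ := hv.exists_chains
  rw [hcs] at hL
  refine ChainDecomp.hasChainDecomp_of_valid (by simp [hL]) (by simp [hL, Finset.nodup]) ?_ hv
  rintro rfl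
  have : Nontrivial G.V := Finite.one_lt_card_iff_nontrivial.1 h4.1
  obtain ⟨s, hs⟩ := exists_ne r
  have h := hcut {r} ⟨r, Set.mem_univ r, rfl⟩ ⟨s, Set.mem_univ s, hs⟩
  rw [← hL] at h
  simp at h
end

section
/- Suppose G is a multigraph with no isolated vertices. If G has a chain decomposition rooted at some vertex r of G, then there exists a set of four edge-independent spanning trees of G rooted at r. -/
set_option autoImplicit false

namespace MG

variable {G : MG}

/-! ### Degrees and walks -/

theorem deg_mono [Finite G.E] {F F' : Set G.E} (h : F ⊆ F') (v : G.V) :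
    G.deg F v ≤ G.deg F' v :=
  Nat.add_le_add
    (Set.ncard_le_ncard (fun _ he => ⟨h he.1, he.2⟩) (Set.toFinite _))
    (Set.ncard_le_ncard (fun _ he => ⟨h he.1, he.2⟩) (Set.toFinite _))

theorem deg_le_one [Finite G.E] {F : Set G.E} {v : G.V}
    (hl : ∀ e ∈ F, G.ends e ≠ s(v, v))
    (hu : ∀ e ∈ F, v ∈ G.ends e → ∀ e' ∈ F, v ∈ G.ends e' → e' = e) :
    G.deg F v ≤ 1 := by
  have h₁ : {e ∈ F | v ∈ G.ends e}.ncard ≤ 1 := by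
    rw [Set.ncard_le_one (Set.toFinite _)]
    exact fun a ha b hb => hu b hb.1 hb.2 a ha.1 ha.2
  have h₂ : {e ∈ F | G.ends e = s(v, v)} = ∅ := by
    ext e
    simp only [Set.mem_ofPred_eq, Set.mem_empty_iff_false, iff_false]
    exact fun h => hl e h.1 h.2
  rw [deg, h₂, Set.ncard_empty]
  exact h₁

theorem IsLink.length_eq {vs : List G.V} {es : List G.E} (h : G.IsLink vs es) :
    vs.length = es.length + 1 := by
  induction es generalizing vs with
  | nil =>
    match vs, h with
    | [_], _ => rfl
  | cons e es ih =>
    match vs, h with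
    | a :: b :: vs, h => simpa using ih h.2

theorem IsLink.ends_getElem {vs : List G.V} {es : List G.E} (h : G.IsLink vs es)
    {i : ℕ} (hi : i < es.length) (h₁ : i < vs.length) (h₂ : i + 1 < vs.length) :
    G.ends es[i] = s(vs[i], vs[i + 1]) := by
  induction es generalizing vs i with
  | nil => simp at hi
  | cons e es ih =>
    match vs, h with
    | a :: b :: vs, h =>
      cases i with
      | zero => exact h.1
      | succ i => exact ih h.2 (by simpa using hi) (by simpa using h₁) (by simpa using h₂)

/-! ### Spanning trees from parent maps -/

/-- The spanning subgraph whose edges are the edges `pe v` for `v ≠ r`. -/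
def parentSub (r : G.V) (pe : G.V → G.E) : Sub G where
  verts := Set.univ
  edges := {e | ∃ v, v ≠ r ∧ e = pe v}
  valid := fun _ _ _ _ => Set.mem_univ _

section Parent

variable {r : G.V} {pe : G.V → G.E} {p : G.V → G.V} {ρ : G.V → ℝ}

theorem parentSub_connected [Finite G.V] (hends : ∀ v, v ≠ r → G.ends (pe v) = s(v, p v))
    (hρ : ∀ v, v ≠ r → ρ (p v) < ρ v) : (parentSub r pe).Connected := by
  refine ⟨⟨r, trivial⟩, ?_⟩
  have hwf : WellFounded (fun a b : G.V => ρ a < ρ b) :=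
    have : IsTrans G.V (fun a b => ρ a < ρ b) := ⟨fun _ _ _ => lt_trans⟩
    have : Std.Irrefl (fun a b : G.V => ρ a < ρ b) := ⟨fun _ => lt_irrefl _⟩
    Finite.wellFounded_of_trans_of_irrefl _
  have key : ∀ a, Relation.ReflTransGen
      (fun x y => ∃ e ∈ (parentSub r pe).edges, G.ends e = s(x, y)) a r := by
    intro a
    induction a using hwf.induction with
    | _ a ih =>
      by_cases har : a = r
      · rw [har]
      · exact (ih (p a) (hρ a har)).head ⟨pe a, ⟨a, har, rfl⟩, hends a har⟩
  intro a _ b _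
  refine (key a).trans ?_
  have hsymm : Std.Symm
      (fun x y => ∃ e ∈ (parentSub r pe).edges, G.ends e = s(x, y)) :=
    ⟨fun x y ⟨e, he, h⟩ => ⟨e, he, h.trans Sym2.eq_swap⟩⟩
  exact Relation.ReflTransGen.stdSymm.symm _ _ (key b)

/-- A parent edge with an end of maximal rank is the parent edge of that end. -/
theorem eq_parent_of_le (hends : ∀ v, v ≠ r → G.ends (pe v) = s(v, p v))
    (hρ : ∀ v, v ≠ r → ρ (p v) < ρ v) {e : G.E} (he : e ∈ (parentSub r pe).edges)
    {a b : G.V} (hab : G.ends e = s(a, b)) (hle : ρ b ≤ ρ a) : e = pe a ∧ a ≠ b := by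
  obtain ⟨v, hv, rfl⟩ := he
  have h₁ := hρ v hv
  rw [hends v hv, Sym2.eq_iff] at hab
  rcases hab with ⟨rfl, rfl⟩ | ⟨rfl, rfl⟩
  · exact ⟨rfl, fun h => h₁.ne (congrArg ρ h.symm)⟩
  · exact absurd h₁ hle.not_gt

theorem parentSub_isTree [Finite G.V] (hends : ∀ v, v ≠ r → G.ends (pe v) = s(v, p v))
    (hρ : ∀ v, v ≠ r → ρ (p v) < ρ v) : (parentSub r pe).IsTree := by
  classical
  refine ⟨parentSub_connected hends hρ, ?_⟩
  rintro ⟨v, vs, es, ⟨-, hes, hne, hlink⟩, hsub⟩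
  have hlen : vs.length + 1 = es.length := by
    have := hlink.length_eq
    simp at this
    omega
  obtain ⟨u, hu, hmax⟩ := (v :: (vs ++ [v])).toFinset.exists_max_image ρ ⟨v, by simp⟩
  have hmax' : ∀ i (hi : i < (v :: (vs ++ [v])).length), ρ (v :: (vs ++ [v]))[i] ≤ ρ u :=
    fun i hi => hmax _ (List.mem_toFinset.2 (List.getElem_mem hi))
  -- the two cycle edges at a vertex of maximal rank coincide
  have key : ∀ i j (hi : i < es.length) (hj : j < es.length),
      (v :: (vs ++ [v]))[i]'(by simp; omega) = u →
      (v :: (vs ++ [v]))[j + 1]'(by simp; omega) = u → i = j ∧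
        (v :: (vs ++ [v]))[i]'(by simp; omega) ≠
          (v :: (vs ++ [v]))[i + 1]'(by simp; omega) := by
    intro i j hi hj h₁ h₂
    have e₁ := hlink.ends_getElem hi (by simp; omega) (by simp; omega)
    have e₂ := hlink.ends_getElem hj (by simp; omega) (by simp; omega)
    have q₁ := eq_parent_of_le hends hρ (hsub _ (List.getElem_mem hi)) e₁
      (by rw [h₁]; exact hmax' _ _)
    have q₂ := eq_parent_of_le hends hρ (hsub _ (List.getElem_mem hj))
      (e₂.trans Sym2.eq_swap) (by rw [h₂]; exact hmax' _ _)
    have : i = j := (hes.getElem_inj_iff).1 (by rw [q₁.1, q₂.1, h₁, h₂])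
    exact ⟨this, q₁.2⟩
  have hu' : u ∈ v :: vs := by simpa using hu
  obtain ⟨i, hi, hiu⟩ := List.getElem_of_mem hu'
  have hi' : i < es.length := by simpa [← hlen] using hi
  have hiu' : (v :: (vs ++ [v]))[i]'(by simp; omega) = u := by
    rw [← hiu]
    have : v :: (vs ++ [v]) = (v :: vs) ++ [v] := rfl
    simp only [this]
    exact List.getElem_append_left hi
  rcases Nat.eq_zero_or_pos i with rfl | hpos
  · have hv : v = u := by simpa using hiu
    have hlast : (v :: (vs ++ [v]))[es.length - 1 + 1]'(by simp; omega) = u := by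
      simp only [← hlen]
      simp [hv]
    obtain ⟨h₀, h₁⟩ := key 0 (es.length - 1) hi' (by omega) hiu' hlast
    apply h₁
    rw [hiu']
    simp only [← h₀] at hlast
    exact hlast.symm
  · obtain ⟨j, rfl⟩ : ∃ j, i = j + 1 := ⟨i - 1, by omega⟩
    have := (key (j + 1) j hi' (by omega) hiu' hiu').1
    omega

theorem parentSub_walk (hends : ∀ v, v ≠ r → G.ends (pe v) = s(v, p v))
    {P : G.V → Set G.E} (hP : ∀ v, v ≠ r → pe v ∈ P v)
    (hPP : ∀ v, v ≠ r → P (p v) ⊆ P v) {v : G.V} (es : List G.E) :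
    ∀ (a : G.V) (vs : List G.V), G.IsLink (a :: vs) es → es.Nodup →
      (∀ e ∈ es, e ∈ (parentSub r pe).edges) → (a = r ∨ pe a ∉ es) →
      (a :: vs).getLast? = some v → (∀ e ∈ es, e ∈ P v) ∧ P a ⊆ P v := by
  induction es with
  | nil =>
    intro a vs hl _ _ _ hlast
    match vs, hl with
    | [], _ =>
      simp only [List.getLast?_singleton, Option.some.injEq] at hlast
      subst hlast
      simp
  | cons e es ih =>
    intro a vs hl hnd hsub ha hlast
    match vs, hl with
    | b :: vs, hl =>
      obtain ⟨x, hx, rfl⟩ := hsub e (by simp)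
      have hab := hl.1
      rw [hends x hx, Sym2.eq_iff] at hab
      have hnd' := List.nodup_cons.1 hnd
      rcases hab with ⟨rfl, -⟩ | ⟨rfl, rfl⟩
      · rcases ha with ha | ha
        · exact absurd ha hx
        · exact absurd (List.mem_cons_self) ha
      · obtain ⟨h₁, h₂⟩ := ih x vs hl.2 hnd'.2 (fun e he => hsub e (by simp [he]))
          (Or.inr hnd'.1) (by simpa [List.getLast?_cons_cons] using hlast)
        refine ⟨fun e he => ?_, (hPP x hx).trans h₂⟩
        rcases List.mem_cons.1 he with rfl | he
        · exact h₂ (hP x hx)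
        · exact h₁ e he

theorem parentSub_path (hends : ∀ v, v ≠ r → G.ends (pe v) = s(v, p v))
    {P : G.V → Set G.E} (hP : ∀ v, v ≠ r → pe v ∈ P v)
    (hPP : ∀ v, v ≠ r → P (p v) ⊆ P v) {v : G.V} {vs : List G.V} {es : List G.E}
    (h : (parentSub r pe).PathIn r v vs es) : ∀ e ∈ es, e ∈ P v := by
  obtain ⟨⟨-, hnd, hl⟩, hhead, hlast, hsub⟩ := h
  cases vs with
  | nil => simp at hhead
  | cons a vs =>
    obtain rfl : a = r := by simpa using hhead
    exact (parentSub_walk hends hP hPP es a vs hl hnd hsub (Or.inl rfl) hlast).1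

end Parent

/-! ### Partial numberings -/

/-- A partial numbering of the edge set `H`, whose edges have level at most `c`. The vertices
in `D` carry an interval `(lo v, hi v)` and, apart from the root, an edge numbered `lo v`
leading to a vertex with smaller `lo` and an edge numbered `hi v` leading to a vertex with
larger `hi`. A vertex outside `D` meets at most one edge of `H`. -/
structure Numbering (r : G.V) (κ : G.E → ℕ) (Q : ℕ → G.V → Prop) (c : ℕ) (H : Set G.E)
    (D : Set G.V) (f : G.E → ℝ) (lo hi : G.V → ℝ) (t : G.V → ℕ) : Prop where
  root_mem : r ∈ D
  lo_lt_hi : ∀ v ∈ D, lo v < hi v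
  lo_exit : ∀ v ∈ D, v ≠ r → ∃ e ∈ H, ∃ w ∈ D,
    G.ends e = s(v, w) ∧ f e = lo v ∧ lo w < lo v ∧ κ e ≤ t v ∧ t w ≤ t v
  hi_exit : ∀ v ∈ D, v ≠ r → ∃ e ∈ H, ∃ w ∈ D,
    G.ends e = s(v, w) ∧ f e = hi v ∧ hi v < hi w ∧ κ e ≤ t v ∧ t w ≤ t v
  inj : Set.InjOn f H
  pending : ∀ v ∉ D, ∀ e ∈ H, v ∈ G.ends e →
    (∃ w ∈ D, G.ends e = s(v, w) ∧ lo w < f e ∧ f e < hi w) ∧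
      ∀ e' ∈ H, v ∈ G.ends e' → e' = e
  level_le : ∀ e ∈ H, κ e ≤ c
  time_le : ∀ v ∈ D, t v ≤ c
  time_spec : ∀ v ∈ D, v ≠ r → Q (t v) v

/-- The edge set `H` has a partial numbering with set `D` of completed vertices. -/
def Numbered (r : G.V) (κ : G.E → ℕ) (Q : ℕ → G.V → Prop) (c : ℕ) (H : Set G.E)
    (D : Set G.V) : Prop :=
  ∃ f lo hi t, Numbering r κ Q c H D f lo hi t

theorem exists_strictMono_avoiding {A B : ℝ} (hAB : A < B) {S : Set ℝ} (hS : S.Finite) :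
    ∃ g : ℕ → ℝ, StrictMono g ∧ ∀ i, A < g i ∧ g i < B ∧ g i ∉ S := by
  have h₁ : (S \ {A})ᶜ ∈ nhds A :=
    (hS.subset Set.sdiff_subset).isClosed.isOpen_compl.mem_nhds (by simp)
  obtain ⟨d, hd, hdS⟩ := mem_nhdsGT_iff_exists_Ioo_subset.1 (mem_nhdsWithin_of_mem_nhds h₁)
  obtain ⟨g, hg, hgm, -⟩ := exists_seq_strictMono_tendsto' (lt_min hd hAB)
  refine ⟨g, hg, fun i => ⟨(hgm i).1, (hgm i).2.trans_le (min_le_right _ _), fun hi => ?_⟩⟩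
  exact hdS ⟨(hgm i).1, (hgm i).2.trans_le (min_le_left _ _)⟩ ⟨hi, (hgm i).1.ne'⟩

theorem exists_between_avoiding {A B : ℝ} (hAB : A < B) {S : Set ℝ} (hS : S.Finite) :
    ∃ y, A < y ∧ y < B ∧ y ∉ S :=
  let ⟨g, _, hg⟩ := exists_strictMono_avoiding hAB hS
  ⟨g 0, hg 0⟩

section Numbering

variable {r : G.V} {κ : G.E → ℕ} {Q : ℕ → G.V → Prop} {c : ℕ} {H : Set G.E} {D : Set G.V}

theorem Numbered.root_mem (h : Numbered r κ Q c H D) : r ∈ D :=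
  let ⟨_, _, _, _, hN⟩ := h
  hN.root_mem

theorem Numbered.mono_level (h : Numbered r κ Q c H D) {c' : ℕ} (hc : c ≤ c') :
    Numbered r κ Q c' H D := by
  obtain ⟨f, lo, hi, t, hN⟩ := h
  exact ⟨f, lo, hi, t, { hN with
    level_le := fun e he => (hN.level_le e he).trans hc
    time_le := fun v hv => (hN.time_le v hv).trans hc }⟩

theorem Numbered.deg_le_one [Finite G.E] (h : Numbered r κ Q c H D) {v : G.V} (hv : v ∉ D) :
    G.deg H v ≤ 1 := by
  obtain ⟨f, lo, hi, t, hN⟩ := h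
  refine MG.deg_le_one (fun e he hl => ?_) (fun e he hve => (hN.pending v hv e he hve).2)
  obtain ⟨⟨w, hw, hvw, -⟩, -⟩ := hN.pending v hv e he (by simp [hl])
  rw [hl, Sym2.eq_iff] at hvw
  rcases hvw with ⟨-, h⟩ | ⟨h, -⟩ <;> exact hv (h ▸ hw)

/-- Adding one edge from a completed vertex to a completed or new vertex. -/
theorem Numbered.insert_edge [Finite G.E] (h : Numbered r κ Q c H D) {e : G.E} (he : e ∉ H)
    (hκ : κ e ≤ c) {a b : G.V} (hab : G.ends e = s(a, b)) (ha : a ∈ D)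
    (hb : b ∈ D ∨ b ∉ G.vertsOf H) : Numbered r κ Q c (insert e H) D := by
  classical
  obtain ⟨f, lo, hi, t, hN⟩ := h
  obtain ⟨y, hy₁, hy₂, hyS⟩ := exists_between_avoiding (hN.lo_lt_hi a ha)
    ((Set.toFinite H).image f)
  have hf : ∀ e' ∈ H, Function.update f e y e' = f e' := fun e' he' =>
    Function.update_of_ne (fun h : e' = e => he (h ▸ he')) _ _
  have hfe : Function.update f e y e = y := Function.update_self _ _ _
  refine ⟨Function.update f e y, lo, hi, t, hN.root_mem, hN.lo_lt_hi, ?_, ?_, ?_, ?_, ?_,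
    hN.time_le, hN.time_spec⟩
  · intro v hv hvr
    obtain ⟨e', he', w, hw, h₁, h₂, h₃⟩ := hN.lo_exit v hv hvr
    exact ⟨e', Or.inr he', w, hw, h₁, (hf e' he').trans h₂, h₃⟩
  · intro v hv hvr
    obtain ⟨e', he', w, hw, h₁, h₂, h₃⟩ := hN.hi_exit v hv hvr
    exact ⟨e', Or.inr he', w, hw, h₁, (hf e' he').trans h₂, h₃⟩
  · rw [Set.injOn_insert he, hfe]
    refine ⟨fun x hx z hz hxz => hN.inj hx hz (by rwa [hf x hx, hf z hz] at hxz), ?_⟩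
    rintro ⟨x, hx, hxy⟩
    exact hyS ⟨x, hx, by rwa [hf x hx] at hxy⟩
  · intro v hv e' he' hve'
    have hvb : v ∈ G.ends e → v = b := by
      rw [hab, Sym2.mem_iff]
      rintro (rfl | rfl)
      · exact absurd ha hv
      · rfl
    rcases he' with rfl | he'
    · obtain rfl := hvb hve'
      refine ⟨⟨a, ha, hab.trans Sym2.eq_swap, by rwa [hfe], by rwa [hfe]⟩, ?_⟩
      rintro e'' (rfl | he'') hve''
      · rfl
      · rcases hb with hb | hb
        · exact absurd hb hv
        · exact absurd ⟨e'', he'', hve''⟩ hb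
    · obtain ⟨⟨w, hw, hvw, h₁, h₂⟩, hu⟩ := hN.pending v hv e' he' hve'
      refine ⟨⟨w, hw, hvw, by rwa [hf e' he'], by rwa [hf e' he']⟩, ?_⟩
      rintro e'' (rfl | he'') hve''
      · obtain rfl := hvb hve''
        rcases hb with hb | hb
        · exact absurd hb hv
        · exact absurd ⟨e', he', hve'⟩ hb
      · exact hu e'' he'' hve''
  · rintro e' (rfl | he')
    · exact hκ
    · exact hN.level_le e' he'

theorem Numbered.union_of_ends_mem [Finite G.E] (h : Numbered r κ Q c H D) {C : Set G.E}
    (hCH : Disjoint C H) (hκ : ∀ e ∈ C, κ e ≤ c) (hC : ∀ v ∈ G.vertsOf C, v ∈ D) :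
    Numbered r κ Q c (H ∪ C) D := by
  induction C, Set.toFinite C using Set.Finite.induction_on with
  | empty => simpa using h
  | @insert e S heS _ ih =>
    have hS := ih (hCH.mono_left (Set.subset_insert _ _)) (fun e he => hκ e (Or.inr he))
      (fun v ⟨e, he, hv⟩ => hC v ⟨e, Or.inr he, hv⟩)
    rw [Set.union_insert]
    obtain ⟨⟨a, b⟩, hab⟩ := Sym2.mk_surjective (G.ends e)
    refine hS.insert_edge ?_ (hκ e (Or.inl rfl)) hab.symm
      (hC a ⟨e, Or.inl rfl, by rw [← hab]; exact Sym2.mem_mk_left a b⟩)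
      (Or.inl (hC b ⟨e, Or.inl rfl, by rw [← hab]; exact Sym2.mem_mk_right a b⟩))
    rintro (h' | h')
    · exact Set.disjoint_left.1 hCH (Or.inl rfl) h'
    · exact heS h'

/-- `x 0, …, x k` is a walk along the edges `ee 0, …, ee (k - 1)`, which is simple except that
its two ends may coincide, and whose edges are not in `H`. -/
structure IsEar (H : Set G.E) (k : ℕ) (x : ℕ → G.V) (ee : ℕ → G.E) : Prop where
  ends : ∀ i < k, G.ends (ee i) = s(x i, x (i + 1))
  edge_inj : ∀ i < k, ∀ j < k, ee i = ee j → i = j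
  inner_inj : ∀ i j, 0 < i → i < k → j ≤ k → x i = x j → i = j
  notMem : ∀ i < k, ee i ∉ H

theorem IsEar.reverse {k : ℕ} {x : ℕ → G.V} {ee : ℕ → G.E} (h : IsEar H k x ee) :
    IsEar H k (fun i => x (k - i)) (fun i => ee (k - 1 - i)) where
  ends i hi := by
    have := h.ends (k - 1 - i) (by omega)
    rw [show k - 1 - i + 1 = k - i by omega] at this
    rw [this, Sym2.eq_swap, show k - (i + 1) = k - 1 - i by omega]
  edge_inj i hi j hj hij := by
    have := h.edge_inj _ (by omega) _ (by omega) hij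
    omega
  inner_inj i j hi hik hj hij := by
    have := h.inner_inj _ _ (by omega) (by omega) (by omega) hij
    omega
  notMem i hi := h.notMem _ (by omega)

/-- The value `A` is available as the lower number of `v`. -/
def LoAvail (H : Set G.E) (D : Set G.V) (f : G.E → ℝ) (lo : G.V → ℝ) (v : G.V) (A : ℝ) : Prop :=
  (v ∈ D ∧ lo v = A) ∨
    (v ∉ D ∧ ∃ e ∈ H, ∃ w ∈ D, G.ends e = s(v, w) ∧ f e = A ∧ lo w < A)

/-- The value `B` is available as the upper number of `v`. -/
def HiAvail (H : Set G.E) (D : Set G.V) (f : G.E → ℝ) (hi : G.V → ℝ) (v : G.V) (B : ℝ) : Prop :=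
  (v ∈ D ∧ hi v = B) ∨
    (v ∉ D ∧ ∃ e ∈ H, ∃ w ∈ D, G.ends e = s(v, w) ∧ f e = B ∧ B < hi w)

/-- Numbering an ear increasingly from its first to its last edge. -/
theorem Numbering.add_increasing_ear [Finite G.E] {f : G.E → ℝ} {lo hi : G.V → ℝ}
    {t : G.V → ℕ} (hN : Numbering r κ Q c H D f lo hi t) {k : ℕ} (hk : 0 < k)
    {x : ℕ → G.V} {ee : ℕ → G.E} (hE : IsEar H k x ee) (hκ : ∀ i < k, κ (ee i) ≤ c)
    (hQ : ∀ i ≤ k, x i ∈ D ∨ Q c (x i)) (hclosed : x 0 = x k → x 0 ∈ D)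
    (hinner : ∀ i, 0 < i → i < k → x i ∉ D)
    {A B : ℝ} (hAB : A < B) (hA : LoAvail H D f lo (x 0) A) (hB : HiAvail H D f hi (x k) B) :
    Numbered r κ Q c (H ∪ {e | ∃ i < k, ee i = e}) (D ∪ {v | ∃ i ≤ k, x i = v}) := by
  classical
  obtain ⟨g, hg, hgm⟩ := exists_strictMono_avoiding hAB ((Set.toFinite H).image f)
  have hxinj : ∀ i j, i ≤ k → j ≤ k → x i ∉ D → x i = x j → i = j := by
    intro i j hi hj hiD hij
    by_cases h₁ : 0 < i ∧ i < k
    · exact hE.inner_inj i j h₁.1 h₁.2 hj hij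
    by_cases h₂ : 0 < j ∧ j < k
    · exact (hE.inner_inj j i h₂.1 h₂.2 hi hij.symm).symm
    by_contra hne
    rcases Nat.eq_zero_or_pos i with rfl | hi0
    · obtain rfl : j = k := by omega
      exact hiD (hclosed hij)
    · obtain rfl : i = k := by omega
      obtain rfl : j = 0 := by omega
      exact hiD (hij ▸ hclosed hij.symm)
  obtain ⟨f', hf'e, hf'H⟩ : ∃ f' : G.E → ℝ, (∀ i < k, f' (ee i) = g i) ∧
      ∀ e ∈ H, f' e = f e := by
    refine ⟨fun e => if h : ∃ i < k, ee i = e then g h.choose else f e, fun i hi => ?_,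
      fun e he => dif_neg ?_⟩
    · have h : ∃ j < k, ee j = ee i := ⟨i, hi, rfl⟩
      simp only [dif_pos h]
      rw [hE.edge_inj _ h.choose_spec.1 _ hi h.choose_spec.2]
    · rintro ⟨i, hi, rfl⟩
      exact hE.notMem i hi he
  have extend : ∀ (l : G.V → ℝ) (m : ℕ → ℝ), ∃ l' : G.V → ℝ, (∀ v ∈ D, l' v = l v) ∧
      ∀ i ≤ k, x i ∉ D → l' (x i) = m i := by
    intro l m
    refine ⟨fun v => if v ∈ D then l v else if h : ∃ i ≤ k, x i = v then m h.choose else 0,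
      fun v hv => if_pos hv, fun i hi hiD => ?_⟩
    have h : ∃ j ≤ k, x j = x i := ⟨i, hi, rfl⟩
    simp only [if_neg hiD, dif_pos h]
    exact congrArg m (hxinj i h.choose hi h.choose_spec.1 hiD h.choose_spec.2.symm).symm
  obtain ⟨lo', hloD, hlox⟩ := extend lo (fun i => if i = 0 then A else g (i - 1))
  obtain ⟨hi', hhiD, hhix⟩ := extend hi (fun i => if i = k then B else g i)
  have hlo_lt : ∀ i < k, lo' (x i) < g i := by
    intro i hi
    by_cases hD : x i ∈ D
    · obtain rfl : i = 0 := by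
        by_contra h0
        exact hinner i (by omega) hi hD
      rcases hA with hA | hA
      · rw [hloD _ hD, hA.2]
        exact (hgm 0).1
      · exact absurd hD hA.1
    · rw [hlox i hi.le hD]
      split_ifs with h0
      · exact (hgm i).1
      · exact hg (by omega)
  have hlt_hi : ∀ i < k, g i < hi' (x (i + 1)) := by
    intro i hi
    by_cases hD : x (i + 1) ∈ D
    · obtain rfl : i + 1 = k := by
        by_contra h0
        exact hinner (i + 1) (by omega) (by omega) hD
      rcases hB with hB | hB
      · rw [hhiD _ hD, hB.2]
        exact (hgm i).2.1
      · exact absurd hD hB.1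
    · rw [hhix (i + 1) hi hD]
      split_ifs with h0
      · exact (hgm i).2.1
      · exact hg (by omega)
  let t' : G.V → ℕ := fun v => if v ∈ D then t v else c
  have htD : ∀ v ∈ D, t' v = t v := fun v hv => if_pos hv
  have htn : ∀ v ∉ D, t' v = c := fun v hv => if_neg hv
  have htc : ∀ v, t' v ≤ c := fun v => by
    by_cases hv : v ∈ D
    · exact (htD v hv).trans_le (hN.time_le v hv)
    · exact (htn v hv).le
  refine ⟨f', lo', hi', t', Or.inl hN.root_mem, ?_, ?_, ?_, ?_, ?_, ?_, fun v _ => htc v, ?_⟩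
  · intro v hv
    by_cases hD : v ∈ D
    · rw [hloD v hD, hhiD v hD]
      exact hN.lo_lt_hi v hD
    obtain ⟨i, hi, rfl⟩ := hv.resolve_left hD
    rcases hi.lt_or_eq with hik | rfl
    · have := hlo_lt i hik
      rw [hhix i hi hD, if_neg hik.ne]
      exact this
    · rw [hhix i le_rfl hD, hlox i le_rfl hD, if_pos rfl, if_neg hk.ne']
      exact (hgm _).2.1
  · intro v hv hvr
    by_cases hD : v ∈ D
    · obtain ⟨e, he, w, hw, h₁, h₂, h₃, h₄, h₅⟩ := hN.lo_exit v hD hvr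
      refine ⟨e, Or.inl he, w, Or.inl hw, h₁, ?_, ?_, ?_, ?_⟩
      · rw [hf'H e he, h₂, hloD v hD]
      · rwa [hloD w hw, hloD v hD]
      · rwa [htD v hD]
      · rwa [htD v hD, htD w hw]
    obtain ⟨i, hi, rfl⟩ := hv.resolve_left hD
    rw [htn _ hD]
    rcases Nat.eq_zero_or_pos i with rfl | hi0
    · rcases hA with hA | ⟨-, e, he, w, hw, h₁, h₂, h₃⟩
      · exact absurd hA.1 hD
      · refine ⟨e, Or.inl he, w, Or.inl hw, h₁, ?_, ?_, hN.level_le e he, htc w⟩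
        · rw [hf'H e he, h₂, hlox 0 hi hD, if_pos rfl]
        · rwa [hloD w hw, hlox 0 hi hD, if_pos rfl]
    · obtain ⟨j, rfl⟩ : ∃ j, i = j + 1 := ⟨i - 1, by omega⟩
      refine ⟨ee j, Or.inr ⟨j, hi, rfl⟩, x j, Or.inr ⟨j, by omega, rfl⟩,
        (hE.ends j hi).trans Sym2.eq_swap, ?_, ?_, hκ j hi, htc _⟩
      · rw [hf'e j hi, hlox _ hi hD, if_neg (Nat.succ_ne_zero j), Nat.add_sub_cancel]
      · rw [hlox _ hi hD, if_neg (Nat.succ_ne_zero j), Nat.add_sub_cancel]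
        exact hlo_lt j hi
  · intro v hv hvr
    by_cases hD : v ∈ D
    · obtain ⟨e, he, w, hw, h₁, h₂, h₃, h₄, h₅⟩ := hN.hi_exit v hD hvr
      refine ⟨e, Or.inl he, w, Or.inl hw, h₁, ?_, ?_, ?_, ?_⟩
      · rw [hf'H e he, h₂, hhiD v hD]
      · rwa [hhiD w hw, hhiD v hD]
      · rwa [htD v hD]
      · rwa [htD v hD, htD w hw]
    obtain ⟨i, hi, rfl⟩ := hv.resolve_left hD
    rw [htn _ hD]
    rcases hi.lt_or_eq with hik | rfl
    · refine ⟨ee i, Or.inr ⟨i, hik, rfl⟩, x (i + 1), Or.inr ⟨i + 1, hik, rfl⟩,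
        hE.ends i hik, ?_, ?_, hκ i hik, htc _⟩
      · rw [hf'e i hik, hhix _ hi hD, if_neg hik.ne]
      · rw [hhix _ hi hD, if_neg hik.ne]
        exact hlt_hi i hik
    · rcases hB with hB | ⟨-, e, he, w, hw, h₁, h₂, h₃⟩
      · exact absurd hB.1 hD
      · refine ⟨e, Or.inl he, w, Or.inl hw, h₁, ?_, ?_, hN.level_le e he, htc w⟩
        · rw [hf'H e he, h₂, hhix i hi hD, if_pos rfl]
        · rwa [hhiD w hw, hhix i hi hD, if_pos rfl]
  · rintro e (he | ⟨i, hi, rfl⟩) e' (he' | ⟨j, hj, rfl⟩) hee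
    · rw [hf'H e he, hf'H e' he'] at hee
      exact hN.inj he he' hee
    · rw [hf'H e he, hf'e j hj] at hee
      exact absurd ⟨e, he, hee⟩ (hgm j).2.2
    · rw [hf'H e' he', hf'e i hi] at hee
      exact absurd ⟨e', he', hee.symm⟩ (hgm i).2.2
    · rw [hf'e i hi, hf'e j hj] at hee
      rw [hg.injective hee]
  · intro v hv
    have hvD : v ∉ D := fun h => hv (Or.inl h)
    have hnew : ∀ i < k, v ∉ G.ends (ee i) := by
      intro i hi hvi
      rw [hE.ends i hi, Sym2.mem_iff] at hvi
      rcases hvi with rfl | rfl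
      · exact hv (Or.inr ⟨i, hi.le, rfl⟩)
      · exact hv (Or.inr ⟨i + 1, hi, rfl⟩)
    rintro e (he | ⟨i, hi, rfl⟩) hve
    · obtain ⟨⟨w, hw, h₁, h₂, h₃⟩, hu⟩ := hN.pending v hvD e he hve
      refine ⟨⟨w, Or.inl hw, h₁, ?_, ?_⟩, ?_⟩
      · rwa [hf'H e he, hloD w hw]
      · rwa [hf'H e he, hhiD w hw]
      · rintro e' (he' | ⟨i, hi, rfl⟩) hve'
        · exact hu e' he' hve'
        · exact absurd hve' (hnew i hi)
    · exact absurd hve (hnew i hi)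
  · rintro e (he | ⟨i, hi, rfl⟩)
    · exact hN.level_le e he
    · exact hκ i hi
  · intro v hv hvr
    by_cases hD : v ∈ D
    · rw [htD v hD]
      exact hN.time_spec v hD hvr
    · obtain ⟨i, hi, rfl⟩ := hv.resolve_left hD
      rw [htn _ hD]
      exact (hQ i hi).resolve_left hD

theorem Numbering.exists_avail {f : G.E → ℝ} {lo hi : G.V → ℝ} {t : G.V → ℕ}
    (hN : Numbering r κ Q c H D f lo hi t) {v : G.V} (hv : v ∈ D ∨ v ∈ G.vertsOf H) :
    ∃ A B, LoAvail H D f lo v A ∧ HiAvail H D f hi v B ∧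
      (A < B ∨ v ∉ D ∧ A = B ∧ ∃ e ∈ H, ∃ w ∈ D, G.ends e = s(v, w) ∧ f e = A) := by
  by_cases hD : v ∈ D
  · exact ⟨lo v, hi v, Or.inl ⟨hD, rfl⟩, Or.inl ⟨hD, rfl⟩, Or.inl (hN.lo_lt_hi v hD)⟩
  · obtain ⟨e, he, hve⟩ := hv.resolve_left hD
    obtain ⟨⟨w, hw, h₁, h₂, h₃⟩, -⟩ := hN.pending v hD e he hve
    exact ⟨f e, f e, Or.inr ⟨hD, e, he, w, hw, h₁, rfl, h₂⟩,
      Or.inr ⟨hD, e, he, w, hw, h₁, rfl, h₃⟩, Or.inr ⟨hD, rfl, e, he, w, hw, h₁, rfl⟩⟩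

/-- Adding an ear none of whose inner vertices is completed. -/
theorem Numbered.add_minimal_ear [Finite G.E] (h : Numbered r κ Q c H D) {k : ℕ} (hk : 0 < k)
    {x : ℕ → G.V} {ee : ℕ → G.E} (hE : IsEar H k x ee) (hκ : ∀ i < k, κ (ee i) ≤ c)
    (hQ : ∀ i ≤ k, x i ∈ D ∨ Q c (x i)) (hclosed : x 0 = x k → x 0 ∈ D)
    (hinner : ∀ i, 0 < i → i < k → x i ∉ D)
    (h0 : x 0 ∈ D ∨ x 0 ∈ G.vertsOf H) (hl : x k ∈ D ∨ x k ∈ G.vertsOf H) :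
    Numbered r κ Q c (H ∪ {e | ∃ i < k, ee i = e}) (D ∪ {v | ∃ i ≤ k, x i = v}) := by
  obtain ⟨f, lo, hi, t, hN⟩ := h
  obtain ⟨A, B, hA, hB, hAB⟩ := hN.exists_avail h0
  obtain ⟨A', B', hA', hB', hAB'⟩ := hN.exists_avail hl
  have hle : A ≤ B := hAB.elim le_of_lt fun h => h.2.1.le
  have hle' : A' ≤ B' := hAB'.elim le_of_lt fun h => h.2.1.le
  rcases lt_or_ge A B' with h₁ | h₁
  · exact hN.add_increasing_ear hk hE hκ hQ hclosed hinner h₁ hA hB'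
  rcases lt_or_ge A' B with h₂ | h₂
  · have := hN.add_increasing_ear hk hE.reverse (fun i hi => hκ _ (by omega))
      (fun i hi => hQ _ (by omega))
      (fun h => by
        simp only [Nat.sub_zero, Nat.sub_self] at h ⊢
        rw [h]
        exact hclosed h.symm)
      (fun i hi hik => hinner _ (by omega) (by omega)) h₂
      (by simpa using hA') (by simpa using hB)
    convert this using 2
    · ext e
      constructor
      · rintro ⟨i, hi, rfl⟩
        exact ⟨k - 1 - i, by omega, congrArg ee (by omega)⟩
      · rintro ⟨i, hi, rfl⟩
        exact ⟨k - 1 - i, by omega, rfl⟩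
    · ext v
      constructor
      · rintro ⟨i, hi, rfl⟩
        exact ⟨k - i, by omega, congrArg x (by omega)⟩
      · rintro ⟨i, hi, rfl⟩
        exact ⟨k - i, by omega, rfl⟩
  · exfalso
    have e₁ : ¬ A < B := by linarith
    have e₂ : ¬ A' < B' := by linarith
    obtain ⟨hD, -, e, he, w, hw, hvw, hf⟩ := hAB.resolve_left e₁
    obtain ⟨hD', -, e', he', w', hw', hvw', hf'⟩ := hAB'.resolve_left e₂
    obtain rfl : e = e' := hN.inj he he' (by rw [hf, hf']; linarith)
    rw [hvw, Sym2.eq_iff] at hvw'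
    rcases hvw' with ⟨h, -⟩ | ⟨h, -⟩
    · exact hD (hclosed h)
    · exact hD (h ▸ hw')

theorem Numbered.add_ear [Finite G.E] {k : ℕ} : ∀ {H : Set G.E} {D : Set G.V}
    {x : ℕ → G.V} {ee : ℕ → G.E}, Numbered r κ Q c H D → 0 < k → IsEar H k x ee →
    (∀ i < k, κ (ee i) ≤ c) → (∀ i ≤ k, x i ∈ D ∨ Q c (x i)) → (x 0 = x k → x 0 ∈ D) →
    (x 0 ∈ D ∨ x 0 ∈ G.vertsOf H) → (x k ∈ D ∨ x k ∈ G.vertsOf H) →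
    ∃ D', D ⊆ D' ∧ Numbered r κ Q c (H ∪ {e | ∃ i < k, ee i = e}) D' := by
  induction k using Nat.strong_induction_on with
  | _ k ih =>
    intro H D x ee h hk hE hκ hQ hclosed h0 hl
    by_cases hin : ∃ j, 0 < j ∧ j < k ∧ x j ∈ D
    · obtain ⟨j, hj, hjk, hjD⟩ := hin
      obtain ⟨D₁, hD₁, h₁⟩ := ih j hjk h hj
        ⟨fun i hi => hE.ends i (by omega), fun i hi i' hi' => hE.edge_inj i (by omega) i' (by omega),
          fun i i' hi hij hi' => hE.inner_inj i i' hi (by omega) (by omega),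
          fun i hi => hE.notMem i (by omega)⟩
        (fun i hi => hκ i (by omega)) (fun i hi => hQ i (by omega)) (fun h => h ▸ hjD) h0
        (Or.inl hjD)
      obtain ⟨D₂, hD₂, h₂⟩ := ih (k - j) (by omega) (x := fun i => x (j + i))
        (ee := fun i => ee (j + i)) h₁ (by omega)
        ⟨fun i hi => hE.ends (j + i) (by omega),
          fun i hi i' hi' h => by
            have := hE.edge_inj _ (by omega) _ (by omega) h
            omega,
          fun i i' hi hij hi' h => by
            have := hE.inner_inj _ _ (by omega) (by omega) (by omega) h
            omega,
          fun i hi => by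
            rintro (h | ⟨i', hi', h⟩)
            · exact hE.notMem _ (by omega) h
            · have := hE.edge_inj _ (by omega) _ (by omega) h
              omega⟩
        (fun i hi => hκ _ (by omega))
        (fun i hi => (hQ (j + i) (by omega)).imp_left fun h => hD₁ h)
        (fun _ => hD₁ hjD) (Or.inl (hD₁ hjD))
        (by
          simp only [show j + (k - j) = k by omega]
          exact hl.imp (fun h => hD₁ h) fun ⟨e, he, hv⟩ => ⟨e, Or.inl he, hv⟩)
      refine ⟨D₂, hD₁.trans hD₂, ?_⟩
      convert h₂ using 1
      rw [Set.union_assoc]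
      congr 1
      ext e
      constructor
      · rintro ⟨i, hi, rfl⟩
        by_cases hij : i < j
        · exact Or.inl ⟨i, hij, rfl⟩
        · exact Or.inr ⟨i - j, by omega, congrArg ee (by omega)⟩
      · rintro (⟨i, hi, rfl⟩ | ⟨i, hi, rfl⟩)
        · exact ⟨i, by omega, rfl⟩
        · exact ⟨j + i, by omega, rfl⟩
    · push Not at hin
      exact ⟨_, Set.subset_union_left, h.add_minimal_ear hk hE hκ hQ hclosed hin h0 hl⟩

/-- Adding an ear given by lists of vertices and edges. -/
theorem Numbered.add_list_ear [Finite G.E] (h : Numbered r κ Q c H D) {a b : G.V}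
    {vs : List G.V} {es : List G.E} (hlink : G.IsLink (a :: (vs ++ [b])) es) (hes : es.Nodup)
    (hvs : vs.Nodup) (ha : a ∉ vs) (hb : b ∉ vs) (hH : ∀ e ∈ es, e ∉ H)
    (hκ : ∀ e ∈ es, κ e ≤ c) (hQ : ∀ v ∈ a :: (vs ++ [b]), v ∈ D ∨ Q c v)
    (hab : a = b → a ∈ D) (h0 : a ∈ D ∨ a ∈ G.vertsOf H) (hl : b ∈ D ∨ b ∈ G.vertsOf H) :
    ∃ D', D ⊆ D' ∧ Numbered r κ Q c (H ∪ {e | e ∈ es}) D' := by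
  have hlen : es.length = vs.length + 1 := by
    have := hlink.length_eq
    simp at this
    omega
  have hpos : 0 < es.length := by omega
  let x : ℕ → G.V := fun i => (a :: (vs ++ [b])).getD i a
  let ee : ℕ → G.E := fun i => es.getD i es[0]
  have hx : ∀ i (hi : i < (a :: (vs ++ [b])).length), x i = (a :: (vs ++ [b]))[i] :=
    fun i hi => List.getD_eq_getElem _ _ hi
  have hee : ∀ i (hi : i < es.length), ee i = es[i] := fun i hi => List.getD_eq_getElem _ _ hi
  have hx0 : x 0 = a := rfl
  have hxk : x es.length = b := by
    rw [hx _ (by simp; omega)]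
    simp [hlen]
  have hxi : ∀ i (hi : i < vs.length), x (i + 1) = vs[i] := by
    intro i hi
    rw [hx _ (by simp; omega)]
    simp [List.getElem_append_left hi]
  have hE : IsEar H es.length x ee := by
    refine ⟨fun i hi => ?_, fun i hi j hj hij => ?_, fun i j hi hik hj hij => ?_,
      fun i hi => ?_⟩
    · rw [hee i hi, hx i (by simp; omega), hx (i + 1) (by simp; omega)]
      exact hlink.ends_getElem hi _ _
    · rw [hee i hi, hee j hj] at hij
      exact hes.getElem_inj_iff.1 hij
    · obtain ⟨i, rfl⟩ : ∃ i', i = i' + 1 := ⟨i - 1, by omega⟩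
      rw [hxi i (by omega)] at hij
      rcases Nat.eq_zero_or_pos j with rfl | hj0
      · rw [hx0] at hij
        exact absurd (hij ▸ List.getElem_mem _) ha
      rcases hj.lt_or_eq with hjk | rfl
      · obtain ⟨j, rfl⟩ : ∃ j', j = j' + 1 := ⟨j - 1, by omega⟩
        rw [hxi j (by omega)] at hij
        rw [hvs.getElem_inj_iff.1 hij]
      · rw [hxk] at hij
        exact absurd (hij ▸ List.getElem_mem _) hb
    · rw [hee i hi]
      exact hH _ (List.getElem_mem hi)
  obtain ⟨D', hD', hN⟩ := h.add_ear hpos hE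
    (fun i hi => by rw [hee i hi]; exact hκ _ (List.getElem_mem hi))
    (fun i hi => by
      have hi' : i < (a :: (vs ++ [b])).length := by simp; omega
      rw [hx i hi']
      exact hQ _ (List.getElem_mem hi'))
    (by rw [hx0, hxk]; exact hab) (by rwa [hx0]) (by rwa [hxk])
  refine ⟨D', hD', ?_⟩
  convert hN using 2
  ext e
  constructor
  · intro he
    obtain ⟨i, hi, rfl⟩ := List.getElem_of_mem he
    exact ⟨i, hi, hee i hi⟩
  · rintro ⟨i, hi, rfl⟩
    rw [hee i hi]
    exact List.getElem_mem hi

end Numbering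

/-! ### Numbering along a chain decomposition -/

theorem IsChain.symm {r : G.V} {H Hb C : Set G.E} (h : G.IsChain r H Hb C) :
    G.IsChain r Hb H C := by
  rcases h with h | h | ⟨u, v, e, h₁, h₂, h₃, h₄, h₅, h₆⟩
  · exact Or.inr (Or.inl h)
  · exact Or.inl h
  · exact Or.inr (Or.inr ⟨v, u, e, h₂, h₁, h₃, h₄.trans Sym2.eq_swap, h₆, h₅⟩)

theorem IsLink.mem_of_mem_ends {vs : List G.V} {es : List G.E} (h : G.IsLink vs es) {e : G.E}
    (he : e ∈ es) {v : G.V} (hv : v ∈ G.ends e) : v ∈ vs := by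
  obtain ⟨i, hi, rfl⟩ := List.getElem_of_mem he
  have hlen := h.length_eq
  rw [h.ends_getElem hi (by omega) (by omega), Sym2.mem_iff] at hv
  rcases hv with rfl | rfl <;> exact List.getElem_mem _

theorem IsUpChain.deg_of_mem {r : G.V} {H Hb C : Set G.E} (h : G.IsUpChain r H Hb C) {v : G.V}
    (hv : v ∈ G.vertsOf C) : v = r ∨ 2 ≤ G.deg Hb v := by
  obtain ⟨e, he, hve⟩ := hv
  rcases h with ⟨-, -, vs, es, hp, -, rfl, hdeg, -⟩ | ⟨u, -, -, vs, es, hc, rfl, hdeg, -⟩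
  · exact hdeg v (hp.2.2.mem_of_mem_ends he hve)
  · have := hc.2.2.2.mem_of_mem_ends he hve
    exact hdeg v (by simpa [or_comm, or_left_comm] using this)

theorem IsChain.deg_of_mem {r : G.V} {H Hb C : Set G.E} (h : G.IsChain r H Hb C) {v : G.V}
    (hv : v ∈ G.vertsOf C) : v = r ∨ 2 ≤ G.deg H v ∨ 2 ≤ G.deg Hb v := by
  rcases h with h | h | ⟨a, b, e, -, -, rfl, hab, ha, hb⟩
  · exact (h.deg_of_mem hv).imp_right Or.inr
  · exact (IsUpChain.deg_of_mem h hv).imp_right Or.inl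
  · obtain ⟨e', rfl, hve⟩ := hv
    rw [hab, Sym2.mem_iff] at hve
    rcases hve with rfl | rfl
    · exact ha.imp_right Or.inl
    · exact hb.imp_right Or.inr

theorem Numbered.add_chain [Finite G.E] {r : G.V} {κ : G.E → ℕ} {Q : ℕ → G.V → Prop} {c : ℕ}
    {H Hb C : Set G.E} {D : Set G.V} (h : Numbered r κ Q c H D) (hC : G.IsChain r H Hb C)
    (hκ : ∀ e ∈ C, κ e ≤ c)
    (hQ : ∀ v, G.deg H v ≤ 1 → 2 ≤ G.deg Hb v → Q c v) :
    ∃ D', Numbered r κ Q c (H ∪ C) D' := by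
  have hr := h.root_mem
  have hdeg : ∀ v, v = r ∨ 2 ≤ G.deg H v → v ∈ D := by
    rintro v (rfl | hv)
    · exact hr
    · by_contra hD
      have := h.deg_le_one hD
      omega
  have hQ' : ∀ v, v = r ∨ 2 ≤ G.deg Hb v → v ∈ D ∨ Q c v := by
    rintro v (rfl | hv)
    · exact Or.inl hr
    · by_cases hD : v ∈ D
      · exact Or.inl hD
      · exact Or.inr (hQ v (h.deg_le_one hD) hv)
  have hr' : ∀ v, v = r ∨ v ∈ G.vertsOf H → v ∈ D ∨ v ∈ G.vertsOf H :=
    fun v hv => hv.imp_left fun h : v = r => h ▸ hr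
  rcases hC with (hC | ⟨v, hC⟩) | hC | ⟨u, v, e, heH, -, rfl, huv, hu, hv⟩
  · obtain ⟨hCH, -, vs, es, ⟨hvs, hes, hlink⟩, hne, rfl, hall, hhead, hlast⟩ := hC
    match vs, es, hlink, hne with
    | a :: b' :: vs', es, hlink, hne =>
      obtain ⟨ws, b, hws⟩ : ∃ ws b, b' :: vs' = ws ++ [b] :=
        ⟨_, _, (List.dropLast_append_getLast (List.cons_ne_nil b' vs')).symm⟩
      rw [hws] at hvs hlink hall hhead hlast
      have hnd := List.nodup_cons.1 hvs
      have hnd' := List.nodup_append.1 hnd.2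
      have hab : a ∉ ws ∧ a ≠ b := by simpa using hnd.1
      obtain ⟨D', -, hN⟩ := h.add_list_ear hlink hes hnd'.1 hab.1
        (fun hb => hnd'.2.2 b hb b (by simp) rfl)
        (fun e he he' => Set.disjoint_left.1 hCH he he') hκ (fun v hv => hQ' v (hall v hv))
        (fun h => absurd h hab.2) (hr' a (hhead a rfl))
        (hr' b (hlast b (by rw [← List.cons_append, List.getLast?_concat])))
      exact ⟨D', hN⟩
    | [_], [], _, hne => exact absurd rfl hne
  · obtain ⟨hCH, -, vs, es, ⟨hvs, hes, -, hlink⟩, rfl, hall, hv⟩ := hC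
    have hnd := List.nodup_cons.1 hvs
    obtain ⟨D', -, hN⟩ := h.add_list_ear hlink hes hnd.2 hnd.1 hnd.1
      (fun e he he' => Set.disjoint_left.1 hCH he he') hκ
      (fun u hu => hQ' u (hall u (by simpa [or_comm, or_left_comm] using hu)))
      (fun _ => hdeg v hv) (Or.inl (hdeg v hv)) (Or.inl (hdeg v hv))
    exact ⟨D', hN⟩
  · have hCH : Disjoint C H := by
      rcases hC with hC | ⟨v, hC⟩
      · exact hC.2.1
      · exact hC.2.1
    exact ⟨D, h.union_of_ends_mem hCH hκ fun v hv => hdeg v (IsUpChain.deg_of_mem hC hv)⟩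
  · have huD := hdeg u hu
    by_cases hvH : v ∈ D ∨ v ∉ G.vertsOf H
    · rw [Set.union_singleton]
      exact ⟨D, h.insert_edge heH (hκ e rfl) huv huD hvH⟩
    · push Not at hvH
      have hne : u ≠ v := fun h => hvH.1 (h ▸ huD)
      obtain ⟨D', -, hN⟩ := h.add_list_ear (a := u) (b := v) (vs := []) (es := [e])
        ⟨huv, trivial⟩ (by simp) (by simp) (by simp) (by simp) (by simpa using heH)
        (by simpa using hκ) (by simpa using ⟨Or.inl huD, hQ' v hv⟩) (fun h => absurd h hne)
        (Or.inl huD) (Or.inr hvH.2)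
      exact ⟨D', by simpa using hN⟩

/-- The set of edges of level less than `c` has a partial numbering. -/
theorem exists_numbered [Finite G.E] {r : G.V} {κ : G.E → ℕ} {n : ℕ}
    (hchain : ∀ c < n, G.IsChain r {e | κ e < c} {e | c < κ e} {e | κ e = c}) {c : ℕ}
    (hc : c ≤ n) :
    ∃ D, Numbered r κ (fun c v => G.deg {e | κ e < c} v ≤ 1 ∧ 2 ≤ G.deg {e | c < κ e} v) c
      {e | κ e < c} D := by
  induction c with
  | zero =>
    refine ⟨{r}, fun _ => 0, fun _ => 0, fun _ => 1, fun _ => 0, rfl, ?_, ?_, ?_, ?_, ?_, ?_, ?_,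
      ?_⟩ <;> simp +contextual
  | succ c ih =>
    obtain ⟨D, hD⟩ := ih (by omega)
    obtain ⟨D', hD'⟩ := hD.add_chain (hchain c (by omega)) (fun e he => le_of_eq he)
      (fun v h₁ h₂ => ⟨h₁, h₂⟩)
    refine ⟨D', ?_⟩
    convert hD'.mono_level (Nat.le_succ c) using 1
    ext e
    exact Nat.lt_succ_iff_lt_or_eq

/-- Two independent spanning trees in which the root paths of `v` only use
levels up to `t v`. -/
theorem exists_two_trees [Finite G.V] [Finite G.E] (hni : G.NoIsolated) {r : G.V}
    {κ : G.E → ℕ} {n : ℕ} (hn : ∀ e, κ e < n)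
    (hchain : ∀ c < n, G.IsChain r {e | κ e < c} {e | c < κ e} {e | κ e = c}) :
    ∃ (T₁ T₂ : Sub G) (t : G.V → ℕ),
      (T₁.IsTree ∧ T₁.Spanning) ∧ (T₂.IsTree ∧ T₂.Spanning) ∧
      (∀ v, v ≠ r → G.deg {e | κ e < t v} v ≤ 1 ∧ 2 ≤ G.deg {e | t v < κ e} v) ∧
      (∀ v vs es, T₁.PathIn r v vs es → ∀ e ∈ es, v ≠ r ∧ κ e ≤ t v) ∧
      (∀ v vs es, T₂.PathIn r v vs es → ∀ e ∈ es, v ≠ r ∧ κ e ≤ t v) ∧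
      G.EdgeIndependent r T₁ T₂ := by
  obtain ⟨D, hD⟩ := exists_numbered hchain le_rfl
  have huniv : {e | κ e < n} = (Set.univ : Set G.E) := Set.eq_univ_of_forall hn
  have hall : ∀ v, v ∈ D := by
    intro v
    by_contra hv
    have hle := hD.deg_le_one hv
    rw [huniv] at hle
    obtain ⟨e, he⟩ := hni v
    rcases (hchain (κ e) (hn e)).deg_of_mem ⟨e, rfl, he⟩ with rfl | h | h
    · exact hv hD.root_mem
    all_goals
      have := h.trans (deg_mono (Set.subset_univ _) v)
      omega
  obtain ⟨f, lo, hi, t, hN⟩ := hD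
  have hlo := fun v => hN.lo_exit v (hall v)
  have hhi := fun v => hN.hi_exit v (hall v)
  have : Nonempty G.V := ⟨r⟩
  have : Nonempty G.E := ⟨(hni r).choose⟩
  choose! pe₁ _ p₁ _ hends₁ hf₁ hlt₁ hκ₁ ht₁ using hlo
  choose! pe₂ _ p₂ _ hends₂ hf₂ hlt₂ hκ₂ ht₂ using hhi
  have path₁ : ∀ v vs es, (parentSub r pe₁).PathIn r v vs es → ∀ e ∈ es,
      v ≠ r ∧ κ e ≤ t v ∧ f e ≤ lo v := by
    intro v vs es h
    refine parentSub_path (P := fun v => {e | v ≠ r ∧ κ e ≤ t v ∧ f e ≤ lo v}) hends₁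
      (fun v hv => ⟨hv, hκ₁ v hv, (hf₁ v hv).le⟩) (fun v hv e he => ?_) h
    exact ⟨hv, he.2.1.trans (ht₁ v hv), he.2.2.trans (hlt₁ v hv).le⟩
  have path₂ : ∀ v vs es, (parentSub r pe₂).PathIn r v vs es → ∀ e ∈ es,
      v ≠ r ∧ κ e ≤ t v ∧ hi v ≤ f e := by
    intro v vs es h
    refine parentSub_path (P := fun v => {e | v ≠ r ∧ κ e ≤ t v ∧ hi v ≤ f e}) hends₂
      (fun v hv => ⟨hv, hκ₂ v hv, (hf₂ v hv).ge⟩) (fun v hv e he => ?_) h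
    exact ⟨hv, he.2.1.trans (ht₂ v hv), (hlt₂ v hv).le.trans he.2.2⟩
  refine ⟨parentSub r pe₁, parentSub r pe₂, t, ⟨parentSub_isTree hends₁ hlt₁, rfl⟩,
    ⟨parentSub_isTree (ρ := fun v => - hi v) hends₂ (fun v hv => neg_lt_neg (hlt₂ v hv)), rfl⟩,
    fun v => hN.time_spec v (hall v),
    fun v vs es h e he => ⟨(path₁ v vs es h e he).1, (path₁ v vs es h e he).2.1⟩,
    fun v vs es h e he => ⟨(path₂ v vs es h e he).1, (path₂ v vs es h e he).2.1⟩,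
    trivial, trivial, ?_⟩
  intro v _ vs₁ es₁ vs₂ es₂ h₁ h₂ e he₁ he₂
  have := (path₁ v _ _ h₁ e he₁).2.2
  have := (path₂ v _ _ h₂ e he₂).2.2
  have := hN.lo_lt_hi v (hall v)
  linarith

theorem EdgeIndependent.symm {r : G.V} {T₁ T₂ : Sub G} (h : G.EdgeIndependent r T₁ T₂) :
    G.EdgeIndependent r T₂ T₁ :=
  ⟨h.2.1, h.1, fun v hv _ _ _ _ h₁ h₂ e he₁ he₂ =>
    h.2.2 v hv.symm _ _ _ _ h₂ h₁ e he₂ he₁⟩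

/-- The level of an edge is the index of the chain containing it. -/
theorem IsChainDecomp.exists_level {r : G.V} {n : ℕ} {Gs : Fin n → Set G.E}
    (h : G.IsChainDecomp r Gs) :
    ∃ κ : G.E → ℕ, (∀ e, κ e < n) ∧
      ∀ c < n, G.IsChain r {e | κ e < c} {e | c < κ e} {e | κ e = c} := by
  obtain ⟨hdisj, hunion, hchain⟩ := h
  have hex : ∀ e, ∃ i, e ∈ Gs i := fun e => Set.mem_iUnion.1 (hunion ▸ Set.mem_univ e)
  choose κ hκ using hex
  have hiff : ∀ e i, e ∈ Gs i ↔ κ e = i := by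
    refine fun e i => ⟨fun he => ?_, fun h => h ▸ hκ e⟩
    by_contra hne
    exact Set.disjoint_left.1 (hdisj _ _ hne) (hκ e) he
  refine ⟨fun e => (κ e).1, fun e => (κ e).2, fun c hc => ?_⟩
  convert hchain ⟨c, hc⟩ using 1
  · ext e
    simp [before, hiff, Fin.lt_def]
  · ext e
    simp [after, hiff, Fin.lt_def]
  · ext e
    simp [hiff, Fin.ext_iff]

end MG

theorem trees_from_chain_decomposition (G : MG) [Finite G.V] [Finite G.E]
    (hni : G.NoIsolated) (r : G.V) (h : G.HasChainDecomp r) : G.HasFourEIST r := by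
  obtain ⟨m, Gs, hGs⟩ := h
  obtain ⟨κ, hκ, hchain⟩ := hGs.exists_level
  obtain ⟨T₁, T₂, t, hT₁, hT₂, ht, hp₁, hp₂, h₁₂⟩ := MG.exists_two_trees hni hκ hchain
  obtain ⟨T₃, T₄, t', hT₃, hT₄, ht', hp₃, hp₄, h₃₄⟩ :=
    MG.exists_two_trees (κ := fun e => m - κ e) (n := m + 1) (r := r) hni
      (fun e => by omega) (fun c hc => by
        convert (hchain (m - c) (by omega)).symm using 1 <;> ext e <;> have := hκ e <;>
          simp only [Set.mem_ofPred_eq] <;> omega)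
  have hspan : ∀ {T : MG.Sub G}, T.Spanning → r ∈ T.verts := fun h => h ▸ Set.mem_univ r
  have hcross : ∀ {T T' : MG.Sub G}, T.Spanning → T'.Spanning →
      (∀ v vs es, T.PathIn r v vs es → ∀ e ∈ es, v ≠ r ∧ κ e ≤ t v) →
      (∀ v vs es, T'.PathIn r v vs es → ∀ e ∈ es, v ≠ r ∧ m - κ e ≤ t' v) →
      G.EdgeIndependent r T T' := by
    intro T T' hT hT' hp hp'
    refine ⟨hspan hT, hspan hT', fun v _ vs₁ es₁ vs₂ es₂ h₁ h₂ e he₁ he₂ => ?_⟩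
    obtain ⟨hv, hle⟩ := hp v _ _ h₁ e he₁
    obtain ⟨-, hle'⟩ := hp' v _ _ h₂ e he₂
    have hsub : {e | t v < κ e} ⊆ {e | m - κ e < t' v} := by
      intro e' he'
      have := hκ e'
      simp only [Set.mem_ofPred_eq] at he' ⊢
      omega
    have := (ht v hv).2.trans (MG.deg_mono hsub v)
    have := (ht' v hv).1
    omega
  have h₁₃ := hcross hT₁.2 hT₃.2 hp₁ hp₃
  have h₁₄ := hcross hT₁.2 hT₄.2 hp₁ hp₄
  have h₂₃ := hcross hT₂.2 hT₃.2 hp₂ hp₃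
  have h₂₄ := hcross hT₂.2 hT₄.2 hp₂ hp₄
  refine ⟨![T₁, T₂, T₃, T₄], fun i => ?_, fun i j hij => ?_⟩
  · fin_cases i <;> assumption
  · fin_cases i <;> fin_cases j <;>
      first
        | exact absurd rfl hij
        | assumption
        | (apply MG.EdgeIndependent.symm; assumption)
end
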